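/- arXiv:1702.03355 — 3 statements merged into one kernel-verified Lean document; each statement's English description precedes it below -/
import Mathlib

section
/- Let S = sgp^+⟨a, b | a^k b = b⟩ with a ≠ b and k ≥ 1. Then S is prefix-automatic but S is not biautomatic. -/
/-!  Common definitions, following the conventions of the paper
"Automaticity of one-relator semigroups with length less than or equal to three".

Words over an alphabet `α` are modelled as `List α`; the empty word is `[]`.
The padded alphabet `A(2,$)` is modelled inside `Option α × Option α`,
where `none` plays the role of the padding symbol `$` (the pair `(none, none)`
never occurs in a padded convolution). -/

/-- A regular set of words: one accepted by a DFA with finitely many states. -/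
abbrev IsReg {α : Type*} (L : Set (List α)) : Prop :=
  Language.IsRegular (L : Language α)

/-- Right-padded convolution `(x,y)δᴿ`: align the two words letter by letter
from the left and pad the shorter one on the right with the padding symbol. -/
def padR {α : Type*} (x y : List α) : List (Option α × Option α) :=
  (x.map some ++ List.replicate (y.length - x.length) none).zip
    (y.map some ++ List.replicate (x.length - y.length) none)

/-- Left-padded convolution `(x,y)δᴸ`: align the two words letter by letter
from the right and pad the shorter one on the left with the padding symbol. -/
def padL {α : Type*} (x y : List α) : List (Option α × Option α) :=
  (List.replicate (y.length - x.length) none ++ x.map some).zip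
    (List.replicate (x.length - y.length) none ++ y.map some)

/-- One elementary rewriting step: replace a factor `u` by `v`
for some defining relation `(u, v) ∈ R` (in either direction via `Relation.EqvGen`). -/
def OneStep {α : Type*} (R : Set (List α × List α)) (x y : List α) : Prop :=
  ∃ p u v s, (u, v) ∈ R ∧ x = p ++ u ++ s ∧ y = p ++ v ++ s

/-- Equality of two words in the semigroup `sgp⁺⟨α ∣ R⟩` (resp. the monoid
`sgp⟨α ∣ R⟩`): the congruence on words generated by the relations `R`. -/
def WordEq {α : Type*} (R : Set (List α × List α)) : List α → List α → Prop :=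
  Relation.EqvGen (OneStep R)

/-- Expansion of a word over an abstract generating set `β` into a word over the
presentation alphabet `α`, where `g b` is a word representing the generator `b`. -/
def expandW {α β : Type*} (g : β → List α) (w : List β) : List α :=
  (w.map g).flatten

/-- `(g, L)` is an automatic structure for the semigroup `sgp⁺⟨α ∣ R⟩` with
respect to the finite generating set indexed by `β`:  each generator `b` is the
element of the semigroup represented by the nonempty word `g b`, the language
`L ⊆ β⁺` is regular and maps onto the semigroup, and `L_ε^$` together with all
`L_b^$` (right multiplication, right padding) are regular. -/
structure SgpAutoStruct {α β : Type*} (R : Set (List α × List α))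
    (g : β → List α) (L : Set (List β)) : Prop where
  gen_ne : ∀ b, g b ≠ []
  reg : IsReg L
  ne : ∀ w ∈ L, w ≠ []
  onto : ∀ w : List α, w ≠ [] → ∃ x ∈ L, WordEq R (expandW g x) w
  eq_reg : IsReg {p | ∃ x ∈ L, ∃ y ∈ L,
      WordEq R (expandW g x) (expandW g y) ∧ p = padR x y}
  mul_reg : ∀ b : β, IsReg {p | ∃ x ∈ L, ∃ y ∈ L,
      WordEq R (expandW g x ++ g b) (expandW g y) ∧ p = padR x y}

/-- A prefix-automatic structure for `sgp⁺⟨α ∣ R⟩`: an automatic structure for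
which moreover `L'_= = {(x,y)δᴿ : x ∈ L, y ∈ Pref(L), x = y in S}` is regular. -/
structure SgpPrefixAutoStruct {α β : Type*} (R : Set (List α × List α))
    (g : β → List α) (L : Set (List β)) extends SgpAutoStruct R g L : Prop where
  pre_reg : IsReg {p | ∃ x ∈ L, ∃ y : List β, (∃ z ∈ L, y <+: z) ∧
      WordEq R (expandW g x) (expandW g y) ∧ p = padR x y}

/-- A biautomatic structure for the semigroup `sgp⁺⟨α ∣ R⟩`: the languages
`L_b^$`, `_bL^$`, `^$L_b` and `_b^$L` are regular for every `b ∈ β ∪ {ε}`. -/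
structure SgpBiautoStruct {α β : Type*} (R : Set (List α × List α))
    (g : β → List α) (L : Set (List β)) : Prop where
  gen_ne : ∀ b, g b ≠ []
  reg : IsReg L
  ne : ∀ w ∈ L, w ≠ []
  onto : ∀ w : List α, w ≠ [] → ∃ x ∈ L, WordEq R (expandW g x) w
  eqR_reg : IsReg {p | ∃ x ∈ L, ∃ y ∈ L,
      WordEq R (expandW g x) (expandW g y) ∧ p = padR x y}
  eqL_reg : IsReg {p | ∃ x ∈ L, ∃ y ∈ L,
      WordEq R (expandW g x) (expandW g y) ∧ p = padL x y}
  mulRR_reg : ∀ b : β, IsReg {p | ∃ x ∈ L, ∃ y ∈ L,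
      WordEq R (expandW g x ++ g b) (expandW g y) ∧ p = padR x y}
  mulLR_reg : ∀ b : β, IsReg {p | ∃ x ∈ L, ∃ y ∈ L,
      WordEq R (g b ++ expandW g x) (expandW g y) ∧ p = padR x y}
  mulRL_reg : ∀ b : β, IsReg {p | ∃ x ∈ L, ∃ y ∈ L,
      WordEq R (expandW g x ++ g b) (expandW g y) ∧ p = padL x y}
  mulLL_reg : ∀ b : β, IsReg {p | ∃ x ∈ L, ∃ y ∈ L,
      WordEq R (g b ++ expandW g x) (expandW g y) ∧ p = padL x y}

/-- The semigroup `sgp⁺⟨α ∣ R⟩` is automatic: it admits an automatic structure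
over some finite generating set. -/
def SgpAutomatic {α : Type*} (R : Set (List α × List α)) : Prop :=
  ∃ (β : Type) (_ : Fintype β) (g : β → List α) (L : Set (List β)),
    SgpAutoStruct R g L

/-- The semigroup `sgp⁺⟨α ∣ R⟩` is prefix-automatic. -/
def SgpPrefixAutomatic {α : Type*} (R : Set (List α × List α)) : Prop :=
  ∃ (β : Type) (_ : Fintype β) (g : β → List α) (L : Set (List β)),
    SgpPrefixAutoStruct R g L

/-- The semigroup `sgp⁺⟨α ∣ R⟩` is biautomatic. -/
def SgpBiautomatic {α : Type*} (R : Set (List α × List α)) : Prop :=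
  ∃ (β : Type) (_ : Fintype β) (g : β → List α) (L : Set (List β)),
    SgpBiautoStruct R g L

/-- `(g, L)` is an automatic structure for the monoid `sgp⟨α ∣ R⟩` with respect
to a finite generating set indexed by `β`; generators may represent any element
of the monoid (in particular the identity, represented by the empty word). -/
structure MonAutoStruct {α β : Type*} (R : Set (List α × List α))
    (g : β → List α) (L : Set (List β)) : Prop where
  reg : IsReg L
  ne : ∀ w ∈ L, w ≠ []
  onto : ∀ w : List α, ∃ x ∈ L, WordEq R (expandW g x) w
  eq_reg : IsReg {p | ∃ x ∈ L, ∃ y ∈ L,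
      WordEq R (expandW g x) (expandW g y) ∧ p = padR x y}
  mul_reg : ∀ b : β, IsReg {p | ∃ x ∈ L, ∃ y ∈ L,
      WordEq R (expandW g x ++ g b) (expandW g y) ∧ p = padR x y}

/-- A prefix-automatic structure for the monoid `sgp⟨α ∣ R⟩`. -/
structure MonPrefixAutoStruct {α β : Type*} (R : Set (List α × List α))
    (g : β → List α) (L : Set (List β)) extends MonAutoStruct R g L : Prop where
  pre_reg : IsReg {p | ∃ x ∈ L, ∃ y : List β, (∃ z ∈ L, y <+: z) ∧
      WordEq R (expandW g x) (expandW g y) ∧ p = padR x y}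

/-- A biautomatic structure for the monoid `sgp⟨α ∣ R⟩`. -/
structure MonBiautoStruct {α β : Type*} (R : Set (List α × List α))
    (g : β → List α) (L : Set (List β)) : Prop where
  reg : IsReg L
  ne : ∀ w ∈ L, w ≠ []
  onto : ∀ w : List α, ∃ x ∈ L, WordEq R (expandW g x) w
  eqR_reg : IsReg {p | ∃ x ∈ L, ∃ y ∈ L,
      WordEq R (expandW g x) (expandW g y) ∧ p = padR x y}
  eqL_reg : IsReg {p | ∃ x ∈ L, ∃ y ∈ L,
      WordEq R (expandW g x) (expandW g y) ∧ p = padL x y}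
  mulRR_reg : ∀ b : β, IsReg {p | ∃ x ∈ L, ∃ y ∈ L,
      WordEq R (expandW g x ++ g b) (expandW g y) ∧ p = padR x y}
  mulLR_reg : ∀ b : β, IsReg {p | ∃ x ∈ L, ∃ y ∈ L,
      WordEq R (g b ++ expandW g x) (expandW g y) ∧ p = padR x y}
  mulRL_reg : ∀ b : β, IsReg {p | ∃ x ∈ L, ∃ y ∈ L,
      WordEq R (expandW g x ++ g b) (expandW g y) ∧ p = padL x y}
  mulLL_reg : ∀ b : β, IsReg {p | ∃ x ∈ L, ∃ y ∈ L,
      WordEq R (g b ++ expandW g x) (expandW g y) ∧ p = padL x y}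

/-- The monoid `sgp⟨α ∣ R⟩` is automatic. -/
def MonAutomatic {α : Type*} (R : Set (List α × List α)) : Prop :=
  ∃ (β : Type) (_ : Fintype β) (g : β → List α) (L : Set (List β)),
    MonAutoStruct R g L

/-- The monoid `sgp⟨α ∣ R⟩` is prefix-automatic. -/
def MonPrefixAutomatic {α : Type*} (R : Set (List α × List α)) : Prop :=
  ∃ (β : Type) (_ : Fintype β) (g : β → List α) (L : Set (List β)),
    MonPrefixAutoStruct R g L

/-- The monoid `sgp⟨α ∣ R⟩` is biautomatic. -/
def MonBiautomatic {α : Type*} (R : Set (List α × List α)) : Prop :=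
  ∃ (β : Type) (_ : Fintype β) (g : β → List α) (L : Set (List β)),
    MonBiautoStruct R g L

/-- The defining relations of `S¹ = sgp⁺⟨α, e ∣ R, ea = ae = a, ee = e⟩`,
the monoid obtained from `S = sgp⁺⟨α ∣ R⟩` by adjoining an identity element,
presented as a semigroup over the alphabet `Option α` where `none` is the new
identity letter `e`. -/
def adjoinOne {α : Type*} (R : Set (List α × List α)) :
    Set (List (Option α) × List (Option α)) :=
  {q | ∃ p ∈ R, q = (p.1.map some, p.2.map some)} ∪
    {q | ∃ a : α, q = ([none, some a], [some a])} ∪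
    {q | ∃ a : α, q = ([some a, none], [some a])} ∪
    {([none, none], [none])}

section Helpers

lemma s7_filterMap_zip_fst {γ δ : Type*} : ∀ (l1 : List (Option γ)) (l2 : List δ),
    l1.length = l2.length → (l1.zip l2).filterMap Prod.fst = l1.filterMap id
  | [], _, _ => by simp
  | x :: l1, [], h => by simp at h
  | x :: l1, y :: l2, h => by
      have ih := s7_filterMap_zip_fst l1 l2 (by simpa using h)
      cases x <;> simp [ih]

lemma s7_filterMap_zip_snd {γ δ : Type*} : ∀ (l1 : List δ) (l2 : List (Option γ)),
    l1.length = l2.length → (l1.zip l2).filterMap Prod.snd = l2.filterMap id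
  | [], [], _ => by simp
  | [], y :: l2, h => by simp at h
  | x :: l1, [], h => by simp at h
  | x :: l1, y :: l2, h => by
      have ih := s7_filterMap_zip_snd l1 l2 (by simpa using h)
      cases y <;> simp [ih]

lemma s7_fm {γ : Type*} (x : List γ) (n : ℕ) :
    (List.replicate n none ++ x.map some).filterMap id = x := by
  have h : (List.replicate n (none : Option γ)).filterMap id = [] := by
    induction n with
    | zero => rfl
    | succ n ih => simp [List.replicate_succ]
  rw [List.filterMap_append, h]
  simp [List.filterMap_map]

lemma s7_padL_fst {γ : Type*} (x y : List γ) : (padL x y).filterMap Prod.fst = x := by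
  unfold padL
  rw [s7_filterMap_zip_fst, s7_fm]
  simp; omega

lemma s7_padL_snd {γ : Type*} (x y : List γ) : (padL x y).filterMap Prod.snd = y := by
  unfold padL
  rw [s7_filterMap_zip_snd, s7_fm]
  simp; omega

lemma s7_padL_split {γ : Type*} (x1 x2 y : List γ) (h : x2.length = y.length) :
    padL (x1 ++ x2) y = x1.map (fun c => (some c, none)) ++ padL x2 y := by
  unfold padL
  simp only [List.length_append, h]
  rw [show y.length - (x1.length + y.length) = 0 by omega,
    show x1.length + y.length - y.length = x1.length by omega]
  simp only [Nat.sub_self, List.replicate_zero, List.nil_append, List.map_append]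
  rw [List.zip_append (by simp)]
  congr 1
  induction x1 with
  | nil => rfl
  | cons c x ih => simp [List.replicate_succ, ih]

/-- quotient-closed finite families give regular languages -/
lemma s7_reg_family {γ : Type*} (F : Set (Set (List γ))) (hfin : F.Finite)
    (hcl : ∀ X ∈ F, ∀ c, {w | c :: w ∈ X} ∈ F) (X : Set (List γ)) (hX : X ∈ F) : IsReg X := by
  apply Language.IsRegular.of_finite_range_leftQuotient
  refine hfin.subset ?_
  rintro _ ⟨x, rfl⟩
  induction x generalizing X with
  | nil => exact hX
  | cons c x ih => exact ih _ (hcl X hX c)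

/-- words of padded pairs -/
def s7PP {γ : Type*} (X : Set (List γ × List γ)) : Set (List (Option γ × Option γ)) :=
  {p | ∃ q ∈ X, p = padR q.1 q.2}

/-- derivative of a relation by a padded pair of letters -/
def s7dv {γ : Type*} (X : Set (List γ × List γ)) : Option γ × Option γ → Set (List γ × List γ)
  | (some c, some d) => {q | (c :: q.1, d :: q.2) ∈ X}
  | (some c, none) => {q | q.2 = [] ∧ (c :: q.1, []) ∈ X}
  | (none, some d) => {q | q.1 = [] ∧ ([], d :: q.2) ∈ X}
  | (none, none) => ∅

lemma s7_padR_nil {γ : Type*} : padR ([] : List γ) [] = [] := rfl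
lemma s7_padR_cc {γ : Type*} (c d : γ) (x y : List γ) :
    padR (c :: x) (d :: y) = (some c, some d) :: padR x y := by simp [padR]
lemma s7_padR_cn {γ : Type*} (c : γ) (x : List γ) :
    padR (c :: x) [] = (some c, none) :: padR x [] := by simp [padR, List.replicate_succ]
lemma s7_padR_nc {γ : Type*} (d : γ) (y : List γ) :
    padR [] (d :: y) = (none, some d) :: padR [] y := by simp [padR, List.replicate_succ]

lemma s7_PP_cons {γ : Type*} (X : Set (List γ × List γ)) (c : Option γ × Option γ) :
    {w | c :: w ∈ s7PP X} = s7PP (s7dv X c) := by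
  ext p
  constructor
  · rintro ⟨⟨x, y⟩, hq, he⟩
    cases x with
    | nil =>
      cases y with
      | nil => simp [s7_padR_nil] at he
      | cons d y =>
        simp only [s7_padR_nc, List.cons.injEq] at he
        obtain ⟨rfl, rfl⟩ := he
        exact ⟨([], y), ⟨rfl, hq⟩, rfl⟩
    | cons e x =>
      cases y with
      | nil =>
        simp only [s7_padR_cn, List.cons.injEq] at he
        obtain ⟨rfl, rfl⟩ := he
        exact ⟨(x, []), ⟨rfl, hq⟩, rfl⟩
      | cons d y =>
        simp only [s7_padR_cc, List.cons.injEq] at he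
        obtain ⟨rfl, rfl⟩ := he
        exact ⟨(x, y), hq, rfl⟩
  · rintro ⟨⟨x, y⟩, hq, rfl⟩
    rcases c with ⟨_ | c, _ | d⟩
    · exact hq.elim
    · obtain ⟨h1, h2⟩ := hq
      simp only at h1 h2
      subst h1
      exact ⟨_, h2, (s7_padR_nc _ _).symm⟩
    · obtain ⟨h1, h2⟩ := hq
      simp only at h1 h2
      subst h1
      exact ⟨_, h2, (s7_padR_cn _ _).symm⟩
    · exact ⟨_, hq, (s7_padR_cc _ _ _ _).symm⟩

lemma s7_reg_pairs {γ : Type*} (F : Set (Set (List γ × List γ))) (hfin : F.Finite)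
    (h0 : ∅ ∈ F) (hcl : ∀ X ∈ F, ∀ c, s7dv X c ∈ F) (X : Set (List γ × List γ)) (hX : X ∈ F) :
    IsReg (s7PP {q | q.1 ≠ [] ∧ q ∈ X}) := by
  apply s7_reg_family (s7PP '' (insert {q | q.1 ≠ [] ∧ q ∈ X} F)) ((hfin.insert _).image _)
  · rintro _ ⟨Y, hY, rfl⟩ c
    rw [s7_PP_cons]
    refine Set.mem_image_of_mem _ (Set.mem_insert_of_mem _ ?_)
    rcases hY with rfl | hY
    · rcases c with ⟨_ | c, d⟩
      · convert h0 using 1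
        ext q
        cases d <;> simp [s7dv]
      · convert hcl X hX (some c, d) using 1
        ext q
        cases d <;> simp [s7dv]
    · exact hcl Y hY c
  · exact Set.mem_image_of_mem _ (Set.mem_insert _ _)

lemma s7_we_pre {γ : Type*} {R : Set (List γ × List γ)} (p : List γ) {x y : List γ}
    (h : WordEq R x y) : WordEq R (p ++ x) (p ++ y) := by
  induction h with
  | rel x y h =>
    obtain ⟨p', u, v, s, h, rfl, rfl⟩ := h
    exact .rel _ _ ⟨p ++ p', u, v, s, h, by simp, by simp⟩
  | refl => exact .refl _
  | symm _ _ _ ih => exact .symm _ _ ih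
  | trans _ _ _ _ _ h1 h2 => exact .trans _ _ _ h1 h2

lemma s7_we_suf {γ : Type*} {R : Set (List γ × List γ)} (p : List γ) {x y : List γ}
    (h : WordEq R x y) : WordEq R (x ++ p) (y ++ p) := by
  induction h with
  | rel x y h =>
    obtain ⟨p', u, v, s, h, rfl, rfl⟩ := h
    exact .rel _ _ ⟨p', u, v, s ++ p, h, by simp, by simp⟩
  | refl => exact .refl _
  | symm _ _ _ ih => exact .symm _ _ ih
  | trans _ _ _ _ _ h1 h2 => exact .trans _ _ _ h1 h2

lemma s7_we_inv {γ δ : Type*} {R : Set (List γ × List γ)} (f : List γ → δ)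
    (hf : ∀ p u v s, (u, v) ∈ R → f (p ++ u ++ s) = f (p ++ v ++ s)) {x y : List γ}
    (h : WordEq R x y) : f x = f y := by
  induction h with
  | rel x y h =>
    obtain ⟨p', u, v, s, h, rfl, rfl⟩ := h
    exact hf _ _ _ _ h
  | refl => rfl
  | symm _ _ _ ih => exact ih.symm
  | trans _ _ _ _ _ h1 h2 => exact h1.trans h2

variable {α : Type} [DecidableEq α] (a b : α) (k : ℕ)

/-- number of trailing letters after the last `b` -/
def s7T (t : ℕ) (w : List α) : ℕ := w.foldl (fun t c => if c = b then 0 else t + 1) t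

lemma s7_T_append (t : ℕ) (u v : List α) : s7T b t (u ++ v) = s7T b (s7T b t u) v := by
  simp [s7T]

lemma s7_T_le (t : ℕ) (w : List α) : s7T b t w ≤ t + w.length := by
  induction w generalizing t with
  | nil => simp [s7T]
  | cons c w ih =>
    have : s7T b t (c :: w) = s7T b (if c = b then 0 else t + 1) w := rfl
    rw [this]
    refine (ih _).trans ?_
    split_ifs <;> simp <;> omega

lemma s7_T_mem (t : ℕ) (w : List α) (h : b ∈ w) : s7T b t w ≤ w.length := by
  obtain ⟨p, s, rfl⟩ := List.append_of_mem h
  rw [s7_T_append]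
  have : ∀ t, s7T b t (b :: s) = s7T b 0 s := fun t => by simp [s7T]
  rw [this]
  have := s7_T_le b 0 s
  simp; omega

lemma s7_T_rep (t n : ℕ) (hab : a ≠ b) : s7T b t (List.replicate n a) = t + n := by
  induction n generalizing t with
  | zero => rfl
  | succ n ih =>
    have : s7T b t (List.replicate (n + 1) a) = s7T b (t + 1) (List.replicate n a) := by
      simp [s7T, List.replicate_succ, hab]
    rw [this, ih]; omega

lemma s7_T_repb (n : ℕ) : s7T b 0 (List.replicate n b) = 0 := by
  induction n with
  | zero => rfl
  | succ n ih => simpa [s7T, List.replicate_succ] using ih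

lemma s7_T_inv (R : Set (List α × List α))
    (hR : R = {(List.replicate k a ++ [b], [b])}) {x y : List α} (h : WordEq R x y) :
    s7T b 0 x = s7T b 0 y := by
  refine s7_we_inv _ ?_ h
  intro p u v s h
  rw [hR] at h
  obtain ⟨rfl, rfl⟩ := Prod.mk.injEq .. ▸ (Set.mem_singleton_iff.1 h)
  simp [s7T]

lemma s7_count_inv (hab : a ≠ b) (R : Set (List α × List α))
    (hR : R = {(List.replicate k a ++ [b], [b])}) {x y : List α} (h : WordEq R x y) :
    x.count b = y.count b := by
  refine s7_we_inv _ ?_ h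
  intro p u v s h
  rw [hR] at h
  obtain ⟨rfl, rfl⟩ := Prod.mk.injEq .. ▸ (Set.mem_singleton_iff.1 h)
  simp [List.count_replicate, hab]

lemma s7_nil_inv (R : Set (List α × List α))
    (hR : R = {(List.replicate k a ++ [b], [b])}) {x y : List α} (h : WordEq R x y) :
    (x = []) = (y = []) := by
  refine s7_we_inv (fun x => x = []) ?_ h
  intro p u v s h
  rw [hR] at h
  obtain ⟨rfl, rfl⟩ := Prod.mk.injEq .. ▸ (Set.mem_singleton_iff.1 h)
  simp

lemma s7_absorb1 (hA : ∀ x : α, x = a ∨ x = b) (R : Set (List α × List α))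
    (hR : R = {(List.replicate k a ++ [b], [b])}) (w : List α) (hw : b ∈ w) :
    WordEq R (List.replicate k a ++ w) w := by
  induction w with
  | nil => simp at hw
  | cons c w ih =>
    by_cases hc : c = b
    · subst hc
      exact .rel _ _ ⟨[], List.replicate k a ++ [c], [c], w, by simp [hR], by simp, by simp⟩
    · have hca : c = a := (hA c).resolve_right hc
      subst hca
      have h := ih (by simpa [Ne.symm hc] using hw)
      have := s7_we_pre [c] h
      rw [show List.replicate k c ++ c :: w = [c] ++ (List.replicate k c ++ w) by
        rw [← List.append_assoc, List.singleton_append, ← List.replicate_succ,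
          List.replicate_succ']; simp]
      exact this

lemma s7_absorb (hA : ∀ x : α, x = a ∨ x = b) (R : Set (List α × List α))
    (hR : R = {(List.replicate k a ++ [b], [b])}) (w : List α) (hw : b ∈ w) (n : ℕ) :
    WordEq R (List.replicate (k * n) a ++ w) w := by
  induction n with
  | zero => exact .refl _
  | succ n ih =>
    rw [Nat.mul_succ, Nat.add_comm, List.replicate_add, List.append_assoc]
    exact .trans _ _ _ (s7_we_pre _ ih) (s7_absorb1 a b k hA R hR w hw)

lemma s7_expand_len {β : Type*} (g : β → List α) (K : ℕ) (hK : ∀ c, (g c).length ≤ K)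
    (x : List β) : (expandW g x).length ≤ K * x.length := by
  induction x with
  | nil => simp [expandW]
  | cons c x ih =>
    have : expandW g (c :: x) = g c ++ expandW g x := by simp [expandW]
    rw [this]
    have := hK c
    simp only [List.length_append, List.length_cons]
    nlinarith

lemma s7_expand_append {β : Type*} (g : β → List α) (x y : List β) :
    expandW g (x ++ y) = expandW g x ++ expandW g y := by simp [expandW]

theorem s7_not_bi (hab : a ≠ b) (hA : ∀ x : α, x = a ∨ x = b) (hk : 1 ≤ k)
    (R : Set (List α × List α)) (hR : R = {(List.replicate k a ++ [b], [b])}) :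
    ¬ SgpBiautomatic R := by
  rintro ⟨β, _, g, L, H⟩
  obtain ⟨K, hK⟩ : ∃ K, ∀ c, (g c).length ≤ K :=
    ⟨Finset.univ.sup fun c => (g c).length, fun c =>
      Finset.le_sup (f := fun c => (g c).length) (Finset.mem_univ c)⟩
  obtain ⟨c, hc⟩ : ∃ c, b ∈ g c := by
    obtain ⟨x, -, hx⟩ := H.onto [b] (by simp)
    have h1 := s7_count_inv a b k hab R hR hx
    have : b ∈ expandW g x := List.count_pos_iff.1 (by rw [h1]; simp)
    simp only [expandW, List.mem_flatten, List.mem_map] at this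
    obtain ⟨_, ⟨c, _, rfl⟩, h⟩ := this
    exact ⟨c, h⟩
  have key : ∀ m : ℕ, ∃ x1 x2 y : List β, x2.length = y.length ∧ x1 ++ x2 ∈ L ∧ y ∈ L ∧
      WordEq R (expandW g (x1 ++ x2) ++ g c) (expandW g y) ∧
      (expandW g x1).count b = m ∧ (expandW g x2).count b = 0 ∧
      (expandW g y).count b = m + (g c).count b := by
    intro m
    obtain ⟨y, hy, hye⟩ := H.onto (List.replicate m b ++ g c) (by simp [H.gen_ne])
    set n := K * y.length + 1 with hn
    obtain ⟨x, hx, hxe⟩ := H.onto (List.replicate m b ++ List.replicate (k * n) a) (by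
      have : k * n ≠ 0 := Nat.mul_ne_zero (by omega) (by omega)
      simp [this]
      )
    have hT := s7_T_inv a b k R hR hxe
    rw [s7_T_append, s7_T_repb, s7_T_rep a b _ _ hab, Nat.zero_add] at hT
    have hkn : n ≤ k * n := Nat.le_mul_of_pos_left _ hk
    have hC := s7_count_inv a b k hab R hR hxe
    have hyC := s7_count_inv a b k hab R hR hye
    have hl := s7_expand_len g K hK x
    have hl2 := s7_T_le b 0 (expandW g x)
    have hlt : y.length ≤ x.length := by
      by_contra hcon
      have : K * x.length ≤ K * y.length := Nat.mul_le_mul_left _ (by omega)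
      omega
    obtain ⟨x1, x2, rfl, h2⟩ : ∃ x1 x2, x = x1 ++ x2 ∧ x2.length = y.length :=
      ⟨x.take (x.length - y.length), x.drop (x.length - y.length), by simp, by simp; omega⟩
    have hb2 : (expandW g x2).count b = 0 := by
      rw [List.count_eq_zero]
      intro hb
      have h3 := s7_T_mem b (s7T b 0 (expandW g x1)) _ hb
      rw [s7_expand_append, s7_T_append] at hT
      have h4 := s7_expand_len g K hK x2
      rw [h2] at h4
      omega
    refine ⟨x1, x2, y, h2, hx, hy, ?_, ?_, hb2, ?_⟩
    · refine .trans _ _ _ (s7_we_suf (g c) hxe) (.trans _ _ _ ?_ (.symm _ _ hye))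
      rw [List.append_assoc]
      exact s7_we_pre _ (s7_absorb a b k hA R hR _ hc n)
    · rw [s7_expand_append] at hC
      simp [List.count_replicate, hab] at hC
      omega
    · rw [hyC]; simp
  choose x1 x2 y hlen hx hy hw h1 h2 h3 using key
  have hfin := Language.IsRegular.finite_range_leftQuotient (H.mulRL_reg c)
  set M : Language (Option β × Option β) := {p | ∃ x ∈ L, ∃ y ∈ L,
      WordEq R (expandW g x ++ g c) (expandW g y) ∧ p = padL x y} with hM
  have hni : ¬ Function.Injective
      (fun m : ℕ => M.leftQuotient ((x1 m).map fun c => (some c, none))) := by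
    intro hinj
    exact Set.infinite_range_of_injective hinj (hfin.subset (by rintro _ ⟨m, rfl⟩; exact ⟨_, rfl⟩))
  simp only [Function.Injective, not_forall] at hni
  obtain ⟨m, m', he, hne⟩ := hni
  have hmem : padL (x2 m) (y m) ∈ M.leftQuotient ((x1 m).map fun c => (some c, none)) := by
    rw [Language.mem_leftQuotient, ← s7_padL_split _ _ _ (hlen m)]
    exact ⟨_, hx m, _, hy m, hw m, rfl⟩
  rw [he, Language.mem_leftQuotient, ← s7_padL_split _ _ _ (hlen m)] at hmem
  obtain ⟨x', hx', y', hy', hw', hp⟩ := hmem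
  have e1 := congrArg (List.filterMap Prod.fst) hp
  have e2 := congrArg (List.filterMap Prod.snd) hp
  rw [s7_padL_fst, s7_padL_fst] at e1
  rw [s7_padL_snd, s7_padL_snd] at e2
  subst e1 e2
  have hcc := s7_count_inv a b k hab R hR hw'
  rw [s7_expand_append] at hcc
  simp only [List.count_append, h1, h2, h3] at hcc
  omega

/-- normal form of `a^j w` -/
def s7N : ℕ → List α → List α
  | j, [] => List.replicate j a
  | j, c :: w => if c = b then List.replicate (j % k) a ++ b :: s7N 0 w else s7N (j + 1) w

/-- `w` continues a normal form whose current run of `a` has (capped) length `j` -/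
def s7G : ℕ → List α → Prop
  | _, [] => True
  | j, c :: w => if c = b then j < k ∧ s7G 0 w else s7G (min (j + 1) k) w

lemma s7_G_b (j : ℕ) (w : List α) : s7G b k j (b :: w) ↔ j < k ∧ s7G b k 0 w := by
  simp [s7G]

lemma s7_N_b (j : ℕ) (w : List α) :
    s7N a b k j (b :: w) = List.replicate (j % k) a ++ b :: s7N a b k 0 w := by
  simp [s7N]

variable {a b}

lemma s7_G_a (hab : a ≠ b) (j : ℕ) (w : List α) :
    s7G b k j (a :: w) ↔ s7G b k (min (j + 1) k) w := by
  simp [s7G, hab]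

lemma s7_N_a (hab : a ≠ b) (j : ℕ) (w : List α) :
    s7N a b k j (a :: w) = s7N a b k (j + 1) w := by
  simp [s7N, hab]

lemma s7_N_run (hab : a ≠ b) (j n : ℕ) (s : List α) :
    s7N a b k j (List.replicate n a ++ b :: s) =
      List.replicate ((j + n) % k) a ++ b :: s7N a b k 0 s := by
  induction n generalizing j with
  | zero => simp [s7_N_b]
  | succ n ih =>
    rw [List.replicate_succ, List.cons_append, s7_N_a k hab, ih]
    congr 3; omega

lemma s7_N_snoc (hab : a ≠ b) (j : ℕ) (w : List α) :
    s7N a b k j (w ++ [a]) = s7N a b k j w ++ [a] := by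
  induction w generalizing j with
  | nil => simp [s7N, hab, List.replicate_succ']
  | cons c w ih =>
    simp only [List.cons_append, s7N]
    split_ifs <;> simp [ih]

lemma s7_N_inv (hab : a ≠ b) (hA : ∀ x : α, x = a ∨ x = b) (R : Set (List α × List α))
    (hR : R = {(List.replicate k a ++ [b], [b])}) {x y : List α} (h : WordEq R x y) :
    s7N a b k 0 x = s7N a b k 0 y := by
  refine s7_we_inv _ ?_ h
  intro p u v s h
  rw [hR] at h
  obtain ⟨rfl, rfl⟩ := Prod.mk.injEq .. ▸ (Set.mem_singleton_iff.1 h)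
  generalize 0 = j
  induction p generalizing j with
  | nil =>
    have := s7_N_run k hab j k s
    simpa [s7_N_b] using this
  | cons c p ih =>
    simp only [List.cons_append, s7N]
    split_ifs
    · rw [ih]
    · rw [ih]

lemma s7_N_we (hA : ∀ x : α, x = a ∨ x = b) (R : Set (List α × List α))
    (hR : R = {(List.replicate k a ++ [b], [b])}) (j : ℕ) (w : List α) :
    WordEq R (List.replicate j a ++ w) (s7N a b k j w) := by
  induction w generalizing j with
  | nil => simpa [s7N] using .refl _
  | cons c w ih =>
    by_cases hc : c = b
    · subst hc
      rw [s7_N_b]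
      have h1 : WordEq R (List.replicate (j % k) a ++ c :: w)
          (List.replicate (j % k) a ++ c :: s7N a c k 0 w) := by
        have := s7_we_pre (List.replicate (j % k) a ++ [c]) (ih 0)
        simpa using this
      refine .trans _ _ _ ?_ h1
      have h2 := s7_absorb a c k hA R hR (List.replicate (j % k) a ++ c :: w) (by simp) (j / k)
      rwa [← List.append_assoc, ← List.replicate_add, Nat.div_add_mod] at h2
    · have hca : c = a := (hA c).resolve_right hc
      subst hca
      have := ih (j + 1)
      rw [List.replicate_succ', List.append_assoc] at this
      simpa [s7N, hc] using this

lemma s7_run_inj (hab : a ≠ b) (i j : ℕ) (s t : List α)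
    (h : List.replicate i a ++ b :: s = List.replicate j a ++ t) :
    j ≤ i ∧ t = List.replicate (i - j) a ++ b :: s := by
  induction j generalizing i with
  | zero => simpa using h.symm
  | succ j ih =>
    cases i with
    | zero => simp [List.replicate_succ, hab.symm] at h
    | succ i =>
      have := ih i (by simpa [List.replicate_succ] using h)
      refine ⟨by omega, ?_⟩
      rw [this.2]; congr 2; omega

lemma s7_run_bb (hab : a ≠ b) (i j : ℕ) (s t : List α) :
    List.replicate i a ++ b :: s = List.replicate j a ++ b :: t ↔ i = j ∧ s = t := by
  constructor
  · intro h
    obtain ⟨h1, -⟩ := s7_run_inj hab _ _ _ _ h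
    obtain ⟨h2, -⟩ := s7_run_inj hab _ _ _ _ h.symm
    have : i = j := by omega
    subst this
    simpa using h
  · rintro ⟨rfl, rfl⟩; rfl

lemma s7_G_iff (hab : a ≠ b) (hA : ∀ x : α, x = a ∨ x = b) (hk : 1 ≤ k) (j : ℕ) (w : List α) :
    s7G b k (min j k) w ↔ s7N a b k j w = List.replicate j a ++ w := by
  induction w generalizing j with
  | nil => simp [s7G, s7N]
  | cons c w ih =>
    by_cases hc : c = b
    · subst hc
      have := ih 0
      simp only [Nat.zero_min, List.replicate_zero, List.nil_append] at this
      rw [s7_G_b, s7_N_b, s7_run_bb hab, this]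
      refine and_congr_left fun _ => ?_
      constructor
      · intro h; exact Nat.mod_eq_of_lt (by omega)
      · intro h; have := Nat.mod_lt j hk; omega
    · have hca : c = a := (hA c).resolve_right hc
      subst hca
      rw [s7_G_a k hab, s7_N_a k hab, show min (min j k + 1) k = min (j + 1) k by omega, ih,
        List.replicate_succ', List.append_assoc, List.singleton_append]

lemma s7_G_zero (hab : a ≠ b) (hA : ∀ x : α, x = a ∨ x = b) (hk : 1 ≤ k) (w : List α) :
    s7G b k 0 w ↔ s7N a b k 0 w = w := by
  simpa using s7_G_iff k hab hA hk 0 w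

lemma s7_G_run (hab : a ≠ b) (j n : ℕ) (hj : j ≤ k) (s : List α)
    (h : s7G b k j (List.replicate n a ++ b :: s)) : j + n < k := by
  induction n generalizing j with
  | zero => simpa using ((s7_G_b b k j s).1 h).1
  | succ n ih =>
    rw [List.replicate_succ, List.cons_append, s7_G_a k hab] at h
    have := ih _ (by omega) h
    omega

lemma s7_G_rep (hab : a ≠ b) (j n : ℕ) : s7G b k j (List.replicate n a) := by
  induction n generalizing j with
  | zero => simp [s7G]
  | succ n ih => rw [List.replicate_succ, s7_G_a k hab]; exact ih _

lemma s7_cases (hA : ∀ x : α, x = a ∨ x = b) (x : List α) :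
    (∃ n, x = List.replicate n a) ∨ ∃ n s, x = List.replicate n a ++ b :: s := by
  induction x with
  | nil => exact .inl ⟨0, rfl⟩
  | cons c x ih =>
    rcases hA c with rfl | rfl
    · rcases ih with ⟨n, rfl⟩ | ⟨n, s, rfl⟩
      · exact .inl ⟨n + 1, rfl⟩
      · exact .inr ⟨n + 1, s, rfl⟩
    · exact .inr ⟨0, x, rfl⟩

/-- the language of normal forms is regular -/
lemma s7_L_reg (hab : a ≠ b) (hA : ∀ x : α, x = a ∨ x = b) :
    IsReg {w : List α | w ≠ [] ∧ s7G b k 0 w} := by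
  have hG : ∀ j ≤ k, ∀ c, {w : List α | s7G b k j (c :: w)} ∈
      insert ∅ ((fun j => {w : List α | s7G b k j w}) '' Set.Iic k) := by
    intro j hj c
    rcases hA c with rfl | rfl
    · refine Set.mem_insert_of_mem _ ⟨min (j + 1) k, by simp, ?_⟩
      ext w; simp [s7_G_a k hab]
    · by_cases h : j < k
      · refine Set.mem_insert_of_mem _ ⟨0, by simp, ?_⟩
        ext w; simp [s7_G_b, h]
      · left
        ext w; simp [s7_G_b, h]
  refine s7_reg_family (insert {w : List α | w ≠ [] ∧ s7G b k 0 w}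
    (insert ∅ ((fun j => {w : List α | s7G b k j w}) '' Set.Iic k)))
    ((((Set.finite_Iic k).image _).insert _).insert _) ?_ _ (Set.mem_insert _ _)
  rintro X (rfl | rfl | ⟨j, hj, rfl⟩) c
  · refine Set.mem_insert_of_mem _ ?_
    simpa using hG 0 (by omega) c
  · refine Set.mem_insert_of_mem _ (Set.mem_insert_iff.2 (.inl ?_))
    simp
  · exact Set.mem_insert_of_mem _ (hG j hj c)

lemma s7_dv_empty {γ : Type*} (c : Option γ × Option γ) :
    s7dv (∅ : Set (List γ × List γ)) c = ∅ := by
  ext q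
  rcases c with ⟨_ | c, _ | d⟩ <;> simp [s7dv]

lemma s7_dv_nil {γ : Type*} (c : Option γ × Option γ) :
    s7dv ({([], [])} : Set (List γ × List γ)) c = ∅ := by
  ext q
  rcases c with ⟨_ | c, _ | d⟩ <;> simp [s7dv]

lemma s7_eq_reg (hab : a ≠ b) (hA : ∀ x : α, x = a ∨ x = b) :
    IsReg (s7PP {q : List α × List α | q.1 ≠ [] ∧ q ∈ {q | s7G b k 0 q.1 ∧ q.2 = q.1}}) := by
  set F : ℕ → Set (List α × List α) := fun j => {q | s7G b k j q.1 ∧ q.2 = q.1} with hF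
  refine s7_reg_pairs (insert ∅ (F '' Set.Iic k)) (((Set.finite_Iic k).image _).insert _)
    (by simp) ?_ (F 0) (Set.mem_insert_of_mem _ ⟨0, by simp, rfl⟩)
  rintro X (rfl | ⟨j, hj, rfl⟩) c
  · simp [s7_dv_empty]
  rcases c with ⟨_ | c, _ | d⟩
  · left; rfl
  · left; ext q; simp [s7dv, hF]
  · left; ext q; simp [s7dv, hF]
  by_cases hcd : d = c
  · subst hcd
    rcases hA d with rfl | rfl
    · refine Set.mem_insert_of_mem _ ⟨min (j + 1) k, by simp, ?_⟩
      ext q; simp [s7dv, hF, s7_G_a k hab]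
    · by_cases h : j < k
      · refine Set.mem_insert_of_mem _ ⟨0, by simp, ?_⟩
        ext q; simp [s7dv, hF, s7_G_b, h]
      · left; ext q; simp [s7dv, hF, s7_G_b, h]
  · left; ext q; simp [s7dv, hF, hcd]

lemma s7_mula_reg (hab : a ≠ b) (hA : ∀ x : α, x = a ∨ x = b) :
    IsReg (s7PP {q : List α × List α | q.1 ≠ [] ∧
      q ∈ {q | s7G b k 0 q.1 ∧ q.2 = q.1 ++ [a]}}) := by
  set F : ℕ → Set (List α × List α) := fun j => {q | s7G b k j q.1 ∧ q.2 = q.1 ++ [a]} with hF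
  refine s7_reg_pairs (insert ∅ (insert {([], [])} (F '' Set.Iic k)))
    ((((Set.finite_Iic k).image _).insert _).insert _)
    (by simp) ?_ (F 0) (Set.mem_insert_of_mem _ (Set.mem_insert_of_mem _ ⟨0, by simp, rfl⟩))
  rintro X (rfl | rfl | ⟨j, hj, rfl⟩) c
  · simp [s7_dv_empty]
  · simp [s7_dv_nil]
  rcases c with ⟨_ | c, _ | d⟩
  · left; rfl
  · by_cases hd : d = a
    · subst hd
      right; left
      ext ⟨x, y⟩; simp [s7dv, hF, s7G]
    · left; ext q; simp [s7dv, hF, hd]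
  · left; ext q; simp [s7dv, hF]
  by_cases hcd : d = c
  · subst hcd
    rcases hA d with rfl | rfl
    · right; right
      refine ⟨min (j + 1) k, by simp, ?_⟩
      ext q; simp [s7dv, hF, s7_G_a k hab]
    · by_cases h : j < k
      · right; right
        refine ⟨0, by simp, ?_⟩
        ext q; simp [s7dv, hF, s7_G_b, h]
      · left; ext q; simp [s7dv, hF, s7_G_b, h]
  · left; ext q; simp [s7dv, hF, hcd]

lemma s7_rep_b_ne (hab : a ≠ b) (i j : ℕ) (s : List α) :
    List.replicate i a ++ b :: s ≠ List.replicate j a := by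
  intro h
  have : b ∈ List.replicate j a := by rw [← h]; simp
  exact hab (List.eq_of_mem_replicate this).symm

lemma s7_mulb_reg (hab : a ≠ b) (hA : ∀ x : α, x = a ∨ x = b) (hk : 1 ≤ k) :
    IsReg (s7PP {q : List α × List α | q.1 ≠ [] ∧
      q ∈ {q | s7G b k 0 q.1 ∧ s7N a b k 0 (q.1 ++ [b]) = List.replicate 0 a ++ q.2}}) := by
  haveI : NeZero k := ⟨by omega⟩
  set F : ℕ → Set (List α × List α) := fun j =>
    {q | s7G b k j q.1 ∧ s7N a b k j (q.1 ++ [b]) = List.replicate j a ++ q.2} with hF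
  set E : ZMod k → Set (List α × List α) := fun r =>
    {q | ∃ n : ℕ, q = (List.replicate n a, []) ∧ (n : ZMod k) + r = 0} with hE
  refine s7_reg_pairs (insert ∅ (insert {([], [])} (Set.range E ∪ F '' Set.Iio k)))
    ((((Set.finite_range E).union ((Set.finite_Iio k).image _)).insert _).insert _)
    (by simp) ?_ (F 0) (.inr <| .inr <| .inr ⟨0, Nat.lt_of_lt_of_le Nat.zero_lt_one hk, rfl⟩)
  rintro X (rfl | rfl | ⟨r, rfl⟩ | ⟨j, hj, rfl⟩) c
  · simp [s7_dv_empty]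
  · simp [s7_dv_nil]
  · rcases c with ⟨_ | c, _ | d⟩
    · left; rfl
    · left; ext q; simp [s7dv, hE]
    · by_cases hc : c = a
      · subst hc
        right; right; left
        refine ⟨r + 1, ?_⟩
        ext ⟨x, y⟩
        simp only [s7dv, hE, Set.mem_ofPred_eq, Prod.mk.injEq]
        constructor
        · rintro ⟨n, ⟨rfl, rfl⟩, h⟩
          exact ⟨rfl, n + 1, by simp [List.replicate_succ], by push_cast; rw [← h]; ring⟩
        · rintro ⟨rfl, n, ⟨h, -⟩, h2⟩
          cases n with
          | zero => simp at h
          | succ n =>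
            rw [List.replicate_succ] at h
            exact ⟨n, ⟨by simpa using h, rfl⟩, by rw [← h2]; push_cast; ring⟩
      · left; ext ⟨x, y⟩
        simp only [s7dv, hE, Set.mem_ofPred_eq, Prod.mk.injEq, Set.mem_empty_iff_false, iff_false]
        rintro ⟨rfl, n, ⟨h, -⟩, h2⟩
        cases n with
        | zero => simp at h
        | succ n => simp [List.replicate_succ, hc] at h
    · left; ext q; simp [s7dv, hE]
  have hj : j < k := hj
  have hjm : j % k = j := Nat.mod_eq_of_lt hj
  rcases c with ⟨_ | c, _ | d⟩
  · left; rfl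
  · rcases hA d with rfl | rfl
    · left; ext ⟨x, y⟩
      simp only [s7dv, hF, Set.mem_ofPred_eq, List.nil_append, s7_N_b, hjm,
        Set.mem_empty_iff_false, iff_false]
      rintro ⟨-, -, h⟩
      simp [hab.symm] at h
    · right; left
      ext ⟨x, y⟩
      simp [s7dv, hF, s7G, s7_N_b, hjm, s7N, eq_comm]
  · left; ext ⟨x, y⟩
    simp only [s7dv, hF, Set.mem_ofPred_eq, List.append_nil, Set.mem_empty_iff_false, iff_false]
    rintro ⟨-, -, h⟩
    rcases s7_cases hA (c :: x) with ⟨n, hn⟩ | ⟨n, s, hn⟩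
    · rw [hn, s7_N_run k hab] at h
      exact s7_rep_b_ne hab _ _ _ h
    · rw [hn, List.append_assoc, List.cons_append, s7_N_run k hab] at h
      exact s7_rep_b_ne hab _ _ _ h
  rcases hA c with rfl | rfl
  · have hG : ∀ x, s7G b k j (c :: x) ↔ s7G b k (j + 1) x := by
      intro x; rw [s7_G_a k hab, min_eq_left (by omega)]
    rcases hA d with rfl | rfl
    · have hS : s7dv (F j) (some d, some d) = F (j + 1) := by
        ext ⟨x, y⟩
        simp [s7dv, hF, hG, s7_N_a k hab, List.replicate_succ']
      rw [hS]
      by_cases hjk : j + 1 < k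
      · exact .inr <| .inr <| .inr ⟨j + 1, hjk, rfl⟩
      · left
        ext ⟨x, y⟩
        simp only [hF, Set.mem_ofPred_eq, Set.mem_empty_iff_false, iff_false]
        rintro ⟨hg, h⟩
        rcases s7_cases hA x with ⟨n, rfl⟩ | ⟨n, s, rfl⟩
        · rw [s7_N_run k hab] at h
          have := (s7_run_inj hab _ _ _ _ h).1
          have := Nat.mod_lt (j + 1 + n) hk
          omega
        · have := s7_G_run k hab _ _ (by omega) _ hg
          omega
    · right; right; left
      refine ⟨1, ?_⟩
      ext ⟨x, y⟩
      simp only [s7dv, hE, hF, hG, Set.mem_ofPred_eq, Prod.mk.injEq, List.cons_append,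
        s7_N_a k hab]
      have hz : ∀ n : ℕ, (j + 1 + n) % k = j ↔ (n : ZMod k) + 1 = 0 := by
        intro n
        rw [show (j + 1 + n) % k = j ↔ (j + 1 + n) % k = j % k by rw [hjm],
          ← ZMod.natCast_eq_natCast_iff']
        push_cast
        constructor
        · intro h
          have : (n : ZMod k) + 1 = (j + 1 + n) - j := by ring
          rw [this, h, sub_self]
        · intro h
          have : (j : ZMod k) + 1 + n = j + (n + 1) := by ring
          rw [this, h, add_zero]
      constructor
      · rintro ⟨n, ⟨rfl, rfl⟩, h⟩
        refine ⟨s7_G_rep k hab _ _, ?_⟩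
        rw [s7_N_run k hab, (hz n).2 h]
        simp [s7N]
      · rintro ⟨hg, h⟩
        rcases s7_cases hA x with ⟨n, rfl⟩ | ⟨n, s, rfl⟩
        · rw [s7_N_run k hab, s7_run_bb hab] at h
          refine ⟨n, ⟨rfl, ?_⟩, (hz n).1 h.1⟩
          rw [← h.2]; simp [s7N]
        · have h1 := s7_G_run k hab _ _ (by omega) _ hg
          rw [List.append_assoc, List.cons_append, s7_N_run k hab, s7_run_bb hab,
            Nat.mod_eq_of_lt h1] at h
          omega
  · rcases hA d with rfl | rfl
    · left; ext ⟨x, y⟩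
      simp only [s7dv, hF, Set.mem_ofPred_eq, List.cons_append, s7_N_b, hjm,
        Set.mem_empty_iff_false, iff_false]
      rintro ⟨-, h⟩
      simp [hab.symm] at h
    · right; right; right
      refine ⟨0, Nat.lt_of_lt_of_le Nat.zero_lt_one hk, ?_⟩
      ext ⟨x, y⟩
      simp [s7dv, hF, s7_G_b, s7_N_b, hjm, hj]

lemma s7_G_prefix (hab : a ≠ b) (hA : ∀ x : α, x = a ∨ x = b) (j : ℕ) (x y : List α)
    (h : s7G b k j (x ++ y)) : s7G b k j x := by
  induction x generalizing j with
  | nil => simp [s7G]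
  | cons c x ih =>
    rcases hA c with rfl | rfl
    · rw [List.cons_append, s7_G_a k hab] at h
      rw [s7_G_a k hab]; exact ih _ h
    · rw [List.cons_append, s7_G_b] at h
      rw [s7_G_b]; exact ⟨h.1, ih _ h.2⟩

theorem s7_prefix (hab : a ≠ b) (hA : ∀ x : α, x = a ∨ x = b) (hk : 1 ≤ k) [Fintype α]
    (R : Set (List α × List α)) (hR : R = {(List.replicate k a ++ [b], [b])}) :
    SgpPrefixAutomatic R := by
  have hex : ∀ x : List α, expandW (fun c => [c]) x = x := by
    intro x
    induction x with
    | nil => rfl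
    | cons c x ih =>
      have : expandW (fun c => [c]) (c :: x) = c :: expandW (fun c => [c]) x := by simp [expandW]
      rw [this, ih]
  have hNw : ∀ w, WordEq R w (s7N a b k 0 w) := fun w => by
    simpa using s7_N_we k hA R hR 0 w
  have hNi : ∀ w, s7G b k 0 (s7N a b k 0 w) := fun w => by
    rw [s7_G_zero k hab hA hk]
    exact (s7_N_inv k hab hA R hR (hNw w)).symm
  have hNn : ∀ w, w ≠ [] → s7N a b k 0 w ≠ [] := fun w hw h => hw (by
    rw [s7_nil_inv a b k R hR (hNw w)]; exact h)
  have hiff : ∀ x y, s7G b k 0 y → (WordEq R x y ↔ s7N a b k 0 x = y) := by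
    intro x y hy
    constructor
    · intro h
      rw [s7_N_inv k hab hA R hR h]
      exact (s7_G_zero k hab hA hk y).1 hy
    · rintro rfl
      exact hNw x
  have heq : IsReg {p | ∃ x ∈ {w : List α | w ≠ [] ∧ s7G b k 0 w},
      ∃ y ∈ {w : List α | w ≠ [] ∧ s7G b k 0 w}, WordEq R x y ∧ p = padR x y} := by
    convert s7_eq_reg k hab hA using 1
    ext p
    constructor
    · rintro ⟨x, ⟨hx1, hx2⟩, y, ⟨hy1, hy2⟩, h, rfl⟩
      rw [hiff _ _ hy2, (s7_G_zero k hab hA hk x).1 hx2] at h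
      exact ⟨(x, y), ⟨hx1, hx2, h.symm⟩, rfl⟩
    · rintro ⟨⟨x, y⟩, ⟨hx1, hx2, h⟩, rfl⟩
      simp only at h hx1 hx2
      subst h
      exact ⟨y, ⟨hx1, hx2⟩, y, ⟨hx1, hx2⟩, .refl _, rfl⟩
  refine ⟨α, inferInstance, fun c => [c], {w | w ≠ [] ∧ s7G b k 0 w},
    ⟨⟨by simp, s7_L_reg k hab hA, fun w hw => hw.1, ?_, ?_, ?_⟩, ?_⟩⟩
  · intro w hw
    refine ⟨s7N a b k 0 w, ⟨hNn w hw, hNi w⟩, ?_⟩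
    rw [hex]
    exact .symm _ _ (hNw w)
  · simpa only [hex] using heq
  · intro c
    simp only [hex]
    have hset : {p | ∃ x ∈ {w : List α | w ≠ [] ∧ s7G b k 0 w},
        ∃ y ∈ {w : List α | w ≠ [] ∧ s7G b k 0 w}, WordEq R (x ++ [c]) y ∧ p = padR x y} =
        s7PP {q | q.1 ≠ [] ∧ s7G b k 0 q.1 ∧ s7N a b k 0 (q.1 ++ [c]) = q.2} := by
      ext p
      constructor
      · rintro ⟨x, ⟨hx1, hx2⟩, y, ⟨hy1, hy2⟩, h, rfl⟩
        rw [hiff _ _ hy2] at h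
        exact ⟨(x, y), ⟨hx1, hx2, h⟩, rfl⟩
      · rintro ⟨⟨x, y⟩, ⟨hx1, hx2, h⟩, rfl⟩
        simp only at h hx1 hx2
        subst h
        exact ⟨x, ⟨hx1, hx2⟩, _, ⟨hNn _ (by simp), hNi _⟩, hNw _, rfl⟩
    rw [hset]
    rcases hA c with rfl | rfl
    · convert s7_mula_reg k hab hA using 2
      ext ⟨x, y⟩
      simp only [Set.mem_ofPred_eq, s7_N_snoc k hab]
      refine and_congr_right fun _ => and_congr_right fun h => ?_
      rw [(s7_G_zero k hab hA hk x).1 h, eq_comm]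
    · exact s7_mulb_reg k hab hA hk
  · simp only [hex]
    convert heq using 1
    ext p
    constructor
    · rintro ⟨x, hx, y, ⟨z, hz, ⟨t, rfl⟩⟩, h, rfl⟩
      refine ⟨x, hx, y, ⟨?_, s7_G_prefix k hab hA _ _ _ hz.2⟩, h, rfl⟩
      intro hy
      exact hx.1 (by rw [s7_nil_inv a b k R hR h]; exact hy)
    · rintro ⟨x, hx, y, hy, h, rfl⟩
      exact ⟨x, hx, y, ⟨y, hy, List.prefix_refl _⟩, h, rfl⟩

end Helpers

/-- the semigroup `S = sgp⁺⟨a, b ∣ aᵏb = b⟩` (`k ≥ 1`) is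
prefix-automatic but not biautomatic. -/
theorem statement_7 {α : Type} [Fintype α] (a b : α) (hab : a ≠ b)
    (hA : ∀ x : α, x = a ∨ x = b) (k : ℕ) (hk : 1 ≤ k)
    (R : Set (List α × List α))
    (hRdef : R = {(List.replicate k a ++ [b], [b])}) :
    SgpPrefixAutomatic R ∧ ¬ SgpBiautomatic R := by
  classical
  exact ⟨s7_prefix k hab hA hk R hRdef, s7_not_bi a b k hab hA hk R hRdef⟩
end

section
/- Let S = sgp^+⟨a_1,…,a_n | u = xy⟩ where A = {a_1,…,a_n}, u = a_{i_1}a_{i_2}⋯a_{i_k} with k ≥ 2, x, y ∈ A, and suppose {u = xy} is a Gröbner–Shirshov basis, equivalently that L = A^+ − A^*{u}A^* contains exactly one representative of each element of S. If a_{i_{k-1}}a_{i_k} ≢ xy and u ≢ y^{k-1}x, then S is automatic and S^1 (the monoid obtained from S by adjoining an identity element) is prefix-automatic. -/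
section Toolbox

theorem reg_of_snoc {Γ σ : Type} [Finite σ] (f : List Γ → σ) (step : σ → Γ → σ)
    (hf : ∀ l a, f (l ++ [a]) = step (f l) a) (S : Set σ) : IsReg {l | f l ∈ S} := by
  classical
  have hfin := Fintype.ofFinite σ
  refine ⟨σ, hfin, ⟨step, f [], S⟩, ?_⟩
  have h : ∀ l, (DFA.mk step (f []) S).eval l = f l := by
    intro l
    induction l using List.reverseRecOn with
    | nil => rfl
    | append_singleton l a ih => rw [DFA.eval_append_singleton, ih, hf]
  ext l
  rw [DFA.mem_accepts, h]
  rfl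

theorem reg_of_cons {Γ σ : Type} [Finite σ] (f : List Γ → σ) (step : σ → Γ → σ)
    (hf : ∀ l a, f (a :: l) = step (f l) a) (S : Set σ) : IsReg {l | f l ∈ S} := by
  apply Language.IsRegular.of_reverse
  have := reg_of_snoc (fun l => f l.reverse) step (by intro l a; simp [hf]) S
  exact this

theorem exists_dfa_of_reg {Γ : Type} {K : Set (List Γ)} (h : IsReg K) :
    ∃ (σ : Type) (_ : Finite σ) (M : DFA Γ σ), ∀ l, l ∈ K ↔ M.eval l ∈ M.accept := by
  obtain ⟨σ, hσ, M, hM⟩ := h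
  refine ⟨σ, Finite.of_fintype σ, M, fun l => ?_⟩
  rw [← DFA.mem_accepts, hM]
  rfl

theorem reg_comap {Γ Δ : Type} (f : Γ → Δ) {K : Set (List Δ)} (h : IsReg K) :
    IsReg {l : List Γ | l.map f ∈ K} := by
  obtain ⟨σ, _, M, hM⟩ := exists_dfa_of_reg h
  have := reg_of_snoc (fun l : List Γ => M.eval (l.map f)) (fun s a => M.step s (f a))
    (by intro l a; simp) M.accept
  simpa [hM] using this

theorem reg_map {Γ Δ : Type} (f : Γ → Δ) {K : Set (List Γ)} (h : IsReg K) :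
    IsReg {l : List Δ | ∃ l' ∈ K, l = l'.map f} := by
  obtain ⟨σ, _, M, hM⟩ := exists_dfa_of_reg h
  have := reg_of_snoc (fun l : List Δ => {s | ∃ l', l = List.map f l' ∧ M.eval l' = s})
    (fun T d => {s | ∃ t ∈ T, ∃ a, f a = d ∧ s = M.step t a})
    (by
      intro l a
      ext s
      simp only [Set.mem_ofPred_eq]
      constructor
      · rintro ⟨l', h1, h2⟩
        obtain ⟨l1, l2, rfl, h3, h4⟩ := List.append_eq_map_iff.1 h1
        obtain ⟨b, l3, rfl, h5, h6⟩ := List.map_eq_cons_iff.1 h4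
        obtain rfl := List.map_eq_nil_iff.1 h6
        refine ⟨M.eval l1, ⟨l1, h3.symm, rfl⟩, b, h5, ?_⟩
        rw [← h2, DFA.eval_append_singleton]
      · rintro ⟨t, ⟨l', rfl, rfl⟩, b, rfl, rfl⟩
        exact ⟨l' ++ [b], by simp, by simp⟩) {T | ∃ s ∈ T, s ∈ M.accept}
  convert this using 1
  ext l
  simp only [Set.mem_ofPred_eq, hM]
  constructor
  · rintro ⟨l', h1, h2⟩
    exact ⟨_, ⟨l', h2, rfl⟩, h1⟩
  · rintro ⟨s, ⟨l', h2, rfl⟩, h1⟩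
    exact ⟨l', h1, h2⟩

theorem reg_union {Γ : Type} {K1 K2 : Set (List Γ)} (h1 : IsReg K1) (h2 : IsReg K2) :
    IsReg (K1 ∪ K2) := Language.IsRegular.add h1 h2

theorem reg_inter {Γ : Type} {K1 K2 : Set (List Γ)} (h1 : IsReg K1) (h2 : IsReg K2) :
    IsReg (K1 ∩ K2) := Language.IsRegular.inf h1 h2

theorem reg_singleton {Γ : Type} (w : List Γ) : IsReg ({w} : Set (List Γ)) := by
  induction w with
  | nil =>
    have := reg_of_cons (fun l : List Γ => decide (l = [])) (fun _ _ => false)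
      (by intro l a; simp) {true}
    simpa using this
  | cons b w ih =>
    classical
    apply Language.IsRegular.of_finite_range_leftQuotient
    have h := ih.finite_range_leftQuotient
    refine Set.Finite.subset ((h.insert {b :: w}).insert (0 : Language Γ)) ?_
    rintro _ ⟨l, rfl⟩
    cases l with
    | nil => right; left; rfl
    | cons a l =>
      by_cases hab : a = b
      · right; right
        refine ⟨l, ?_⟩
        ext z
        subst hab
        change l ++ z = w ↔ a :: l ++ z = a :: w
        simp
      · left
        ext z
        change a :: l ++ z = b :: w ↔ False
        simp [hab]

theorem reg_empty {Γ : Type} : IsReg (∅ : Set (List Γ)) := by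
  have := reg_of_cons (fun _ : List Γ => ()) (fun _ _ => ()) (by intros; rfl) ∅
  simpa using this

theorem reg_subsingleton {Γ : Type} {K : Set (List Γ)} (h : K.Subsingleton) : IsReg K := by
  rcases h.eq_empty_or_singleton with rfl | ⟨w, rfl⟩
  · exact reg_empty
  · exact reg_singleton w

/-- Valid columns: letters followed by padding. -/
def ValidCol {B : Type} : List (Option B) → Prop
  | [] => True
  | none :: l => ∀ o ∈ l, o = none
  | some _ :: l => ValidCol l

theorem validCol_of_none {B : Type} (l : List (Option B)) (h : ∀ o ∈ l, o = none) :
    ValidCol l := by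
  cases l with
  | nil => trivial
  | cons a l =>
    have := h a (by simp)
    subst this
    exact fun o ho => h o (by simp [ho])

theorem reg_validCol {B : Type} : IsReg {l : List (Option B) | ValidCol l} := by
  classical
  have := reg_of_cons
    (fun l : List (Option B) => ((decide (ValidCol l), decide (∀ o ∈ l, o = none)) : Bool × Bool))
    (fun s o => match o with
      | none => (s.2, s.2)
      | some _ => (s.1, false))
    (by
      intro l a
      cases a with
      | none => simp [ValidCol]; congr
      | some a => simp [ValidCol]; congr) {s | s.1 = true}
  simpa using this

theorem validCol_iff {B : Type} (l : List (Option B)) :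
    ValidCol l ↔ ∃ (x : List B) (m : ℕ), l = x.map some ++ List.replicate m none := by
  induction l with
  | nil => simp [ValidCol]
  | cons o l ih =>
    cases o with
    | none =>
      simp only [ValidCol]
      constructor
      · intro h
        refine ⟨[], l.length + 1, ?_⟩
        simp [List.replicate_succ, List.eq_replicate_iff]
        exact h
      · rintro ⟨x, m, h⟩
        cases x with
        | nil =>
          cases m with
          | zero => simp at h
          | succ m =>
            simp [List.replicate_succ] at h
            subst h
            intro o ho
            exact (List.mem_replicate.1 ho).2
        | cons a x => simp at h
    | some a =>
      simp only [ValidCol, ih]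
      constructor
      · rintro ⟨x, m, rfl⟩
        exact ⟨a :: x, m, by simp⟩
      · rintro ⟨x, m, h⟩
        cases x with
        | nil =>
          cases m with
          | zero => simp at h
          | succ m => simp [List.replicate_succ] at h
        | cons b x =>
          simp at h
          exact ⟨x, m, h.2⟩

def colN {B : Type} (n : ℕ) (x : List B) : List (Option B) :=
  (List.range n).map fun i => x[i]?

def padN {B : Type} (n : ℕ) (x y : List B) : List (Option B × Option B) :=
  (List.range n).map fun i => (x[i]?, y[i]?)

theorem colN_eq {B : Type} (n : ℕ) (x : List B) (h : x.length ≤ n) :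
    colN n x = x.map some ++ List.replicate (n - x.length) none := by
  apply List.ext_getElem
  · simp [colN]; omega
  · intro i h1 h2
    simp only [colN, List.getElem_map, List.getElem_range]
    by_cases hi : i < x.length
    · rw [List.getElem_append_left (by simpa using hi)]
      simp [hi]
    · rw [List.getElem_append_right (by simpa using hi)]
      simp at hi ⊢
      exact hi

theorem validCol_iff_colN {B : Type} (l : List (Option B)) :
    ValidCol l ↔ ∃ x : List B, x.length ≤ l.length ∧ l = colN l.length x := by
  rw [validCol_iff]
  constructor
  · rintro ⟨x, m, rfl⟩
    refine ⟨x, by simp, ?_⟩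
    rw [colN_eq _ _ (by simp)]
    simp
  · rintro ⟨x, h1, h2⟩
    exact ⟨x, _, h2.trans (colN_eq _ _ h1)⟩

theorem padR_eq {B : Type} (x y : List B) : padR x y = padN (max x.length y.length) x y := by
  have h1 := colN_eq (max x.length y.length) x (le_max_left _ _)
  have h2 := colN_eq (max x.length y.length) y (le_max_right _ _)
  have e1 : max x.length y.length - x.length = y.length - x.length := by omega
  have e2 : max x.length y.length - y.length = x.length - y.length := by omega
  rw [e1] at h1
  rw [e2] at h2
  unfold padR
  rw [← h1, ← h2, colN, colN, List.zip_map', padN]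

theorem padN_succ {B : Type} (n : ℕ) (x y : List B) :
    padN (n + 1) x y = padN n x y ++ [(x[n]?, y[n]?)] := by
  simp [padN, List.range_succ]

theorem padN_add {B : Type} (n m : ℕ) (x y : List B) (h1 : x.length ≤ n) (h2 : y.length ≤ n) :
    padN (n + m) x y = padN n x y ++ List.replicate m (none, none) := by
  induction m with
  | zero => simp
  | succ m ih =>
    rw [← add_assoc, padN_succ, ih, List.replicate_succ', ← List.append_assoc]
    congr 1
    simp
    omega

theorem padN_fst {B : Type} (n : ℕ) (x y : List B) : (padN n x y).map Prod.fst = colN n x := by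
  simp [padN, colN, Function.comp_def]

theorem padN_snd {B : Type} (n : ℕ) (x y : List B) : (padN n x y).map Prod.snd = colN n y := by
  simp [padN, colN, Function.comp_def]

theorem length_padN {B : Type} (n : ℕ) (x y : List B) : (padN n x y).length = n := by
  simp [padN]

theorem eq_padN {B : Type} (n : ℕ) (x y : List B) (l : List (Option B × Option B))
    (h1 : l.map Prod.fst = colN n x) (h2 : l.map Prod.snd = colN n y) : l = padN n x y := by
  rw [← padN_fst n x y] at h1
  rw [← padN_snd n x y] at h2
  have := congrArg₂ List.zip h1 h2
  simpa [List.zip_map', Function.comp_def] using this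

/-- Synchronously recognisable relations. -/
def Sync {B : Type} (Rel : List B → List B → Prop) : Prop :=
  ∃ K : Set (List (Option B × Option B)), IsReg K ∧
    ∀ x y n, x.length ≤ n → y.length ≤ n → (padN n x y ∈ K ↔ Rel x y)

theorem Sync.congr {B : Type} {R1 R2 : List B → List B → Prop} (h : Sync R1)
    (h2 : ∀ x y, R1 x y ↔ R2 x y) : Sync R2 := by
  have : R1 = R2 := by ext x y; exact h2 x y
  exact this ▸ h

theorem Sync.and {B : Type} {R1 R2 : List B → List B → Prop} (h1 : Sync R1) (h2 : Sync R2) :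
    Sync (fun x y => R1 x y ∧ R2 x y) := by
  obtain ⟨K1, r1, c1⟩ := h1
  obtain ⟨K2, r2, c2⟩ := h2
  refine ⟨K1 ∩ K2, reg_inter r1 r2, fun x y n hx hy => ?_⟩
  exact and_congr (c1 x y n hx hy) (c2 x y n hx hy)

theorem sync_of_eventually {B : Type} {K : Set (List (Option B × Option B))} (h : IsReg K) :
    Sync (fun x y => ∃ n0, ∀ n ≥ n0, padN n x y ∈ K) := by
  obtain ⟨σ, _, M, hM⟩ := exists_dfa_of_reg h
  refine ⟨_, reg_of_snoc M.eval M.step (fun l a => M.eval_append_singleton l a)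
    {s | ∃ m0, ∀ m ≥ m0, M.evalFrom s (List.replicate m (none, none)) ∈ M.accept}, ?_⟩
  intro x y n hx hy
  have key : ∀ m, M.evalFrom (M.eval (padN n x y)) (List.replicate m (none, none)) ∈ M.accept ↔
      padN (n + m) x y ∈ K := by
    intro m
    rw [hM, padN_add n m x y hx hy]
    unfold DFA.eval
    rw [DFA.evalFrom_of_append]
  simp only [Set.mem_ofPred_eq, key]
  constructor
  · rintro ⟨m0, h0⟩
    refine ⟨n + m0, fun n' hn' => ?_⟩
    have := h0 (n' - n) (by omega)
    rwa [Nat.add_sub_cancel' (by omega)] at this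
  · rintro ⟨n0, h0⟩
    exact ⟨n0, fun m hm => h0 _ (by omega)⟩

theorem Sync.comp {B : Type} {R1 R2 : List B → List B → Prop} (h1 : Sync R1) (h2 : Sync R2) :
    Sync (fun x z => ∃ y, R1 x y ∧ R2 y z) := by
  obtain ⟨K1, r1, c1⟩ := h1
  obtain ⟨K2, r2, c2⟩ := h2
  have rK := reg_map (fun t : Option B × Option B × Option B => (t.1, t.2.2))
    (reg_inter (reg_inter
      (reg_comap (fun t : Option B × Option B × Option B => (t.1, t.2.1)) r1)
      (reg_comap (fun t : Option B × Option B × Option B => (t.2.1, t.2.2)) r2))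
      (reg_comap (fun t : Option B × Option B × Option B => t.2.1) reg_validCol))
  refine (sync_of_eventually rK).congr fun x z => ?_
  constructor
  · rintro ⟨n0, h0⟩
    obtain ⟨l, ⟨⟨a1, a2⟩, a3⟩, a4⟩ :=
      h0 (max n0 (max x.length z.length)) (le_max_left _ _)
    set n := max n0 (max x.length z.length) with hn
    have hx : x.length ≤ n := by omega
    have hz : z.length ≤ n := by omega
    simp only [Set.mem_ofPred_eq] at a1 a2 a3
    have hl : l.length = n := by
      have := congrArg List.length a4
      simpa [length_padN] using this.symm
    obtain ⟨y, b1, b2⟩ := (validCol_iff_colN _).1 a3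
    rw [List.length_map, hl] at b1 b2
    have c4 := congrArg (List.map Prod.fst) a4
    have c5 := congrArg (List.map Prod.snd) a4
    rw [padN_fst, List.map_map] at c4
    rw [padN_snd, List.map_map] at c5
    refine ⟨y, (c1 x y n hx b1).1 ?_, (c2 y z n b1 hz).1 ?_⟩
    · rwa [← eq_padN n x y (l.map fun t => (t.1, t.2.1)) (by rw [List.map_map]; exact c4.symm)
        (by rw [List.map_map]; exact b2)]
    · rwa [← eq_padN n y z (l.map fun t => (t.2.1, t.2.2)) (by rw [List.map_map]; exact b2)
        (by rw [List.map_map]; exact c5.symm)]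
  · rintro ⟨y, g1, g2⟩
    refine ⟨max x.length (max y.length z.length), fun n hn => ?_⟩
    refine ⟨(List.range n).map fun i => (x[i]?, y[i]?, z[i]?), ⟨⟨?_, ?_⟩, ?_⟩, ?_⟩
    · have := (c1 x y n (by omega) (by omega)).2 g1
      simpa [padN, Function.comp_def] using this
    · have := (c2 y z n (by omega) (by omega)).2 g2
      simpa [padN, Function.comp_def] using this
    · simp only [Set.mem_ofPred_eq]
      rw [validCol_iff_colN]
      refine ⟨y, by simp; omega, ?_⟩
      simp [colN, Function.comp_def]
    · simp [padN, Function.comp_def]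

theorem reduce_colN {B : Type} (n : ℕ) (x : List B) (h : x.length ≤ n) :
    (colN n x).reduceOption = x := by
  rw [colN_eq n x h]
  simp [List.reduceOption]

theorem sync_col {B : Type} {L : Set (List B)} (h : IsReg L) :
    ∃ K : Set (List (Option B)), IsReg K ∧
      ∀ x n, x.length ≤ n → (colN n x ∈ K ↔ x ∈ L) := by
  obtain ⟨σ, _, M, hM⟩ := exists_dfa_of_reg h
  refine ⟨_, reg_of_snoc (fun l : List (Option B) => M.eval l.reduceOption)
    (fun s o => match o with
      | none => s
      | some b => M.step s b)
    (by
      intro l o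
      cases o <;> simp [List.reduceOption_append]) M.accept, fun x n hx => ?_⟩
  rw [hM]
  simp only [Set.mem_ofPred_eq, reduce_colN n x hx]

theorem sync_left {B : Type} {L : Set (List B)} (h : IsReg L) :
    Sync (fun x _ : List B => x ∈ L) := by
  obtain ⟨K, r, c⟩ := sync_col h
  refine ⟨_, reg_comap Prod.fst r, fun x y n hx _ => ?_⟩
  refine Iff.trans ?_ (c x n hx)
  simp only [Set.mem_ofPred_eq, padN_fst]

theorem sync_right {B : Type} {L : Set (List B)} (h : IsReg L) :
    Sync (fun _ y : List B => y ∈ L) := by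
  obtain ⟨K, r, c⟩ := sync_col h
  refine ⟨_, reg_comap Prod.snd r, fun x y n _ hy => ?_⟩
  refine Iff.trans ?_ (c y n hy)
  simp only [Set.mem_ofPred_eq, padN_snd]

theorem reg_noPad {Γ : Type} (z : Γ) : IsReg {l : List Γ | z ∉ l} := by
  classical
  have := reg_of_cons (fun l : List Γ => decide (z ∈ l)) (fun s a => decide (z = a) || s)
    (by intro l a; simp) {false}
  simpa using this

theorem Sync.reg {B : Type} {Rel : List B → List B → Prop} (h : Sync Rel) :
    IsReg {p | ∃ x y, Rel x y ∧ p = padR x y} := by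
  obtain ⟨K, r, c⟩ := h
  have := reg_inter (reg_inter (reg_inter r (reg_comap Prod.fst reg_validCol))
    (reg_comap Prod.snd reg_validCol)) (reg_noPad ((none : Option B), (none : Option B)))
  convert this using 1
  ext p
  simp only [Set.mem_ofPred_eq, Set.mem_inter_iff]
  constructor
  · rintro ⟨x, y, h, rfl⟩
    rw [padR_eq, padN_fst, padN_snd, validCol_iff_colN, validCol_iff_colN]
    refine ⟨⟨⟨(c x y _ (le_max_left _ _) (le_max_right _ _)).2 h, x, ?_⟩, y, ?_⟩, ?_⟩
    · simp [colN]
    · simp [colN]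
    · simp [padN]
      omega
  · rintro ⟨⟨⟨h1, h2⟩, h3⟩, h4⟩
    obtain ⟨x, hx, ex⟩ := (validCol_iff_colN _).1 h2
    obtain ⟨y, hy, ey⟩ := (validCol_iff_colN _).1 h3
    rw [List.length_map] at hx ex hy ey
    have hp := eq_padN _ x y p ex ey
    refine ⟨x, y, ?_, ?_⟩
    · rw [hp] at h1
      exact (c x y _ hx hy).1 h1
    · rw [padR_eq]
      have : max x.length y.length = p.length := by
        apply le_antisymm (max_le hx hy)
        by_contra hlt
        apply h4
        rw [hp]
        simp only [padN, List.mem_map, List.mem_range]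
        refine ⟨max x.length y.length, by omega, ?_⟩
        simp
      rw [this]
      exact hp

end Toolbox


section Lag

variable {A B : Type}

theorem WordEq.rfl' {R : Set (List A × List A)} (x : List A) : WordEq R x x :=
  Relation.EqvGen.refl x

theorem WordEq.symm' {R : Set (List A × List A)} {x y : List A} (h : WordEq R x y) :
    WordEq R y x := Relation.EqvGen.symm _ _ h

theorem WordEq.trans' {R : Set (List A × List A)} {x y z : List A} (h : WordEq R x y)
    (h2 : WordEq R y z) : WordEq R x z := Relation.EqvGen.trans _ _ _ h h2

theorem WordEq.of_eq {R : Set (List A × List A)} {x y : List A} (h : x = y) : WordEq R x y :=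
  h ▸ WordEq.rfl' x

theorem WordEq.congr {R : Set (List A × List A)} {x y : List A} (h : WordEq R x y)
    (p s : List A) : WordEq R (p ++ x ++ s) (p ++ y ++ s) := by
  induction h with
  | rel a b h =>
    obtain ⟨p', u, v, s', h1, rfl, rfl⟩ := h
    refine Relation.EqvGen.rel _ _ ⟨p ++ p', u, v, s' ++ s, h1, ?_, ?_⟩ <;> simp
  | refl a => exact WordEq.rfl' _
  | symm a b _ ih => exact ih.symm'
  | trans a b c _ _ ih1 ih2 => exact ih1.trans' ih2

theorem WordEq.left {R : Set (List A × List A)} {x y : List A} (h : WordEq R x y)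
    (p : List A) : WordEq R (p ++ x) (p ++ y) := by simpa using h.congr p []

theorem WordEq.right {R : Set (List A × List A)} {x y : List A} (h : WordEq R x y)
    (s : List A) : WordEq R (x ++ s) (y ++ s) := by simpa using h.congr [] s

theorem expandW_append (g : B → List A) (x y : List B) :
    expandW g (x ++ y) = expandW g x ++ expandW g y := by simp [expandW]

theorem expandW_cons (g : B → List A) (b : B) (y : List B) :
    expandW g (b :: y) = g b ++ expandW g y := by simp [expandW]

theorem expandW_nil (g : B → List A) : expandW g [] = [] := rfl

/-- Expansion of a padded letter. -/
def gOpt (g : B → List A) (o : Option B) : List A := expandW g o.toList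

theorem expandW_take_succ (g : B → List A) (x : List B) (i : ℕ) :
    expandW g (x.take (i + 1)) = expandW g (x.take i) ++ gOpt g x[i]? := by
  rw [List.take_add_one, expandW_append, gOpt]

/-- Nondeterministic automaton following two words at bounded distance. -/
def lagNFA (R : Set (List A × List A)) (g : B → List A) (N : ℕ) (b : List A) :
    NFA (Option B × Option B) {p : List A × List A // p.1.length ≤ N ∧ p.2.length ≤ N} where
  step p o := {q | ∃ r, WordEq R (gOpt g o.1 ++ q.1.1) (p.1.1 ++ r) ∧
    WordEq R (gOpt g o.2 ++ q.1.2) (p.1.2 ++ r)}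
  start := {p | p.1 = ([], [])}
  accept := {p | p.1 = (b, [])}

def LagRel (R : Set (List A × List A)) (g : B → List A) (N : ℕ) (b : List A)
    (x y : List B) : Prop :=
  ∃ n0, ∀ n ≥ n0, padN n x y ∈ (lagNFA R g N b).accepts

theorem sync_lagRel [Finite A] (R : Set (List A × List A)) (g : B → List A) (N : ℕ)
    (b : List A) : Sync (LagRel R g N b) := by
  apply sync_of_eventually
  have : Finite {p : List A × List A // p.1.length ≤ N ∧ p.2.length ≤ N} := by
    have h := (List.finite_length_le A N).prod (List.finite_length_le A N)
    exact Set.Finite.to_subtype (h.subset (by rintro p ⟨h1, h2⟩; exact ⟨h1, h2⟩))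
  have := Fintype.ofFinite {p : List A × List A // p.1.length ≤ N ∧ p.2.length ≤ N}
  classical
  exact ⟨_, inferInstance, (lagNFA R g N b).toDFA, NFA.toDFA_correct⟩

theorem lag_sound (R : Set (List A × List A)) (g : B → List A) (N : ℕ) (b : List A)
    (x y : List B) (n : ℕ) (p) (hp : p ∈ (lagNFA R g N b).eval (padN n x y)) :
    WordEq R (expandW g (x.take n) ++ p.1.1) (expandW g (y.take n) ++ p.1.2) := by
  induction n generalizing p with
  | zero =>
    have : p.1 = ([], []) := by simpa [padN, lagNFA] using hp
    rw [this]
    exact WordEq.rfl' _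
  | succ n ih =>
    rw [padN_succ, NFA.eval_append_singleton, NFA.mem_stepSet] at hp
    obtain ⟨q, hq, r, h1, h2⟩ := hp
    have h3 := ih q hq
    rw [expandW_take_succ, expandW_take_succ, List.append_assoc, List.append_assoc]
    refine (h1.left _).trans' (WordEq.trans' ?_ (h2.left _).symm')
    simpa using h3.right r

theorem lagRel_sound {R : Set (List A × List A)} {g : B → List A} {N : ℕ} {b : List A}
    {x y : List B} (h : LagRel R g N b x y) :
    WordEq R (expandW g x ++ b) (expandW g y) := by
  obtain ⟨n0, h0⟩ := h
  obtain ⟨p, hp, h1⟩ := h0 (max n0 (max x.length y.length)) (le_max_left _ _)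
  have h2 := lag_sound R g N b x y _ p h1
  have h3 : p.1 = (b, []) := hp
  rw [h3, List.take_of_length_le (by omega), List.take_of_length_le (by omega)] at h2
  simpa using h2

theorem lagRel_of_run {R : Set (List A × List A)} {g : B → List A} {N : ℕ} {b : List A}
    {x y : List B} (s t : ℕ → List A) (hs : ∀ i, (s i).length ≤ N) (ht : ∀ i, (t i).length ≤ N)
    (s0 : s 0 = []) (t0 : t 0 = [])
    (hstep : ∀ i, ∃ r, WordEq R (gOpt g x[i]? ++ s (i + 1)) (s i ++ r) ∧
      WordEq R (gOpt g y[i]? ++ t (i + 1)) (t i ++ r))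
    (n0 : ℕ) (hend : ∀ n ≥ n0, s n = b ∧ t n = []) : LagRel R g N b x y := by
  have key : ∀ n, (⟨(s n, t n), hs n, ht n⟩ :
      {p : List A × List A // p.1.length ≤ N ∧ p.2.length ≤ N}) ∈
        (lagNFA R g N b).eval (padN n x y) := by
    intro n
    induction n with
    | zero => simp [padN, lagNFA, s0, t0]
    | succ n ih =>
      rw [padN_succ, NFA.eval_append_singleton, NFA.mem_stepSet]
      exact ⟨_, ih, hstep n⟩
  refine ⟨n0, fun n hn => ⟨_, ?_, key n⟩⟩
  simp [lagNFA, hend n hn]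

theorem lagRel_of_diff {R : Set (List A × List A)} {g : B → List A} {N : ℕ}
    {x y : List B} (h : expandW g x = expandW g y)
    (h1 : ∀ i, (expandW g (x.take i)).length ≤ (expandW g (y.take i)).length + N)
    (h2 : ∀ i, (expandW g (y.take i)).length ≤ (expandW g (x.take i)).length + N) :
    LagRel R g N [] x y := by
  set W := expandW g x with hW
  have hpx : ∀ i, expandW g (x.take i) = W.take (expandW g (x.take i)).length := by
    intro i
    have : W = expandW g (x.take i) ++ expandW g (x.drop i) := by
      rw [← expandW_append, List.take_append_drop]
    rw [this, List.take_left']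
    rfl
  have hpy : ∀ i, expandW g (y.take i) = W.take (expandW g (y.take i)).length := by
    intro i
    have : W = expandW g (y.take i) ++ expandW g (y.drop i) := by
      rw [← expandW_append, List.take_append_drop, h]
    rw [this, List.take_left']
    rfl
  set a := fun i => (expandW g (x.take i)).length with ha
  set b := fun i => (expandW g (y.take i)).length with hb
  have amono : ∀ i, a i ≤ a (i + 1) := by
    intro i
    simp only [ha, expandW_take_succ, List.length_append]
    omega
  have bmono : ∀ i, b i ≤ b (i + 1) := by
    intro i
    simp only [hb, expandW_take_succ, List.length_append]
    omega
  have ale : ∀ i, a i ≤ W.length := by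
    intro i
    have := congrArg List.length (hpx i)
    rw [List.length_take] at this
    change a i = _ at this
    omega
  have ble : ∀ i, b i ≤ W.length := by
    intro i
    have := congrArg List.length (hpy i)
    rw [List.length_take] at this
    change b i = _ at this
    omega
  have gen : ∀ (p m p' m' : ℕ) (l : List A), p ≤ m → p ≤ p' → m ≤ m' → p' ≤ m' →
      m' ≤ W.length → W.take p' = W.take p ++ l →
      l ++ (W.take m').drop p' = (W.take m).drop p ++ (W.take m').drop m := by
    intro p m p' m' l q1 q2 q3 q4 q5 q6
    apply List.append_cancel_left (as := W.take p)
    have e1 : W.take p ++ (W.take m).drop p = W.take m := by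
      conv_rhs => rw [← List.take_append_drop p (W.take m), List.take_take, min_eq_left q1]
    have e2 : W.take m ++ (W.take m').drop m = W.take m' := by
      conv_rhs => rw [← List.take_append_drop m (W.take m'), List.take_take, min_eq_left q3]
    have e3 : W.take p' ++ (W.take m').drop p' = W.take m' := by
      conv_rhs => rw [← List.take_append_drop p' (W.take m'), List.take_take, min_eq_left q4]
    rw [← List.append_assoc, ← q6, e3, ← List.append_assoc, e1, e2]
  refine lagRel_of_run (fun i => (W.take (max (a i) (b i))).drop (a i))
    (fun i => (W.take (max (a i) (b i))).drop (b i)) ?_ ?_ ?_ ?_ ?_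
    (max x.length y.length) ?_
  · intro i
    have := h2 i
    change b i ≤ a i + N at this
    rw [List.length_drop, List.length_take]
    omega
  · intro i
    have := h1 i
    change a i ≤ b i + N at this
    rw [List.length_drop, List.length_take]
    omega
  · simp [ha, hb, expandW_nil]
  · simp [ha, hb, expandW_nil]
  · intro i
    have := amono i
    have := bmono i
    have := ale (i + 1)
    have := ble (i + 1)
    refine ⟨(W.take (max (a (i + 1)) (b (i + 1)))).drop (max (a i) (b i)), WordEq.of_eq ?_,
      WordEq.of_eq ?_⟩
    · apply gen <;> try omega
      rw [← hpx, ← hpx, expandW_take_succ]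
    · apply gen <;> try omega
      rw [← hpy, ← hpy, expandW_take_succ]
  · intro n hn
    have e1 : a n = W.length := by
      simp only [ha]
      rw [List.take_of_length_le (by omega)]
    have e2 : b n = W.length := by
      simp only [hb]
      rw [List.take_of_length_le (by omega), h]
    simp [e1, e2]

/-- Number of letters whose expansion does not have length `l`. -/
def cnt (g : B → List A) (l : ℕ) (x : List B) : ℕ := x.countP (fun b => decide ((g b).length ≠ l))

theorem cnt_append (g : B → List A) (l : ℕ) (x y : List B) :
    cnt g l (x ++ y) = cnt g l x + cnt g l y := by simp [cnt]

theorem cnt_nil (g : B → List A) (l : ℕ) : cnt g l [] = 0 := rfl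

theorem cnt_cons (g : B → List A) (l : ℕ) (b : B) (x : List B) :
    cnt g l (b :: x) = cnt g l x + if (g b).length = l then 0 else 1 := by
  simp [cnt, List.countP_cons]

theorem cnt_bounds (g : B → List A) (M l : ℕ) (hl : l ≤ M) (hM : ∀ b, (g b).length ≤ M)
    (x : List B) : (expandW g x).length ≤ x.length * l + cnt g l x * M ∧
      x.length * l ≤ (expandW g x).length + cnt g l x * M := by
  induction x with
  | nil => simp [expandW_nil]
  | cons b x ih =>
    rw [expandW_cons, cnt_cons, List.length_append, List.length_cons, add_mul, add_mul]
    have := hM b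
    split_ifs with h
    · omega
    · omega

theorem cnt_take (g : B → List A) (l : ℕ) (x : List B) (i : ℕ) :
    cnt g l (x.take i) ≤ cnt g l x := (List.take_sublist i x).countP_le

theorem lag_half (g : B → List A) (M l K : ℕ) (hl : l ≤ M) (hM : ∀ b, (g b).length ≤ M)
    {x y : List B} (h : expandW g x = expandW g y) (hx : cnt g l x ≤ K) (hy : cnt g l y ≤ K)
    (i : ℕ) : (expandW g (x.take i)).length ≤ (expandW g (y.take i)).length + 2 * (K * M) := by
  have hx1 := cnt_bounds g M l hl hM (x.take i)
  have hy1 := cnt_bounds g M l hl hM (y.take i)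
  have hx2 : cnt g l (x.take i) * M ≤ K * M :=
    Nat.mul_le_mul_right _ ((cnt_take g l x i).trans hx)
  have hy2 : cnt g l (y.take i) * M ≤ K * M :=
    Nat.mul_le_mul_right _ ((cnt_take g l y i).trans hy)
  by_cases hi : y.length ≤ i
  · rw [List.take_of_length_le hi, ← h]
    have : (expandW g x).length = (expandW g (x.take i)).length + (expandW g (x.drop i)).length := by
      rw [← List.length_append, ← expandW_append, List.take_append_drop]
    omega
  · have : (x.take i).length * l ≤ (y.take i).length * l := by
      apply Nat.mul_le_mul_right
      rw [List.length_take, List.length_take]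
      omega
    omega

theorem lagRel_of_cnt {R : Set (List A × List A)} (g : B → List A) (M l K : ℕ) (hl : l ≤ M)
    (hM : ∀ b, (g b).length ≤ M) {x y : List B} (c : List B)
    (h : expandW g x = expandW g y) (hx : cnt g l x ≤ K) (hy : cnt g l y ≤ K) :
    LagRel R g (2 * (K * M)) [] (c ++ x) (c ++ y) := by
  apply lagRel_of_diff
  · rw [expandW_append, expandW_append, h]
  · intro i
    rw [List.take_append, List.take_append, expandW_append, expandW_append, List.length_append,
      List.length_append, add_assoc]
    exact Nat.add_le_add_left (lag_half g M l K hl hM h hx hy _) _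
  · intro i
    rw [List.take_append, List.take_append, expandW_append, expandW_append, List.length_append,
      List.length_append, add_assoc]
    exact Nat.add_le_add_left (lag_half g M l K hl hM h.symm hy hx _) _

/-- The basic run: `c d^m` against `c z y^m`. -/
theorem lagRel_run {R : Set (List A × List A)} (g : B → List A) (N : ℕ) (hN : 1 ≤ N)
    (c : List B) (d z y : B) (a z' y' : A) (hz : g z = [z']) (hy : g y = [y']) (m : ℕ)
    (H0 : m = 0 → z' = a) (H1 : 1 ≤ m → WordEq R (g d ++ [a]) [z', y'])
    (H2 : 2 ≤ m → WordEq R (g d ++ [a]) [a, y']) :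
    LagRel R g N [a] (c ++ List.replicate m d) (c ++ z :: List.replicate m y) := by
  refine lagRel_of_run (fun i => if i ≤ c.length then [] else [a])
    (fun i => if i ≤ c.length then [] else if i ≤ c.length + m then [y'] else [])
    ?_ ?_ ?_ ?_ ?_ (c.length + m + 1) ?_
  · intro i; split_ifs <;> simp [hN]
  · intro i; split_ifs <;> simp [hN]
  · simp
  · simp
  · intro i
    try dsimp only
    rcases lt_trichotomy i c.length with hi | hi | hi
    · rw [if_pos (by omega), if_pos (by omega), if_pos (by omega), if_pos (by omega),
        List.getElem?_append_left hi, List.getElem?_append_left hi]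
      exact ⟨gOpt g ((c)[i]?), by simpa using WordEq.rfl' _, by simpa using WordEq.rfl' _⟩
    · subst hi
      rw [if_neg (by omega), if_pos le_rfl, if_neg (by omega), if_pos le_rfl,
        List.getElem?_append_right le_rfl, List.getElem?_append_right le_rfl]
      rcases Nat.eq_zero_or_pos m with rfl | hm
      · refine ⟨[a], ?_⟩
        simp [gOpt, expandW, hz, H0 rfl, WordEq.rfl']
      · refine ⟨[z', y'], ?_⟩
        rw [if_pos (by omega)]
        have := H1 hm
        simp [gOpt, expandW, hz, List.getElem?_replicate, hm, WordEq.rfl', this]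
    · have h5 : ¬ i ≤ c.length := by omega
      have h6 : ¬ i + 1 ≤ c.length := by omega
      simp only [h5, h6, if_false]
      rw [List.getElem?_append_right (by omega), List.getElem?_append_right (by omega)]
      obtain ⟨j, hj⟩ : ∃ j, i - c.length = j + 1 := ⟨i - c.length - 1, by omega⟩
      rw [hj, List.getElem?_cons_succ]
      rcases lt_trichotomy (j + 1) m with hm | hm | hm
      · rw [if_pos (show i + 1 ≤ c.length + m by omega), if_pos (show i ≤ c.length + m by omega)]
        refine ⟨[y'], ?_⟩
        have := H2 (by omega)
        have h3 : j < m := by omega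
        simp [gOpt, expandW, hy, List.getElem?_replicate, hm, h3, WordEq.rfl', this]
      · rw [if_neg (show ¬ i + 1 ≤ c.length + m by omega), if_pos (show i ≤ c.length + m by omega)]
        refine ⟨[], ?_⟩
        have h3 : j < m := by omega
        have h4 : ¬ (j + 1 < m) := by omega
        simp [gOpt, expandW, hy, List.getElem?_replicate, h3, h4, WordEq.rfl']
      · rw [if_neg (show ¬ i + 1 ≤ c.length + m by omega), if_neg (show ¬ i ≤ c.length + m by omega)]
        refine ⟨[], ?_⟩
        have h3 : ¬ j < m := by omega
        have h4 : ¬ (j + 1 < m) := by omega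
        simp [gOpt, expandW, List.getElem?_replicate, h3, h4, WordEq.rfl']
  · intro n hn
    have h5 : ¬ n ≤ c.length := by omega
    have h6 : ¬ n ≤ c.length + m := by omega
    simp [h5, h6]

end Lag


section Coding

variable {α : Type}

open Classical in
/-- First block of a word: one letter for short words or words beginning with `y^M`,
otherwise `M` letters. -/
noncomputable def hdW (y : α) (M : ℕ) (v : List α) : List α :=
  if v.length < M ∨ v.take M = List.replicate M y then v.take 1 else v.take M

theorem hdW_append (y : α) (M : ℕ) (v w : List α) (h : M ≤ v.length) (hM : 1 ≤ M) :
    hdW y M (v ++ w) = hdW y M v := by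
  have e1 : (v ++ w).take M = v.take M := List.take_append_of_le_length h
  have e2 : (v ++ w).take 1 = v.take 1 := List.take_append_of_le_length (by omega)
  have e3 : ¬ (v ++ w).length < M := by rw [List.length_append]; omega
  have e4 : ¬ v.length < M := by omega
  unfold hdW
  rw [e1, e2]
  by_cases h5 : v.take M = List.replicate M y
  · rw [if_pos (Or.inr h5), if_pos (Or.inr h5)]
  · rw [if_neg (by tauto), if_neg (by tauto)]

theorem hdW_cases (y : α) (M : ℕ) (v : List α) :
    (hdW y M v = v.take 1 ∧ (v.length < M ∨ v.take M = List.replicate M y)) ∨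
    (hdW y M v = v.take M ∧ M ≤ v.length ∧ v.take M ≠ List.replicate M y) := by
  unfold hdW
  split_ifs with h
  · exact Or.inl ⟨rfl, h⟩
  · push Not at h
    exact Or.inr ⟨rfl, h⟩

theorem hdW_eq_take (y : α) (M : ℕ) (hM : 1 ≤ M) (v : List α) :
    ∃ n, 1 ≤ n ∧ n ≤ M ∧ hdW y M v = v.take n := by
  rcases hdW_cases y M v with h | h
  · exact ⟨1, le_rfl, hM, h.1⟩
  · exact ⟨M, hM, le_rfl, h.1⟩

/-- Nonempty words of length at most `M`. -/
abbrev Blk (α : Type) (M : ℕ) : Type := {l : List α // l ≠ [] ∧ l.length ≤ M}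

abbrev Blk.g {M : ℕ} (b : Blk α M) : List α := b.1

/-- Valid codings. -/
def ValidC (y : α) (M : ℕ) : List (Blk α M) → Prop
  | [] => True
  | b :: β => ValidC y M β ∧ b.1 = hdW y M (b.1 ++ expandW Blk.g β)

theorem validC_unique (y : α) (M : ℕ) : ∀ β β' : List (Blk α M), ValidC y M β → ValidC y M β' →
    expandW Blk.g β = expandW Blk.g β' → β = β'
  | [], [], _, _, _ => rfl
  | [], b :: β, _, _, h => by
    rw [expandW_nil, expandW_cons] at h
    exact absurd (List.append_eq_nil_iff.1 h.symm).1 b.2.1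
  | b :: β, [], _, _, h => by
    rw [expandW_nil, expandW_cons] at h
    exact absurd (List.append_eq_nil_iff.1 h).1 b.2.1
  | b :: β, b' :: β', h1, h2, h => by
    rw [expandW_cons, expandW_cons] at h
    have e : b.1 = b'.1 := by
      rw [h1.2, h2.2]
      exact congrArg _ h
    have e' : b = b' := Subtype.ext e
    subst e'
    rw [validC_unique y M β β' h1.1 h2.1 (List.append_cancel_left h)]

theorem validC_cons_exists (y : α) (M : ℕ) (hM : 1 ≤ M) (v : List α) (hv : v ≠ []) :
    ∃ b : Blk α M, ∃ v', v = b.1 ++ v' ∧ b.1 = hdW y M v := by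
  obtain ⟨n, h1, h2, h3⟩ := hdW_eq_take y M hM v
  refine ⟨⟨v.take n, ?_, ?_⟩, v.drop n, ?_, h3.symm⟩
  · intro h
    rw [List.take_eq_nil_iff] at h
    rcases h with h | h
    · omega
    · exact hv h
  · rw [List.length_take]; omega
  · exact (List.take_append_drop n v).symm

theorem validC_exists (y : α) (M : ℕ) (hM : 1 ≤ M) (v : List α) :
    ∃ β : List (Blk α M), ValidC y M β ∧ expandW Blk.g β = v := by
  induction h : v.length using Nat.strong_induction_on generalizing v with
  | _ n ih =>
    by_cases hv : v = []
    · exact ⟨[], trivial, hv.symm⟩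
    · obtain ⟨b, v', e, hb⟩ := validC_cons_exists y M hM v hv
      have := List.length_pos_iff.2 b.2.1
      have hl : v'.length < n := by
        rw [← h, e, List.length_append]; omega
      obtain ⟨β, h1, h2⟩ := ih _ hl v' rfl
      refine ⟨b :: β, ⟨h1, ?_⟩, ?_⟩
      · rw [h2, ← e]; exact hb
      · rw [expandW_cons, h2]; exact e.symm

theorem validC_pre_closed (y : α) (M : ℕ) (hM : 1 ≤ M) : ∀ β β' : List (Blk α M),
    ValidC y M (β ++ β') → ValidC y M β
  | [], _, _ => trivial
  | b :: β, β', h => by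
    refine ⟨validC_pre_closed y M hM β β' h.1, ?_⟩
    have h2 := h.2
    change b.1 = hdW y M (b.1 ++ expandW Blk.g (β ++ β')) at h2
    rw [expandW_append, ← List.append_assoc] at h2
    by_cases hl : M ≤ (b.1 ++ expandW Blk.g β).length
    · rwa [hdW_append _ _ _ _ hl hM] at h2
    · have hb := List.length_pos_iff.2 b.2.1
      rcases hdW_cases y M (b.1 ++ expandW Blk.g β) with h3 | h3
      · rcases hdW_cases y M (b.1 ++ expandW Blk.g β ++ expandW Blk.g β') with h4 | h4
        · rw [h3.1]
          rw [h4.1, List.take_append_of_le_length] at h2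
          · exact h2
          · rw [List.length_append]; omega
        · rw [h4.1] at h2
          have := congrArg List.length h2
          rw [List.length_take] at this
          rw [List.length_append] at hl
          omega
      · exact absurd h3.2.1 hl

theorem validC_decomp (y : α) (M : ℕ) (hM : 1 ≤ M) (w : List α) :
    ∃ (γ : List (Blk α M)) (r : List α), expandW Blk.g γ ++ r = w ∧ r.length < M ∧
      ∀ v δ, ValidC y M δ → expandW Blk.g δ = r ++ v → ValidC y M (γ ++ δ) := by
  induction h : w.length using Nat.strong_induction_on generalizing w with
  | _ n ih =>
    by_cases hw : w.length < M
    · exact ⟨[], w, by simp [expandW_nil], hw, fun v δ h _ => h⟩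
    · have hne : w ≠ [] := by
        rintro rfl
        simp at hw; omega
      obtain ⟨b, w', e, hb⟩ := validC_cons_exists y M hM w hne
      have := List.length_pos_iff.2 b.2.1
      have hl : w'.length < n := by
        rw [← h, e, List.length_append]; omega
      obtain ⟨γ, r, h1, h2, h3⟩ := ih _ hl w' rfl
      refine ⟨b :: γ, r, ?_, h2, ?_⟩
      · rw [expandW_cons, List.append_assoc, h1]; exact e.symm
      · intro v δ hδ hδ2
        refine ⟨h3 v δ hδ hδ2, ?_⟩
        change b.1 = hdW y M (b.1 ++ expandW Blk.g (γ ++ δ))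
        rw [expandW_append, hδ2, ← List.append_assoc _ r, h1, ← List.append_assoc, ← e,
          hdW_append _ _ _ _ (by omega) hM]
        exact hb

theorem cnt_le_length {M : ℕ} (l : ℕ) (δ : List (Blk α M)) :
    cnt Blk.g l δ ≤ (expandW Blk.g δ).length := by
  induction δ with
  | nil => simp [cnt_nil]
  | cons b δ ih =>
    have := List.length_pos_iff.2 b.2.1
    rw [cnt_cons, expandW_cons, List.length_append]
    change _ ≤ b.1.length + _
    split_ifs <;> omega

/-- Powers of a word. -/
def wpow (c : List α) : ℕ → List α
  | 0 => []
  | m + 1 => c ++ wpow c m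

theorem expandW_replicate {B : Type} (g : B → List α) (m : ℕ) (d : B) :
    expandW g (List.replicate m d) = wpow (g d) m := by
  induction m with
  | zero => rfl
  | succ m ih => rw [List.replicate_succ, expandW_cons, ih, wpow]

theorem wpow_succ' (c : List α) (m : ℕ) : wpow c (m + 1) = wpow c m ++ c := by
  induction m with
  | zero => simp [wpow]
  | succ m ih => rw [wpow, ih, ← List.append_assoc, ← wpow]; rw [← ih]

/-- (Y) -/
theorem cnt_Y (y : α) (M : ℕ) (hM : 1 ≤ M) : ∀ (δ : List (Blk α M)) (r : List α) (m : ℕ),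
    ValidC y M δ → expandW Blk.g δ = r ++ List.replicate m y → cnt Blk.g 1 δ ≤ r.length
  | [], r, m, _, _ => by simp [cnt_nil]
  | b :: δ, r, m, hv, he => by
    rw [expandW_cons] at he
    have hb := hv.2
    have hb1 := List.length_pos_iff.2 b.2.1
    change b.1 ++ _ = _ at he
    rw [he] at hb
    rw [cnt_cons]
    have key : ∀ n, b.1 = (r ++ List.replicate m y).take n → n ≤ r.length + m →
        cnt Blk.g 1 δ ≤ r.length - n := by
      intro n hn hn2
      have e : expandW Blk.g δ = r.drop n ++ List.replicate (m - (n - r.length)) y := by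
        have h0 : b.1.length = n := by
          rw [hn, List.length_take, List.length_append, List.length_replicate]; omega
        have := congrArg (List.drop n) he
        rw [List.drop_left' h0, List.drop_append, List.drop_replicate] at this
        exact this
      have := cnt_Y y M hM δ _ _ hv.1 e
      rwa [List.length_drop] at this
    have hlen : 1 ≤ r.length + m := by
      have := congrArg List.length he
      rw [List.length_append, List.length_append, List.length_replicate] at this
      omega
    rcases hdW_cases y M (r ++ List.replicate m y) with h | h
    · rw [h.1] at hb
      have h5 := key 1 hb hlen
      have h6 : b.1.length = 1 := by
        rw [hb, List.length_take, List.length_append, List.length_replicate]; omega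
      rw [if_pos h6]; omega
    · have h7 := h.2.1
      rw [List.length_append, List.length_replicate] at h7
      rw [h.1] at hb
      have h5 := key M hb h7
      split_ifs
      · omega
      · have : r ≠ [] := by
          rintro rfl
          apply h.2.2
          rw [List.nil_append, List.take_replicate]
          simp at h7
          rw [Nat.min_eq_left h7]
        have := List.length_pos_iff.2 this
        omega

theorem validC_step_M (y : α) (M : ℕ) (r s t : List α) (hl : (r ++ s).length = M)
    (hne : r ++ s ≠ List.replicate M y) (δ : List (Blk α M)) (hM : 1 ≤ M)
    (hv : ValidC y M δ) (he : expandW Blk.g δ = r ++ s ++ t) :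
    ∃ b δ', δ = b :: δ' ∧ b.1.length = M ∧ ValidC y M δ' ∧ expandW Blk.g δ' = t := by
  cases δ with
  | nil =>
    exfalso
    have := congrArg List.length he
    rw [List.length_append (as := r ++ s), hl] at this
    simp [expandW_nil] at this
    omega
  | cons b δ' =>
    rw [expandW_cons] at he
    have hb := hv.2
    change b.1 ++ _ = _ at he
    rw [he, hdW_append _ _ _ _ hl.ge hM] at hb
    have : hdW y M (r ++ s) = r ++ s := by
      rcases hdW_cases y M (r ++ s) with h | h
      · exfalso
        rcases h.2 with h' | h'
        · omega
        · rw [List.take_of_length_le hl.le] at h'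
          exact hne h'
      · rw [h.1, List.take_of_length_le hl.le]
    rw [this] at hb
    refine ⟨b, δ', rfl, by rw [hb, hl], hv.1, ?_⟩
    rw [hb] at he
    exact List.append_cancel_left he

/-- (A) -/
theorem cnt_A (y : α) (M : ℕ) (hM : 1 ≤ M) (s r : List α) (hl : (s ++ r).length = M)
    (hc : s ++ r ≠ List.replicate M y) (m : ℕ) (δ : List (Blk α M)) (hv : ValidC y M δ)
    (he : expandW Blk.g δ = r ++ wpow (s ++ r) m) : cnt Blk.g M δ ≤ M := by
  induction m generalizing δ with
  | zero =>
    have h1 := cnt_le_length M δ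
    rw [he] at h1
    simp [wpow] at h1 hl
    omega
  | succ m ih =>
    have hl' : (r ++ s).length = M := by
      rw [← hl, List.length_append, List.length_append]; omega
    obtain ⟨b, δ', e1, e2, e3, e4⟩ := validC_step_M y M r s (r ++ wpow (s ++ r) m) hl' (by
      intro h
      apply hc
      rw [List.eq_replicate_iff] at h ⊢
      refine ⟨hl, fun b hb => h.2 b ?_⟩
      rw [List.mem_append] at hb ⊢
      exact hb.symm) δ hM hv (by rw [he, wpow]; simp)
    rw [e1, cnt_cons, if_pos e2]
    exact ih δ' e3 e4

/-- (B) -/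
theorem cnt_B (y : α) (M : ℕ) (hM : 1 ≤ M) (c : List α) (hl : c.length = M)
    (hc : c ≠ List.replicate M y) (m : ℕ) : ∀ (δ : List (Blk α M)) (r : List α), r.length ≤ M →
    ValidC y M δ → expandW Blk.g δ = r ++ wpow c m → cnt Blk.g M δ ≤ r.length + M
  | [], r, _, _, _ => by simp [cnt_nil]
  | b :: δ, r, hr, hv, he => by
    cases m with
    | zero =>
      have h1 := cnt_le_length M (b :: δ)
      rw [he] at h1
      simp [wpow] at h1
      omega
    | succ m =>
      by_cases hr0 : r = []
      · subst hr0
        have := cnt_A y M hM c [] (by simpa using hl) (by simpa using hc) (m + 1) (b :: δ) hv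
          (by simpa using he)
        simpa using this
      · by_cases hq : r ++ c.take (M - r.length) = List.replicate M y
        · obtain ⟨a, r', rfl⟩ := List.exists_cons_of_ne_nil hr0
          have hb := hv.2
          have he' := he
          rw [expandW_cons] at he
          change b.1 ++ _ = _ at he
          rw [he] at hb
          have e : hdW y M (a :: r' ++ wpow c (m + 1)) = [a] := by
            have : a :: r' ++ wpow c (m + 1) = (a :: r' ++ c.take (M - (a :: r').length)) ++
              (c.drop (M - (a :: r').length) ++ wpow c m) := by
              rw [List.append_assoc, ← List.append_assoc (List.take _ _), List.take_append_drop, wpow]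
            rw [this, hdW_append, hq]
            · rcases hdW_cases y M (List.replicate M y) with h | h
              · rw [h.1, ← hq]; rfl
              · exact absurd (by simp) h.2.2
            · rw [hq, List.length_replicate]
            · exact hM
          rw [e] at hb
          rw [hb] at he
          have := cnt_B y M hM c hl hc (m + 1) δ r' (by simp at hr; omega) hv.1
            (by simpa using he)
          rw [cnt_cons]
          simp only [List.length_cons]
          split_ifs <;> omega
        · have hlt : (r ++ c.take (M - r.length)).length = M := by
            rw [List.length_append, List.length_take]; omega
          obtain ⟨b', δ', e1, e2, e3, e4⟩ := validC_step_M y M r (c.take (M - r.length))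
            (c.drop (M - r.length) ++ wpow c m) hlt hq (b :: δ) hM hv (by
              rw [he, wpow, List.append_assoc, ← List.append_assoc (List.take _ _),
                List.take_append_drop])
          have := cnt_A y M hM (c.take (M - r.length)) (c.drop (M - r.length))
            (by rw [List.take_append_drop, hl]) (by rwa [List.take_append_drop]) m δ' e3
            (by rw [List.take_append_drop]; exact e4)
          rw [e1, cnt_cons, if_pos e2]
          omega

end Coding


section Structure

variable {α : Type}

/-- The language of valid codings of irreducible nonempty words. -/
def LC (y : α) (M : ℕ) (u : List α) : Set (List (Blk α M)) :=
  {β | ValidC y M β ∧ ¬ u <:+: expandW Blk.g β ∧ β ≠ []}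

theorem hdW_take (y : α) (M n : ℕ) (hM : 1 ≤ M) (hn : M ≤ n) (v : List α) :
    hdW y M (v.take n) = hdW y M v := by
  by_cases h : v.length ≤ n
  · rw [List.take_of_length_le h]
  · conv_rhs => rw [← List.take_append_drop n v]
    rw [hdW_append]
    · rw [List.length_take]; omega
    · exact hM

theorem hdW_append_take (y : α) (M n : ℕ) (hM : 1 ≤ M) (hn : M ≤ n) (b v : List α) :
    hdW y M (b ++ v) = hdW y M (b ++ v.take n) := by
  rw [← hdW_take y M n hM hn, ← hdW_take y M n hM hn (b ++ v.take n)]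
  congr 1
  rw [List.take_append, List.take_append, List.take_take]
  congr 2
  omega

theorem factor_take_iff (u b e : List α) (n : ℕ) (hn : u.length ≤ n) :
    u <:+: b ++ e ↔ u <:+: e ∨ u <:+: b ++ e.take n := by
  constructor
  · intro h
    rcases List.infix_append_iff.1 h with h | h | ⟨l1, l2, rfl, h3, h4⟩
    · exact Or.inr (List.infix_append_of_infix_left h)
    · exact Or.inl h
    · right
      refine List.infix_append_iff.2 (Or.inr (Or.inr ⟨l1, l2, rfl, h3, ?_⟩))
      rw [List.prefix_take_iff]
      rw [List.length_append] at hn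
      exact ⟨h4, by omega⟩
  · rintro (h | h)
    · exact List.infix_append_of_infix_right h
    · refine h.trans (List.IsPrefix.isInfix ?_)
      exact ⟨e.drop n, by rw [List.append_assoc, List.take_append_drop]⟩

theorem reg_LC [Finite α] (y : α) (M : ℕ) (u : List α) (hM : 1 ≤ M) :
    IsReg (LC y M u) := by
  set n := max M u.length with hn
  have : Finite {l : List α // l.length ≤ n} := (List.finite_length_le α n).to_subtype
  have key := reg_of_cons (Γ := Blk α M) (σ := Prop × Prop × {l : List α // l.length ≤ n})
    (fun β => (ValidC y M β, ¬ u <:+: expandW Blk.g β,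
      ⟨(expandW Blk.g β).take n, by rw [List.length_take]; omega⟩))
    (fun s b => (s.1 ∧ b.1 = hdW y M (b.1 ++ s.2.2.1), s.2.1 ∧ ¬ u <:+: b.1 ++ s.2.2.1,
      ⟨(b.1 ++ s.2.2.1).take n, by rw [List.length_take]; omega⟩))
    (by
      intro β b
      refine Prod.ext ?_ (Prod.ext ?_ (Subtype.ext ?_))
      · change (_ ∧ _) = (_ ∧ _)
        dsimp only
        rw [hdW_append_take y M n hM (by omega)]
      · dsimp only
        rw [expandW_cons, factor_take_iff u _ _ n (by omega), not_or]
      · dsimp only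
        rw [expandW_cons]
        change List.take n (b.1 ++ _) = _
        rw [List.take_append, List.take_append, List.take_take]
        congr 2
        omega) {s | s.1 ∧ s.2.1 ∧ s.2.2.1 ≠ []}
  convert key using 1
  ext β
  simp only [Set.mem_ofPred_eq, LC]
  refine and_congr Iff.rfl (and_congr Iff.rfl (not_congr ?_))
  rw [List.take_eq_nil_iff]
  constructor
  · rintro rfl; right; rfl
  · rintro (h | h)
    · omega
    · cases β with
      | nil => rfl
      | cons b β =>
        rw [expandW_cons] at h
        exact absurd (List.append_eq_nil_iff.1 h).1 b.2.1

theorem strip_pow (c w : List α) (hc : c ≠ []) : ∃ w0 m, w = w0 ++ wpow c m ∧ ¬ c <:+ w0 := by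
  induction h : w.length using Nat.strong_induction_on generalizing w with
  | _ n ih =>
    by_cases hw : c <:+ w
    · obtain ⟨w', rfl⟩ := hw
      have := List.length_pos_iff.2 hc
      rw [List.length_append] at h
      obtain ⟨w0, m, e, h2⟩ := ih w'.length (by omega) w' rfl
      exact ⟨w0, m + 1, by rw [wpow_succ', ← List.append_assoc, ← e], h2⟩
    · exact ⟨w, 0, by simp [wpow], hw⟩

theorem analysis {R : Set (List α × List α)} (c : List α) (t x y : α) (M : ℕ) (hM : 1 ≤ M)
    (hc : c.length = M) (hR : WordEq R (c ++ [t]) [x, y]) (h1 : ¬ [x, y] <:+ c ++ [t])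
    (h2 : c ++ [t] ≠ List.replicate M y ++ [x]) (w : List α) (hw : ¬ c ++ [t] <:+: w) (a : α) :
    ∃ w0 m z, w = w0 ++ wpow c m ∧ ¬ c ++ [t] <:+: w0 ++ z :: List.replicate m y ∧
      (m = 0 → z = a) ∧ (1 ≤ m → WordEq R (c ++ [a]) [z, y]) ∧
      (2 ≤ m → WordEq R (c ++ [a]) [a, y]) ∧ (c ≠ List.replicate M y ∨ m ≤ 1) := by
  have hcne : c ≠ [] := by
    rintro rfl
    simp at hc; omega
  have suf1 : ∀ p b, c ++ [t] <:+ p ++ [b] → t = b ∧ c <:+ p := by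
    intro p b h
    rcases List.suffix_concat_iff.1 h with h | ⟨s, h, h'⟩
    · simp at h
    · have := List.append_inj' h rfl
      exact ⟨by simpa using this.2, this.1 ▸ h'⟩
  have suf2 : ∀ p, ¬ c ++ [t] <:+ p ++ [x] ++ [y] := by
    intro p h
    apply h1
    refine List.suffix_of_suffix_length_le ?_ h ?_
    · exact ⟨p, by simp⟩
    · simp; omega
  by_cases hwa : c ++ [t] <:+: w ++ [a]
  · have h3 : c ++ [t] <:+ w ++ [a] := by
      rcases List.infix_concat_iff.1 hwa with h | h
      · exact h
      · exact absurd h hw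
    obtain ⟨rfl, h4⟩ := suf1 _ _ h3
    by_cases hx : t = x
    · subst hx
      obtain ⟨w0, m, e, h5⟩ := strip_pow c w hcne
      refine ⟨w0, m, t, e, ?_, fun _ => rfl, fun _ => hR, fun _ => hR, Or.inl ?_⟩
      · have hw0 : ¬ c ++ [t] <:+: w0 := fun h => hw (e ▸ List.infix_append_of_infix_left h)
        clear e
        induction m with
        | zero =>
          intro h
          change _ <:+: w0 ++ [t] at h
          rcases List.infix_concat_iff.1 h with h | h
          · exact h5 (suf1 _ _ h).2
          · exact hw0 h
        | succ j ih =>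
          intro h
          rw [List.replicate_succ', ← List.cons_append, ← List.append_assoc] at h
          rcases List.infix_concat_iff.1 h with h | h
          · obtain ⟨rfl, -⟩ := suf1 _ _ h
            apply suf2 (w0 ++ List.replicate j t)
            rw [← List.replicate_succ, List.replicate_succ', ← List.append_assoc w0] at h
            exact h
          · exact ih h
      · intro h
        exact h2 (by rw [h])
    · obtain ⟨w', rfl⟩ := h4
      refine ⟨w', 1, x, by simp [wpow], ?_, by omega, fun _ => hR, by omega, Or.inr le_rfl⟩
      intro h
      have e : w' ++ x :: List.replicate 1 y = w' ++ [x] ++ [y] := by simp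
      rw [e] at h
      rcases List.infix_concat_iff.1 h with h | h
      · exact suf2 _ h
      · rcases List.infix_concat_iff.1 h with h | h
        · exact hx (suf1 _ _ h).1
        · exact hw (List.infix_append_of_infix_left h)
  · exact ⟨w, 0, a, by simp [wpow], hwa, fun _ => rfl, by omega, by omega, Or.inr (by omega)⟩

/-- Coding letter by letter. -/
def singles (M : ℕ) (hM : 1 ≤ M) (r : List α) : List (Blk α M) :=
  r.map (fun a => ⟨[a], by simp, hM⟩)

theorem expandW_singles (M : ℕ) (hM : 1 ≤ M) (r : List α) :
    expandW Blk.g (singles M hM r) = r := by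
  induction r with
  | nil => rfl
  | cons a r ih =>
    have e : singles M hM (a :: r) = ⟨[a], by simp, hM⟩ :: singles M hM r := rfl
    rw [e, expandW_cons, ih]; rfl

theorem cnt_singles (M : ℕ) (hM : 1 ≤ M) (r : List α) :
    cnt Blk.g 1 (singles M hM r) = 0 := by
  induction r with
  | nil => rfl
  | cons a r ih =>
    have e : singles M hM (a :: r) = ⟨[a], by simp, hM⟩ :: singles M hM r := rfl
    rw [e, cnt_cons, ih]; rfl

theorem cnt_replicate {B : Type} (g : B → List α) (l m : ℕ) (d : B) (h : (g d).length = l) :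
    cnt g l (List.replicate m d) = 0 := by
  induction m with
  | zero => rfl
  | succ m ih => rw [List.replicate_succ, cnt_cons, ih, if_pos h]

theorem wpow_single (y : α) (m : ℕ) : wpow [y] m = List.replicate m y := by
  induction m with
  | zero => rfl
  | succ m ih => rw [List.replicate_succ, wpow, ih]; rfl

theorem length_wpow (c : List α) (m : ℕ) : (wpow c m).length = m * c.length := by
  induction m with
  | zero => simp [wpow]
  | succ m ih => rw [wpow, List.length_append, ih]; ring

theorem mul_complete {R : Set (List α × List α)} (c : List α) (t x y : α) (M : ℕ) (hM : 1 ≤ M)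
    (hc : c.length = M) (hR : WordEq R (c ++ [t]) [x, y]) (h1 : ¬ [x, y] <:+ c ++ [t])
    (h2 : c ++ [t] ≠ List.replicate M y ++ [x])
    (huniq : ∀ w w', w ≠ [] → w' ≠ [] → ¬ c ++ [t] <:+: w → ¬ c ++ [t] <:+: w' →
      WordEq R w w' → w = w')
    (a : α) (p q : List (Blk α M)) (hp : p ∈ LC y M (c ++ [t])) (hq : q ∈ LC y M (c ++ [t]))
    (h : WordEq R (expandW Blk.g p ++ [a]) (expandW Blk.g q)) :
    ∃ p' q', LagRel R Blk.g (2 * (2 * M * M)) [] p p' ∧ LagRel R Blk.g (2 * (2 * M * M)) [a] p' q' ∧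
      LagRel R Blk.g (2 * (2 * M * M)) [] q' q := by
  obtain ⟨w0, m, z, e, h3, h4, h5, h6, h7⟩ := analysis c t x y M hM hc hR h1 h2 _ hp.2.1 a
  obtain ⟨γ, r, e2, hr, h8⟩ := validC_decomp y M hM w0
  let B := Blk α M
  let g : B → List α := Blk.g
  have hg : ∀ b : B, (g b).length ≤ M := fun b => b.2.2
  have hN : 1 ≤ 2 * (2 * M * M) := by nlinarith
  let d : B := ⟨c, by rintro rfl; simp at hc; omega, hc.le⟩
  let zb : B := ⟨[z], by simp, hM⟩
  let yb : B := ⟨[y], by simp, hM⟩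
  have L2 : LagRel R g (2 * (2 * M * M)) [a] ((γ ++ singles M hM r) ++ List.replicate m d)
      ((γ ++ singles M hM r) ++ zb :: List.replicate m yb) :=
    lagRel_run g _ hN _ d zb yb a z y rfl rfl m h4 h5 h6
  have ez : expandW g (zb :: List.replicate m yb) = z :: List.replicate m y := by
    rw [expandW_cons, expandW_replicate]
    change [z] ++ wpow [y] m = _
    rw [wpow_single]; rfl
  have ed : expandW g (List.replicate m d) = wpow c m := expandW_replicate g m d
  obtain ⟨δ1, v1, E1⟩ := validC_exists y M hM (r ++ wpow c m)
  obtain ⟨δ2, v2, E2⟩ := validC_exists y M hM (r ++ z :: List.replicate m y)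
  have P : p = γ ++ δ1 := by
    apply validC_unique y M _ _ hp.1 (h8 _ _ v1 E1)
    rw [expandW_append, E1, ← List.append_assoc, e2, ← e]
  have W : WordEq R (expandW g p ++ [a]) (w0 ++ z :: List.replicate m y) := by
    have := lagRel_sound L2
    rw [expandW_append, expandW_append, expandW_singles, ed, expandW_append g _ (zb :: _), ez,
      expandW_append, expandW_singles] at this
    change WordEq R (expandW Blk.g γ ++ r ++ _ ++ _) (expandW Blk.g γ ++ r ++ _) at this
    rw [e2, ← e] at this
    exact this
  have Q : q = γ ++ δ2 := by
    apply validC_unique y M _ _ hq.1 (h8 _ _ v2 E2)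
    rw [expandW_append, E2, ← List.append_assoc, e2]
    refine huniq _ _ ?_ (by simp) hq.2.1 h3 (h.symm'.trans' W)
    obtain ⟨b, q', rfl⟩ := List.exists_cons_of_ne_nil hq.2.2
    rw [expandW_cons]
    intro h
    exact b.2.1 (List.append_eq_nil_iff.1 h).1
  refine ⟨_, _, ?_, L2, ?_⟩
  · rw [P, List.append_assoc]
    apply lagRel_of_cnt g M M (2 * M) le_rfl hg
    · rw [expandW_append g (singles _ _ _), ed, expandW_singles]; exact E1
    · rcases h7 with h7 | h7
      · have := cnt_B y M hM c hc h7 m δ1 r hr.le v1 E1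
        change cnt Blk.g M δ1 ≤ _
        omega
      · have := cnt_le_length M δ1
        rw [E1, List.length_append, length_wpow, hc] at this
        have h9 : m * M ≤ 1 * M := Nat.mul_le_mul_right _ h7
        change cnt Blk.g M δ1 ≤ _
        omega
    · rw [cnt_append, cnt_replicate g M m d hc]
      have := cnt_le_length M (singles M hM r)
      rw [expandW_singles] at this
      change cnt g M _ ≤ _ at this
      omega
  · rw [Q, List.append_assoc]
    apply lagRel_of_cnt g M 1 (2 * M) hM hg
    · rw [expandW_append g (singles _ _ _), ez, expandW_singles]; exact E2.symm
    · rw [cnt_append, cnt_cons, cnt_replicate g 1 m yb rfl]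
      change cnt Blk.g 1 _ + (0 + 0) ≤ _
      rw [cnt_singles]; omega
    · have := cnt_Y y M hM δ2 (r ++ [z]) m v2 (by rw [E2]; simp)
      change cnt Blk.g 1 δ2 ≤ _
      simp at this
      omega

theorem main_struct [Finite α] {R : Set (List α × List α)} (c : List α) (t x y : α) (M : ℕ)
    (hM : 1 ≤ M) (hc : c.length = M) (hR : WordEq R (c ++ [t]) [x, y])
    (h1 : ¬ [x, y] <:+ c ++ [t]) (h2 : c ++ [t] ≠ List.replicate M y ++ [x])
    (huniq : ∀ w w', w ≠ [] → w' ≠ [] → ¬ c ++ [t] <:+: w → ¬ c ++ [t] <:+: w' →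
      WordEq R w w' → w = w')
    (hex : ∀ w, w ≠ [] → ∃ w', w' ≠ [] ∧ ¬ c ++ [t] <:+: w' ∧ WordEq R w' w) :
    SgpAutoStruct R (Blk.g (M := M)) (LC y M (c ++ [t])) := by
  set L := LC y M (c ++ [t]) with hL
  have hne : ∀ p ∈ L, expandW Blk.g p ≠ [] := by
    intro p hp
    obtain ⟨b, q', rfl⟩ := List.exists_cons_of_ne_nil hp.2.2
    rw [expandW_cons]
    intro h
    exact b.2.1 (List.append_eq_nil_iff.1 h).1
  have hreg : IsReg L := reg_LC y M _ hM
  have onto : ∀ w : List α, w ≠ [] → ∃ x ∈ L, WordEq R (expandW Blk.g x) w := by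
    intro w hw
    obtain ⟨w', h3, h4, h5⟩ := hex w hw
    obtain ⟨β, h6, h7⟩ := validC_exists y M hM w'
    refine ⟨β, ⟨h6, by rwa [h7], ?_⟩, by rwa [h7]⟩
    rintro rfl
    exact h3 h7.symm
  have uniq : ∀ p ∈ L, ∀ q ∈ L, WordEq R (expandW Blk.g p) (expandW Blk.g q) → p = q := by
    intro p hp q hq h
    exact validC_unique y M p q hp.1 hq.1 (huniq _ _ (hne p hp) (hne q hq) hp.2.1 hq.2.1 h)
  have LL : Sync (fun p q : List (Blk α M) => p ∈ L ∧ q ∈ L) :=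
    (sync_left hreg).and (sync_right hreg)
  have S0 : Sync (fun p q : List (Blk α M) => (p ∈ L ∧ q ∈ L) ∧
      WordEq R (expandW Blk.g p ++ []) (expandW Blk.g q)) := by
    refine (LL.and (sync_lagRel R Blk.g 0 [])).congr ?_
    intro p q
    refine and_congr_right fun hpq => ⟨fun h => lagRel_sound h, fun h => ?_⟩
    rw [List.append_nil] at h
    have := uniq p hpq.1 q hpq.2 h
    subst this
    exact lagRel_of_diff rfl (fun i => by omega) (fun i => by omega)
  have S1 : ∀ a : α, Sync (fun p q : List (Blk α M) => (p ∈ L ∧ q ∈ L) ∧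
      WordEq R (expandW Blk.g p ++ [a]) (expandW Blk.g q)) := by
    intro a
    refine (LL.and ((sync_lagRel R Blk.g (2 * (2 * M * M)) []).comp
      ((sync_lagRel R Blk.g (2 * (2 * M * M)) [a]).comp
        (sync_lagRel R Blk.g (2 * (2 * M * M)) [])))).congr ?_
    intro p q
    refine and_congr_right fun hpq => ⟨?_, fun h => ?_⟩
    · rintro ⟨p', h3, q', h4, h5⟩
      have h3 := lagRel_sound h3
      have h4 := lagRel_sound h4
      have h5 := lagRel_sound h5
      rw [List.append_nil] at h3 h5
      exact ((h3.right [a]).trans' h4).trans' h5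
    · obtain ⟨p', q', h3, h4, h5⟩ :=
        mul_complete c t x y M hM hc hR h1 h2 huniq a p q hpq.1 hpq.2 h
      exact ⟨p', h3, q', h4, h5⟩
  have S : ∀ v : List α, Sync (fun p q : List (Blk α M) => (p ∈ L ∧ q ∈ L) ∧
      WordEq R (expandW Blk.g p ++ v) (expandW Blk.g q)) := by
    intro v
    induction v using List.reverseRecOn with
    | nil => exact S0
    | append_singleton v a ih =>
      refine (ih.comp (S1 a)).congr ?_
      intro p q
      constructor
      · rintro ⟨s, ⟨h3, h4⟩, h5, h6⟩
        refine ⟨⟨h3.1, h5.2⟩, ?_⟩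
        rw [← List.append_assoc]
        exact (h4.right [a]).trans' h6
      · rintro ⟨h3, h4⟩
        obtain ⟨s, hs, h5⟩ := onto (expandW Blk.g p ++ v) (by
          intro h
          exact hne p h3.1 (List.append_eq_nil_iff.1 h).1)
        refine ⟨s, ⟨⟨h3.1, hs⟩, h5.symm'⟩, ⟨hs, h3.2⟩, ?_⟩
        rw [← List.append_assoc] at h4
        exact (h5.right [a]).trans' h4
  have fin : ∀ v : List α, IsReg {p | ∃ x ∈ L, ∃ y ∈ L,
      WordEq R (expandW Blk.g x ++ v) (expandW Blk.g y) ∧ p = padR x y} := by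
    intro v
    convert (S v).reg using 1
    ext p
    simp only [Set.mem_ofPred_eq]
    constructor
    · rintro ⟨x, hx, y, hy, h, e⟩; exact ⟨x, y, ⟨⟨hx, hy⟩, h⟩, e⟩
    · rintro ⟨x, y, ⟨⟨hx, hy⟩, h⟩, e⟩; exact ⟨x, hx, y, hy, h, e⟩
  refine ⟨fun b => b.2.1, hreg, fun w hw => hw.2.2, onto, ?_, fun b => fin _⟩
  have := fin []
  simpa only [List.append_nil] using this

theorem LC_pre_closed (y : α) (M : ℕ) (hM : 1 ≤ M) (u : List α) (p q : List (Blk α M))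
    (hq : q ∈ LC y M u) (h : p <+: q) (hp : p ≠ []) : p ∈ LC y M u := by
  obtain ⟨s, rfl⟩ := h
  refine ⟨validC_pre_closed y M hM _ _ hq.1, ?_, hp⟩
  intro h
  apply hq.2.1
  rw [expandW_append]
  exact List.infix_append_of_infix_left h

end Structure


section Adjoin

variable {α β : Type}

theorem wordEq_nil_iff {R : Set (List α × List α)} (hR : ∀ p ∈ R, p.1 ≠ [] ∧ p.2 ≠ [])
    {p q : List α} (h : WordEq R p q) : p = [] ↔ q = [] := by
  induction h with
  | rel a b h =>
    obtain ⟨p', u, v, s', h1, rfl, rfl⟩ := h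
    have := hR _ h1
    simp_all
  | refl a => rfl
  | symm a b _ ih => exact ih.symm
  | trans a b c _ _ ih1 ih2 => exact ih1.trans ih2

theorem adj_ne {R : Set (List α × List α)} (hR : ∀ p ∈ R, p.1 ≠ [] ∧ p.2 ≠ []) :
    ∀ p ∈ adjoinOne R, p.1 ≠ [] ∧ p.2 ≠ [] := by
  rintro p (((⟨q, hq, rfl⟩ | ⟨a, rfl⟩) | ⟨a, rfl⟩) | rfl)
  · simpa using hR q hq
  · simp
  · simp
  · simp

theorem wordEq_reduce {R : Set (List α × List α)} {p q : List (Option α)}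
    (h : WordEq (adjoinOne R) p q) : WordEq R p.reduceOption q.reduceOption := by
  induction h with
  | rel a b h =>
    obtain ⟨p', u, v, s', h1, rfl, rfl⟩ := h
    simp only [List.reduceOption_append]
    apply WordEq.congr
    rcases h1 with ((⟨q, hq, e⟩ | ⟨a, e⟩) | ⟨a, e⟩) | e
    rotate_left 3
    · change (u, v) = _ at e
      rw [Prod.mk.injEq] at e
      rw [e.1, e.2]
      exact WordEq.rfl' _
    · rw [Prod.mk.injEq] at e
      rw [e.1, e.2]
      have r : ∀ l : List α, (l.map some).reduceOption = l := by
        intro l; simp [List.reduceOption]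
      rw [r, r]
      exact Relation.EqvGen.rel _ _ ⟨[], q.1, q.2, [], hq, by simp, by simp⟩
    all_goals
      rw [Prod.mk.injEq] at e
      rw [e.1, e.2]
      exact WordEq.rfl' _
  | refl a => exact WordEq.rfl' _
  | symm a b _ ih => exact ih.symm'
  | trans a b c _ _ ih1 ih2 => exact ih1.trans' ih2

theorem wordEq_map_some {R : Set (List α × List α)} {p q : List α}
    (h : WordEq R p q) : WordEq (adjoinOne R) (p.map some) (q.map some) := by
  induction h with
  | rel a b h =>
    obtain ⟨p', u, v, s', h1, rfl, rfl⟩ := h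
    exact Relation.EqvGen.rel _ _ ⟨p'.map some, u.map some, v.map some, s'.map some,
      Or.inl (Or.inl (Or.inl ⟨_, h1, rfl⟩)), by simp, by simp⟩
  | refl a => exact WordEq.rfl' _
  | symm a b _ ih => exact ih.symm'
  | trans a b c _ _ ih1 ih2 => exact ih1.trans' ih2

theorem wordEq_of_mem {R : Set (List α × List α)} {p q : List α} (h : (p, q) ∈ R) :
    WordEq R p q := Relation.EqvGen.rel _ _ ⟨[], p, q, [], h, by simp, by simp⟩

theorem wordEq_nf (R : Set (List α × List α)) (w : List (Option α)) (hw : w ≠ []) :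
    (w.reduceOption = [] → WordEq (adjoinOne R) w [none]) ∧
    (w.reduceOption ≠ [] → WordEq (adjoinOne R) w (w.reduceOption.map some)) := by
  induction w with
  | nil => exact absurd rfl hw
  | cons a w ih =>
    have m1 : ∀ b, WordEq (adjoinOne R) [none, some b] [some b] := fun b =>
      wordEq_of_mem (Or.inl (Or.inl (Or.inr ⟨b, rfl⟩)))
    have m2 : ∀ b, WordEq (adjoinOne R) [some b, none] [some b] := fun b =>
      wordEq_of_mem (Or.inl (Or.inr ⟨b, rfl⟩))
    have m3 : WordEq (adjoinOne R) [none, none] [none] := wordEq_of_mem (Or.inr rfl)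
    by_cases hw0 : w = []
    · subst hw0
      cases a with
      | none => exact ⟨fun _ => WordEq.rfl' _, fun h => absurd rfl h⟩
      | some b => exact ⟨fun h => by simp at h, fun _ => WordEq.rfl' _⟩
    · obtain ⟨i1, i2⟩ := ih hw0
      cases a with
      | none =>
        rw [List.reduceOption_cons_of_none]
        constructor
        · intro h
          exact ((i1 h).left [none]).trans' m3
        · intro h
          refine ((i2 h).left [none]).trans' ?_
          obtain ⟨b, l, e⟩ := List.exists_cons_of_ne_nil h
          rw [e]
          exact (m1 b).right (l.map some)
      | some b =>
        rw [List.reduceOption_cons_of_some]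
        refine ⟨fun h => by simp at h, fun _ => ?_⟩
        by_cases h : w.reduceOption = []
        · rw [h]
          exact ((i1 h).left [some b]).trans' (m2 b)
        · exact (i2 h).left [some b]

theorem adj_iff {R : Set (List α × List α)} (hR : ∀ p ∈ R, p.1 ≠ [] ∧ p.2 ≠ [])
    {p q : List (Option α)} (hp : p ≠ []) (hq : q ≠ []) :
    WordEq (adjoinOne R) p q ↔ WordEq R p.reduceOption q.reduceOption := by
  refine ⟨wordEq_reduce, fun h => ?_⟩
  have h2 := wordEq_nil_iff hR h
  by_cases h0 : p.reduceOption = []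
  · exact ((wordEq_nf R p hp).1 h0).trans' ((wordEq_nf R q hq).1 (h2.1 h0)).symm'
  · exact (((wordEq_nf R p hp).2 h0).trans' (wordEq_map_some h)).trans'
      ((wordEq_nf R q hq).2 (fun h => h0 (h2.2 h))).symm'

theorem padR_map (f : α → β) (x y : List α) : padR (x.map f) (y.map f) =
    (padR x y).map (Prod.map (Option.map f) (Option.map f)) := by
  simp only [padR, List.length_map]
  rw [← List.zip_map]
  simp [Function.comp_def]

/-- Generators for the monoid with adjoined identity. -/
def gA (g : β → List α) : Option β → List (Option α)
  | none => [none]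
  | some b => (g b).map some

def LA (L : Set (List β)) : Set (List (Option β)) := {l | ∃ l' ∈ L, l = l'.map some} ∪ {[none]}

theorem red_map_some (l : List α) : (l.map some).reduceOption = l := by simp [List.reduceOption]

theorem expandW_gA (g : β → List α) (l : List β) :
    expandW (gA g) (l.map some) = (expandW g l).map some := by
  induction l with
  | nil => rfl
  | cons b l ih => rw [List.map_cons, expandW_cons, expandW_cons, ih, List.map_append]; rfl

theorem adj_struct {R : Set (List α × List α)} (hR : ∀ p ∈ R, p.1 ≠ [] ∧ p.2 ≠ [])
    {g : β → List α} {L : Set (List β)} (h : SgpAutoStruct R g L)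
    (hpre : ∀ p q, q ∈ L → p <+: q → p ≠ [] → p ∈ L)
    (huniq : ∀ p ∈ L, ∀ q ∈ L, WordEq R (expandW g p) (expandW g q) → p = q) :
    SgpPrefixAutoStruct (adjoinOne R) (gA g) (LA L) := by
  have gne : ∀ b, gA g b ≠ [] := by
    intro b
    cases b with
    | none => simp [gA]
    | some b => simpa [gA] using h.gen_ne b
  have Lne : ∀ w ∈ LA L, w ≠ [] := by
    rintro w (⟨l, hl, rfl⟩ | rfl)
    · simpa using h.ne l hl
    · simp
  have exp_ne' : ∀ l : List (Option β), l ≠ [] → expandW (gA g) l ≠ [] := by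
    intro l hl
    obtain ⟨b, l', rfl⟩ := List.exists_cons_of_ne_nil hl
    rw [expandW_cons]
    intro h
    exact gne b (List.append_eq_nil_iff.1 h).1
  have exp_ne : ∀ l : List β, l ≠ [] → expandW g l ≠ [] := by
    intro l hl
    obtain ⟨b, l', rfl⟩ := List.exists_cons_of_ne_nil hl
    rw [expandW_cons]
    intro hh
    exact h.gen_ne b (List.append_eq_nil_iff.1 hh).1
  have Lreg : IsReg (LA L) := reg_union (reg_map some h.reg) (reg_singleton _)
  have e0 : expandW (gA g) [none] = [none] := rfl
  have r0 : ([none] : List (Option α)).reduceOption = [] := rfl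
  have onto : ∀ w : List (Option α), w ≠ [] →
      ∃ x ∈ LA L, WordEq (adjoinOne R) (expandW (gA g) x) w := by
    intro w hw
    by_cases h0 : w.reduceOption = []
    · refine ⟨[none], Or.inr rfl, ?_⟩
      rw [adj_iff hR (exp_ne' _ (by simp)) hw, h0]
      exact WordEq.rfl' _
    · obtain ⟨x, hx, hx2⟩ := h.onto _ h0
      refine ⟨x.map some, Or.inl ⟨x, hx, rfl⟩, ?_⟩
      rw [adj_iff hR (exp_ne' _ (by simpa using h.ne x hx)) hw, expandW_gA, red_map_some]
      exact hx2
  have eqreg : IsReg {p | ∃ x ∈ LA L, ∃ y ∈ LA L,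
      WordEq (adjoinOne R) (expandW (gA g) x) (expandW (gA g) y) ∧ p = padR x y} := by
    convert reg_union (reg_map (Prod.map (Option.map some) (Option.map some)) h.eq_reg)
      (reg_singleton (padR [none] [none])) using 1
    ext p
    constructor
    · rintro ⟨x, hx, y, hy, hxy, rfl⟩
      rw [adj_iff hR (exp_ne' _ (Lne _ hx)) (exp_ne' _ (Lne _ hy))] at hxy
      rcases hx with ⟨x, hx, rfl⟩ | rfl <;> rcases hy with ⟨y, hy, rfl⟩ | rfl
      · rw [expandW_gA, expandW_gA, red_map_some, red_map_some] at hxy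
        exact Or.inl ⟨_, ⟨x, hx, y, hy, hxy, rfl⟩, padR_map _ _ _⟩
      · rw [expandW_gA, e0, r0, red_map_some] at hxy
        exact absurd ((wordEq_nil_iff hR hxy).2 rfl) (exp_ne _ (h.ne _ hx))
      · rw [expandW_gA, e0, r0, red_map_some] at hxy
        exact absurd ((wordEq_nil_iff hR hxy).1 rfl) (exp_ne _ (h.ne _ hy))
      · exact Or.inr rfl
    · rintro (⟨_, ⟨x, hx, y, hy, hxy, rfl⟩, rfl⟩ | rfl)
      · refine ⟨x.map some, Or.inl ⟨x, hx, rfl⟩, y.map some, Or.inl ⟨y, hy, rfl⟩, ?_,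
          (padR_map _ _ _).symm⟩
        rw [expandW_gA, expandW_gA]
        exact wordEq_map_some hxy
      · exact ⟨[none], Or.inr rfl, [none], Or.inr rfl, WordEq.rfl' _, rfl⟩
  refine ⟨⟨gne, Lreg, Lne, onto, eqreg, ?_⟩, ?_⟩
  · intro b
    cases b with
    | none =>
      convert eqreg using 1
      ext p
      have key : ∀ x ∈ LA L, ∀ y ∈ LA L,
          (WordEq (adjoinOne R) (expandW (gA g) x ++ gA g none) (expandW (gA g) y) ↔
            WordEq (adjoinOne R) (expandW (gA g) x) (expandW (gA g) y)) := by
        intro x hx y hy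
        rw [adj_iff hR (exp_ne' _ (Lne _ hx)) (exp_ne' _ (Lne _ hy)), adj_iff hR _
          (exp_ne' _ (Lne _ hy)), List.reduceOption_append]
        · change WordEq R (_ ++ []) _ ↔ _
          rw [List.append_nil]
        · simp [gA]
      constructor
      · rintro ⟨x, hx, y, hy, hxy, rfl⟩
        exact ⟨x, hx, y, hy, (key x hx y hy).1 hxy, rfl⟩
      · rintro ⟨x, hx, y, hy, hxy, rfl⟩
        exact ⟨x, hx, y, hy, (key x hx y hy).2 hxy, rfl⟩
    | some b =>
      have sub : {p : List (Option (Option β) × Option (Option β)) | ∃ y ∈ L,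
          WordEq R (g b) (expandW g y) ∧ p = padR [none] (y.map some)}.Subsingleton := by
        rintro _ ⟨y, hy, h2, rfl⟩ _ ⟨y', hy', h2', rfl⟩
        rw [huniq y hy y' hy' (h2.symm'.trans' h2')]
      convert reg_union (reg_map (Prod.map (Option.map some) (Option.map some)) (h.mul_reg b))
        (reg_subsingleton sub) using 1
      ext p
      have ne2 : ∀ x, expandW (gA g) x ++ gA g (some b) ≠ [] := by
        intro x hx
        exact gne _ (List.append_eq_nil_iff.1 hx).2
      have rb : (gA g (some b)).reduceOption = g b := red_map_some _
      constructor
      · rintro ⟨x, hx, y, hy, hxy, rfl⟩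
        rw [adj_iff hR (ne2 _) (exp_ne' _ (Lne _ hy)), List.reduceOption_append, rb] at hxy
        rcases hy with ⟨y, hy, rfl⟩ | rfl
        · rcases hx with ⟨x, hx, rfl⟩ | rfl
          · rw [expandW_gA, expandW_gA, red_map_some, red_map_some] at hxy
            exact Or.inl ⟨_, ⟨x, hx, y, hy, hxy, rfl⟩, padR_map _ _ _⟩
          · rw [expandW_gA, e0, r0, red_map_some] at hxy
            exact Or.inr ⟨y, hy, hxy, rfl⟩
        · rw [e0, r0] at hxy
          exact absurd (List.append_eq_nil_iff.1 ((wordEq_nil_iff hR hxy).2 rfl)).2 (h.gen_ne b)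
      · rintro (⟨_, ⟨x, hx, y, hy, hxy, rfl⟩, rfl⟩ | ⟨y, hy, hxy, rfl⟩)
        · refine ⟨x.map some, Or.inl ⟨x, hx, rfl⟩, y.map some, Or.inl ⟨y, hy, rfl⟩, ?_,
            (padR_map _ _ _).symm⟩
          rw [expandW_gA, expandW_gA]
          change WordEq _ (_ ++ (g b).map some) _
          rw [← List.map_append]
          exact wordEq_map_some hxy
        · refine ⟨[none], Or.inr rfl, y.map some, Or.inl ⟨y, hy, rfl⟩, ?_, rfl⟩
          rw [adj_iff hR (ne2 _) (exp_ne' _ (by simpa using h.ne y hy)), List.reduceOption_append,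
            rb, e0, r0, expandW_gA, red_map_some]
          exact hxy
  · convert eqreg using 1
    ext p
    constructor
    · rintro ⟨x, hx, y, ⟨z, hz, hyz⟩, hxy, rfl⟩
      have hy0 : y ≠ [] := by
        rintro rfl
        exact exp_ne' _ (Lne _ hx) ((wordEq_nil_iff (adj_ne hR) hxy).2 rfl)
      refine ⟨x, hx, y, ?_, hxy, rfl⟩
      rcases hz with ⟨z, hz, rfl⟩ | rfl
      · obtain ⟨s, hs⟩ := hyz
        obtain ⟨y', s', rfl, rfl, -⟩ := List.map_eq_append_iff.1 hs.symm
        exact Or.inl ⟨y', hpre y' _ hz ⟨s', rfl⟩ (by simpa using hy0), rfl⟩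
      · rw [List.prefix_cons_iff] at hyz
        rcases hyz with rfl | ⟨t, rfl, ht⟩
        · exact absurd rfl hy0
        · rw [List.prefix_nil] at ht
          subst ht
          exact Or.inr rfl
    · rintro ⟨x, hx, y, hy, hxy, rfl⟩
      exact ⟨x, hx, y, ⟨y, hy, List.prefix_refl _⟩, hxy, rfl⟩

end Adjoin

/-- let `S = sgp⁺⟨α ∣ u = xy⟩` with `|u| = k ≥ 2` and `x, y`
letters, where `{u = xy}` is a Gröbner–Shirshov basis.  If the last two letters
of `u` do not form the word `xy` and `u ≠ y^(k-1)x`, then `S` is automatic and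
`S¹` (the monoid obtained by adjoining an identity) is prefix-automatic. -/
theorem statement_8 {α : Type} [Fintype α] (k : ℕ) (hk : 2 ≤ k)
    (u : List α) (hu : u.length = k) (x y : α)
    (R : Set (List α × List α)) (hRdef : R = {(u, [x, y])})
    (hGSB : ∀ w : List α, w ≠ [] →
      ∃! l : List α, (l ≠ [] ∧ ¬ u <:+: l) ∧ WordEq R l w)
    (h1 : u.drop (k - 2) ≠ [x, y])
    (h2 : u ≠ List.replicate (k - 1) y ++ [x]) :
    SgpAutomatic R ∧ SgpPrefixAutomatic (adjoinOne R) := by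
  subst hRdef
  have une : u ≠ [] := by
    rintro rfl
    simp at hu; omega
  obtain ⟨c, t, rfl⟩ : ∃ c t, u = c ++ [t] :=
    ⟨u.dropLast, u.getLast une, (List.dropLast_append_getLast une).symm⟩
  obtain ⟨M, rfl⟩ : ∃ M, k = M + 1 := ⟨k - 1, by omega⟩
  have hM : 1 ≤ M := by omega
  have hc : c.length = M := by simpa using hu
  have hRne : ∀ p ∈ ({(c ++ [t], [x, y])} : Set (List α × List α)), p.1 ≠ [] ∧ p.2 ≠ [] := by
    rintro p rfl
    simp
  have huniq : ∀ w w', w ≠ [] → w' ≠ [] → ¬ c ++ [t] <:+: w → ¬ c ++ [t] <:+: w' →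
      WordEq {(c ++ [t], [x, y])} w w' → w = w' := by
    intro w w' hw hw' h3 h4 h5
    exact (hGSB w' hw').unique ⟨⟨hw, h3⟩, h5⟩ ⟨⟨hw', h4⟩, WordEq.rfl' _⟩
  have hs := main_struct (R := {(c ++ [t], [x, y])}) c t x y M hM hc (wordEq_of_mem rfl) (by
      intro h
      apply h1
      rw [List.suffix_iff_eq_drop, hu] at h
      exact h.symm) h2 huniq (by
      intro w hw
      obtain ⟨l, ⟨⟨h3, h4⟩, h5⟩, -⟩ := hGSB w hw
      exact ⟨l, h3, h4, h5⟩)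
  have hfin : Finite (Blk α M) :=
    ((List.finite_length_le α M).subset (fun l (hl : l ≠ [] ∧ l.length ≤ M) => hl.2)).to_subtype
  have hne : ∀ p ∈ LC y M (c ++ [t]), expandW Blk.g p ≠ [] := by
    intro p hp
    obtain ⟨b, q', rfl⟩ := List.exists_cons_of_ne_nil hp.2.2
    rw [expandW_cons]
    intro h
    exact b.2.1 (List.append_eq_nil_iff.1 h).1
  refine ⟨⟨Blk α M, Fintype.ofFinite _, _, _, hs⟩,
    ⟨Option (Blk α M), Fintype.ofFinite _, _, _, adj_struct hRne hs ?_ ?_⟩⟩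
  · exact fun p q hq h hp => LC_pre_closed y M hM _ p q hq h hp
  · intro p hp q hq h
    exact validC_unique y M p q hp.1 hq.1
      (huniq _ _ (hne p hp) (hne q hq) hp.2.1 hq.2.1 h)
end

section
/- Let S = sgp^+⟨a, b | a^k b^l = b^l⟩ with a ≠ b, k ≥ 1 and l ≥ 0. Then S is prefix-automatic if and only if l ≤ 1. Moreover, if l ≥ 2 then S is not even automatic. -/
namespace St9

/-! ### Regular languages -/

theorem reg_of_lin {γ : Type} {σ : Type} [Finite σ] (X : σ → Set (List γ))
    (δ : σ → γ → Set σ)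
    (h : ∀ s c w, c :: w ∈ X s ↔ ∃ t ∈ δ s c, w ∈ X t) (s : σ) : IsReg (X s) := by
  classical
  have := Fintype.ofFinite σ
  let M : NFA γ σ := ⟨δ, {s}, {s | [] ∈ X s}⟩
  have key : ∀ (w : List γ) (S : Set σ), w ∈ M.acceptsFrom S ↔ ∃ s ∈ S, w ∈ X s := by
    intro w
    induction w with
    | nil => intro S; rw [NFA.nil_mem_acceptsFrom]; rfl
    | cons c w ih =>
      intro S
      rw [NFA.cons_mem_acceptsFrom, ih]
      constructor
      · rintro ⟨t, ht, hw⟩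
        obtain ⟨s, hs, hst⟩ := (NFA.mem_stepSet (M := M)).1 ht
        exact ⟨s, hs, (h s c w).2 ⟨t, hst, hw⟩⟩
      · rintro ⟨s, hs, hw⟩
        obtain ⟨t, ht, hw⟩ := (h s c w).1 hw
        exact ⟨t, (NFA.mem_stepSet (M := M)).2 ⟨s, hs, ht⟩, hw⟩
  refine ⟨Set σ, inferInstance, M.toDFA, ?_⟩
  rw [NFA.toDFA_correct, NFA.accepts_eq_acceptsFrom_start]
  ext w
  rw [key]
  show (∃ t ∈ ({s} : Set σ), w ∈ X t) ↔ w ∈ X s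
  simp

theorem reg_concat {β γ : Type} {L : Set (List β)} {K : Set (List γ)} (D : β → γ)
    (hL : IsReg L) (hK : IsReg K) :
    IsReg {p | ∃ x ∈ L, ∃ t ∈ K, p = x.map D ++ t} := by
  obtain ⟨σ, _, M, hM⟩ := hL
  obtain ⟨τ, _, N, hN⟩ := hK
  let X : σ ⊕ τ → Set (List γ) := fun s => match s with
    | .inl s => {p | ∃ x ∈ M.acceptsFrom s, ∃ t ∈ K, p = x.map D ++ t}
    | .inr t => {p | p ∈ N.acceptsFrom t}
  let δ : σ ⊕ τ → γ → Set (σ ⊕ τ) := fun s c => match s with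
    | .inl s => {q | (∃ d, c = D d ∧ q = .inl (M.step s d)) ∨
        ([] ∈ M.acceptsFrom s ∧ q = .inr (N.step N.start c))}
    | .inr t => {.inr (N.step t c)}
  have hc1 : ∀ s c w, c :: w ∈ M.acceptsFrom s ↔ w ∈ M.acceptsFrom (M.step s c) :=
    fun s c w => Iff.rfl
  have hc2 : ∀ s c w, c :: w ∈ N.acceptsFrom s ↔ w ∈ N.acceptsFrom (N.step s c) :=
    fun s c w => Iff.rfl
  have hKN : ∀ t, t ∈ K ↔ t ∈ N.acceptsFrom N.start := by
    intro t; rw [← hN]; rfl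
  have key := reg_of_lin X δ (by
    rintro (s | t) c w
    · constructor
      · rintro ⟨x, hx, t, ht, he⟩
        cases x with
        | nil =>
          simp only [List.map_nil, List.nil_append] at he
          subst he
          exact ⟨.inr (N.step N.start c), Or.inr ⟨hx, rfl⟩, (hKN _).1 ht⟩
        | cons d x =>
          simp only [List.map_cons, List.cons_append, List.cons.injEq] at he
          obtain ⟨rfl, rfl⟩ := he
          exact ⟨.inl (M.step s d), Or.inl ⟨d, rfl, rfl⟩, x, hx, t, ht, rfl⟩
      · rintro ⟨q, (⟨d, rfl, rfl⟩ | ⟨hn, rfl⟩), hw⟩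
        · obtain ⟨x, hx, t, ht, rfl⟩ := hw
          exact ⟨d :: x, hx, t, ht, rfl⟩
        · exact ⟨[], hn, c :: w, (hKN _).2 hw, rfl⟩
    · constructor
      · intro hw
        exact ⟨_, rfl, hw⟩
      · rintro ⟨_, rfl, hw⟩
        exact hw) (.inl M.start)
  have : L = M.acceptsFrom M.start := hM.symm
  rw [this]
  exact key

theorem reg_finite {γ : Type} {L : Set (List γ)} (h : L.Finite) : IsReg L := by
  apply Language.IsRegular.of_finite_range_leftQuotient
  have hf : Set.Finite (⋃ w ∈ L, {s | s ∈ w.tails}) :=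
    h.biUnion fun w _ => List.finite_toSet _
  refine hf.finite_subsets.subset ?_
  rintro _ ⟨x, rfl⟩ y hy
  simp only [Set.mem_iUnion]
  exact ⟨x ++ y, hy, by simp⟩

theorem reg_univ {γ : Type} : IsReg (Set.univ : Set (List γ)) := by
  refine ⟨Unit, inferInstance, ⟨fun _ _ => (), (), Set.univ⟩, ?_⟩
  ext x
  exact ⟨fun _ => trivial, fun _ => trivial⟩

theorem reg_union {γ : Type} {L K : Set (List γ)} (h : IsReg L) (h' : IsReg K) :
    IsReg (L ∪ K) := Language.IsRegular.add h h'

theorem reg_diff {γ : Type} {L K : Set (List γ)} (h : IsReg L) (h' : IsReg K) :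
    IsReg (L \ K) := Language.IsRegular.inf h (Language.IsRegular.compl h')

/-! ### Padding -/

/-- The diagonal letter. -/
def dg {β : Type} (x : β) : Option β × Option β := (some x, some x)

theorem padR_nil {β : Type} : padR ([] : List β) [] = [] := rfl

theorem padR_append {β : Type} (w x y : List β) :
    padR (w ++ x) (w ++ y) = w.map dg ++ padR x y := by
  induction w with
  | nil => rfl
  | cons c w ih =>
    have : padR (c :: (w ++ x)) (c :: (w ++ y)) = dg c :: padR (w ++ x) (w ++ y) := by
      simp [padR, dg]
    simp [this, ih]

theorem padR_self {β : Type} (w : List β) : padR w w = w.map dg := by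
  have := padR_append w [] []
  simpa [padR_nil] using this

theorem padR_cons {β : Type} (c d : β) (x y : List β) :
    padR (c :: x) (d :: y) = (some c, some d) :: padR x y := by
  simp [padR]

theorem padR_nil_right {β : Type} (x : List β) :
    padR x [] = x.map fun c => (some c, none) := by
  induction x with
  | nil => rfl
  | cons c x ih =>
    have : padR (c :: x) [] = (some c, none) :: padR x [] := by
      simp [padR, List.replicate_succ]
    simp [this, ih]

theorem padR_nil_left {β : Type} (x : List β) :
    padR [] x = x.map fun c => (none, some c) := by
  induction x with
  | nil => rfl
  | cons c x ih =>
    have : padR [] (c :: x) = (none, some c) :: padR [] x := by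
      simp [padR, List.replicate_succ]
    simp [this, ih]

theorem padR_split {β : Type} (u y w : List β) (h : u.length = y.length) :
    padR (u ++ w) y = padR u y ++ w.map fun c => (some c, none) := by
  induction u generalizing y with
  | nil =>
    have : y = [] := by simpa using h.symm
    subst this
    simp [padR_nil, padR_nil_right]
  | cons c u ih =>
    cases y with
    | nil => simp at h
    | cons d y =>
      simp only [List.cons_append, padR_cons]
      rw [ih y (by simpa using h)]

theorem padR_inj {β : Type} {x y x' y' : List β} (h : padR x y = padR x' y') :
    x = x' ∧ y = y' := by
  have h1 : ∀ x y : List β, (padR x y).filterMap Prod.fst = x ∧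
      (padR x y).filterMap Prod.snd = y := by
    intro x
    induction x with
    | nil => intro y; rw [padR_nil_left]; simp [List.filterMap_map, Function.comp_def]
    | cons c x ih =>
      intro y
      cases y with
      | nil => rw [padR_nil_right]; simp [List.filterMap_map, Function.comp_def]
      | cons d y => simp [padR_cons, ih y]
  exact ⟨by rw [← (h1 x y).1, h, (h1 x' y').1], by rw [← (h1 x y).2, h, (h1 x' y').2]⟩

/-! ### Word equality -/

section WE
variable {α : Type} {R : Set (List α × List α)}

theorem we_refl (x : List α) : WordEq R x x := Relation.EqvGen.refl x

theorem we_symm {x y : List α} (h : WordEq R x y) : WordEq R y x := Relation.EqvGen.symm _ _ h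

theorem we_trans {x y z : List α} (h : WordEq R x y) (h' : WordEq R y z) : WordEq R x z :=
  Relation.EqvGen.trans _ _ _ h h'

theorem we_rel {u v : List α} (h : (u, v) ∈ R) : WordEq R u v :=
  Relation.EqvGen.rel _ _ ⟨[], u, v, [], h, by simp, by simp⟩

theorem we_ctx (p s : List α) {x y : List α} (h : WordEq R x y) :
    WordEq R (p ++ x ++ s) (p ++ y ++ s) := by
  induction h with
  | rel x y h =>
    obtain ⟨p', u, v, s', hR, rfl, rfl⟩ := h
    exact Relation.EqvGen.rel _ _ ⟨p ++ p', u, v, s' ++ s, hR, by simp, by simp⟩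
  | refl x => exact we_refl _
  | symm x y _ ih => exact we_symm ih
  | trans x y z _ _ ih1 ih2 => exact we_trans ih1 ih2

theorem we_left (p : List α) {x y : List α} (h : WordEq R x y) :
    WordEq R (p ++ x) (p ++ y) := by simpa using we_ctx p [] h

theorem we_right (s : List α) {x y : List α} (h : WordEq R x y) :
    WordEq R (x ++ s) (y ++ s) := by simpa using we_ctx [] s h

theorem we_inv {T : Type} (f : List α → T)
    (hf : ∀ p u v s, (u, v) ∈ R → f (p ++ u ++ s) = f (p ++ v ++ s))
    {x y : List α} (h : WordEq R x y) : f x = f y := by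
  induction h with
  | rel x y h =>
    obtain ⟨p', u, v, s', hR, rfl, rfl⟩ := h
    exact hf _ _ _ _ hR
  | refl x => rfl
  | symm x y _ ih => exact ih.symm
  | trans x y z _ _ ih1 ih2 => exact ih1.trans ih2

end WE

theorem expandW_append {α β : Type} (g : β → List α) (x y : List β) :
    expandW g (x ++ y) = expandW g x ++ expandW g y := by simp [expandW]

theorem expandW_cons {α β : Type} (g : β → List α) (x : β) (y : List β) :
    expandW g (x :: y) = g x ++ expandW g y := by simp [expandW]

theorem expandW_nil {α β : Type} (g : β → List α) : expandW g [] = [] := rfl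

/-! ### The case `2 ≤ l` -/

theorem infix_a {α : Type} {a b : α} (hab : a ≠ b) {l : ℕ} (hl : 1 ≤ l) (n : ℕ) {w : List α}
    (h : List.replicate l b <:+: List.replicate n a ++ w) : List.replicate l b <:+: w := by
  induction n with
  | zero => simpa using h
  | succ n ih =>
    rw [List.replicate_succ, List.cons_append, List.infix_cons_iff] at h
    rcases h with h | h
    · obtain ⟨l, rfl⟩ : ∃ m, l = m + 1 := ⟨l - 1, by omega⟩
      rw [List.replicate_succ, List.cons_prefix_cons] at h
      exact absurd h.1.symm hab
    · exact ih h

theorem infix_ba {α : Type} {a b : α} (hab : a ≠ b) {l : ℕ} (hl : 2 ≤ l) {w : List α}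
    (h : List.replicate l b <:+: b :: a :: w) : List.replicate l b <:+: a :: w := by
  rw [List.infix_cons_iff] at h
  rcases h with h | h
  · obtain ⟨l, rfl⟩ : ∃ m, l = m + 2 := ⟨l - 2, by omega⟩
    rw [List.replicate_succ, List.cons_prefix_cons, List.replicate_succ,
      List.cons_prefix_cons] at h
    exact absurd h.2.1.symm hab
  · exact h

/-- The word `(a^k b)^m a^k z`. -/
def zig {α : Type} (a b : α) (k : ℕ) (z : List α) : ℕ → List α
  | 0 => List.replicate k a ++ z
  | m + 1 => List.replicate k a ++ b :: zig a b k z m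

theorem zig_append {α : Type} (a b : α) (k : ℕ) (z z' : List α) (m : ℕ) :
    zig a b k z m ++ z' = zig a b k (z ++ z') m := by
  induction m with
  | zero => simp [zig]
  | succ m ih => simp [zig, ih]

theorem zig_count {α : Type} [DecidableEq α] {a b : α} (hab : a ≠ b) (k : ℕ) (z : List α)
    (m : ℕ) : (zig a b k z m).count b = m + z.count b := by
  induction m with
  | zero => simp [zig, List.count_replicate, hab]
  | succ m ih => simp [zig, List.count_replicate, hab, ih]; omega

theorem zig_no_run {α : Type} {a b : α} (hab : a ≠ b) {l : ℕ} (hl : 2 ≤ l) {k : ℕ} (hk : 1 ≤ k)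
    (z : List α) (m : ℕ) (h : List.replicate l b <:+: zig a b k z m) :
    List.replicate l b <:+: z := by
  induction m with
  | zero => exact infix_a hab (by omega) k h
  | succ m ih =>
    have h1 := infix_a hab (by omega) k h
    obtain ⟨k, rfl⟩ : ∃ j, k = j + 1 := ⟨k - 1, by omega⟩
    have : ∃ w, zig a b (k + 1) z m = a :: w := by
      cases m <;> simp [zig, List.replicate_succ]
    obtain ⟨w, hw⟩ := this
    rw [hw] at h1 ih
    exact ih (infix_ba hab hl h1)

section Rel
variable {α : Type} {a b : α} {k l : ℕ} {R : Set (List α × List α)}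

theorem we_alone (hRdef : R = {(List.replicate k a ++ List.replicate l b, List.replicate l b)})
    {x y : List α} (h : WordEq R x y) (hy : ¬ List.replicate l b <:+: y) : x = y := by
  have h2 : (fun z => z = y) x = (fun z => z = y) y := by
    refine we_inv (R := R) (fun z => z = y) ?_ h
    intro p u v s huv
    rw [hRdef] at huv
    simp only [Set.mem_singleton_iff, Prod.mk.injEq] at huv
    obtain ⟨rfl, rfl⟩ := huv
    apply propext
    constructor
    · rintro rfl
      exact absurd ⟨p ++ List.replicate k a, s, by simp⟩ hy
    · rintro rfl
      exact absurd ⟨p, s, by simp⟩ hy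
  simpa using h2

theorem we_pow (hRdef : R = {(List.replicate k a ++ List.replicate l b, List.replicate l b)})
    (N : ℕ) (s : List α) :
    WordEq R (List.replicate (k * N) a ++ (List.replicate l b ++ s))
      (List.replicate l b ++ s) := by
  induction N with
  | zero => exact we_refl _
  | succ N ih =>
    rw [Nat.mul_succ, List.replicate_add]
    refine we_trans ?_ ih
    have h1 : WordEq R (List.replicate k a ++ List.replicate l b) (List.replicate l b) :=
      we_rel (by rw [hRdef]; rfl)
    simpa only [List.append_assoc] using we_ctx (List.replicate (k * N) a) s h1

theorem we_zig (hRdef : R = {(List.replicate k a ++ List.replicate l b, List.replicate l b)})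
    (m : ℕ) :
    WordEq R (zig a b k (List.replicate l b) m) (List.replicate (m + l) b) := by
  induction m with
  | zero => simpa [zig] using we_pow hRdef 1 []
  | succ m ih =>
    have h1 := we_ctx (List.replicate k a ++ [b]) [] ih
    have h2 := we_pow hRdef 1 (List.replicate (m + 1) b)
    simp only [mul_one, List.append_nil, List.append_assoc, List.singleton_append] at h1 h2
    refine we_trans h1 ?_
    have e : b :: List.replicate (m + l) b = List.replicate l b ++ List.replicate (m + 1) b := by
      rw [← List.replicate_succ, ← List.replicate_add]; congr 1; omega
    rw [e]
    refine we_trans h2 ?_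
    rw [← List.replicate_add]
    rw [show l + (m + 1) = m + 1 + l by omega]
    exact we_refl _

theorem not_auto (hab : a ≠ b) (hk : 1 ≤ k) (hl : 2 ≤ l)
    (hRdef : R = {(List.replicate k a ++ List.replicate l b, List.replicate l b)}) :
    ¬ SgpAutomatic R := by
  classical
  rintro ⟨β, _, g, L, hS⟩
  have hcount : ∀ {x y : List α}, WordEq R x y → x.count b = y.count b := by
    intro x y h
    refine we_inv (R := R) (fun z => z.count b) ?_ h
    intro p u v s huv
    rw [hRdef] at huv
    simp only [Set.mem_singleton_iff, Prod.mk.injEq] at huv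
    obtain ⟨rfl, rfl⟩ := huv
    simp [List.count_replicate, hab]
  -- a generator equal to `b`
  obtain ⟨b0, hb0⟩ : ∃ b0, g b0 = [b] := by
    obtain ⟨x, hx, hxe⟩ := hS.onto [b] (by simp)
    have h1 := we_alone hRdef hxe (by
      intro h; have := h.length_le; simp at this; omega)
    cases x with
    | nil => simp [expandW_nil] at h1
    | cons b0 x =>
      rw [expandW_cons] at h1
      refine ⟨b0, ?_⟩
      have := hS.gen_ne b0
      cases hg : g b0 with
      | nil => exact absurd hg this
      | cons c t => rw [hg] at h1; simp at h1; simp [h1]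
  -- length bound
  obtain ⟨C, hC⟩ : ∃ C, ∀ i, (g i).length ≤ C :=
    ⟨Finset.univ.sup fun i => (g i).length,
      fun i => Finset.le_sup (f := fun i => (g i).length) (Finset.mem_univ i)⟩
  have hlen : ∀ w : List β, (expandW g w).length ≤ C * w.length := by
    intro w
    induction w with
    | nil => simp [expandW_nil]
    | cons c w ih =>
      rw [expandW_cons, List.length_append, List.length_cons, Nat.mul_succ]
      have := hC c
      omega
  obtain ⟨σ, _, M, hM⟩ := hS.mul_reg b0
  have key : ∀ m : ℕ, ∃ u w y : List β, u.length = y.length ∧ u ++ w ∈ L ∧ y ∈ L ∧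
      (expandW g u).count b = 0 ∧ (expandW g w).count b = m + (l - 1) ∧
      (expandW g y).count b = m + l ∧
      WordEq R (expandW g (u ++ w) ++ g b0) (expandW g y) := by
    intro m
    obtain ⟨y, hy, hye⟩ := hS.onto (List.replicate (m + l) b) (by simp; omega)
    set N := C * y.length + 1 with hN
    obtain ⟨x, hx, hxe⟩ := hS.onto (List.replicate (k * N) a ++
      zig a b k (List.replicate (l - 1) b) m) (by
        have : k * N ≠ 0 := by positivity
        simp [this])
    have hx1 := we_alone hRdef hxe (by
      intro h
      have h1 := zig_no_run hab hl hk _ _ (infix_a hab (by omega) _ h)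
      have := h1.length_le; simp at this; omega)
    have hkN : N ≤ k * N := Nat.le_mul_of_pos_left _ hk
    have hyx : y.length ≤ x.length := by
      by_contra hlt
      have h1 := hlen x
      rw [hx1] at h1
      have h2 : C * x.length ≤ C * y.length := Nat.mul_le_mul_left _ (by omega)
      simp at h1
      omega
    have hspl : expandW g (x.take y.length) ++ expandW g (x.drop y.length) =
        List.replicate (k * N) a ++ zig a b k (List.replicate (l - 1) b) m := by
      rw [← expandW_append, List.take_append_drop, hx1]
    have hu : (expandW g (x.take y.length)).count b = 0 := by
      have hp : expandW g (x.take y.length) <+: List.replicate (k * N) a := by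
        refine List.prefix_of_prefix_length_le (l₃ := List.replicate (k * N) a ++
          zig a b k (List.replicate (l - 1) b) m) ⟨_, hspl⟩ ⟨_, rfl⟩ ?_
        have h1 := hlen (x.take y.length)
        rw [List.length_take, min_eq_left hyx] at h1
        rw [List.length_replicate]
        omega
      have := hp.sublist.count_le b
      simpa [List.count_replicate, hab] using this
    refine ⟨x.take y.length, x.drop y.length, y, by simp [hyx], by simpa using hx, hy, hu, ?_,
      ?_, ?_⟩
    · have := congrArg (List.count b) hspl
      simp only [List.count_append, hu, zig_count hab, List.count_replicate] at this
      simpa [hab] using this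
    · rw [hcount hye]; simp
    · rw [List.take_append_drop, hx1, hb0]
      refine we_trans ?_ (we_symm hye)
      rw [List.append_assoc, zig_append]
      have e : List.replicate (l - 1) b ++ [b] = List.replicate l b := by
        rw [← List.replicate_succ']; congr 1; omega
      rw [e]
      refine we_trans (we_left _ (we_zig hRdef m)) ?_
      rw [add_comm m l, List.replicate_add]
      exact we_pow hRdef N _
  choose u w y huy hL hy hu hw hyc hwe using key
  obtain ⟨m, n, hmn, hne⟩ : ∃ m n : ℕ, M.eval (padR (u m) (y m)) = M.eval (padR (u n) (y n)) ∧
      m ≠ n := by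
    by_contra hcon
    push Not at hcon
    exact not_injective_infinite_finite (fun m => M.eval (padR (u m) (y m)))
      fun m n h => hcon m n h
  have hacc : padR (u n ++ w n) (y n) ∈ M.accepts := by
    rw [hM]; exact ⟨_, hL n, _, hy n, hwe n, rfl⟩
  have hacc2 : padR (u m ++ w n) (y m) ∈ M.accepts := by
    rw [padR_split _ _ _ (huy _), DFA.mem_accepts, DFA.eval, DFA.evalFrom_of_append] at hacc ⊢
    have : M.evalFrom M.start (padR (u m) (y m)) = M.evalFrom M.start (padR (u n) (y n)) := hmn
    rw [this]
    exact hacc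
  rw [hM] at hacc2
  obtain ⟨x', _, y', _, he, hp⟩ := hacc2
  obtain ⟨rfl, rfl⟩ := padR_inj hp
  have := hcount he
  rw [expandW_append, hb0] at this
  simp only [List.count_append, hu, hw, hyc, List.count_singleton_self] at this
  omega

end Rel

/-! ### The case `l ≤ 1` -/

section Act
variable {α : Type} [DecidableEq α] {T : Type} [AddMonoidWithOne T] {k : ℕ}

/-- One letter acting on a normal form. -/
def stp (f : T → ZMod k) (a : α) (s : List (ZMod k) × T) (c : α) : List (ZMod k) × T :=
  if c = a then (s.1, s.2 + 1) else (s.1 ++ [f s.2], 0)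

/-- A word acting on a normal form. -/
def act (f : T → ZMod k) (a : α) (s : List (ZMod k) × T) (w : List α) : List (ZMod k) × T :=
  w.foldl (stp f a) s

theorem act_append (f : T → ZMod k) (a : α) (s : List (ZMod k) × T) (w v : List α) :
    act f a s (w ++ v) = act f a (act f a s w) v := by simp [act]

theorem act_rep (f : T → ZMod k) (a : α) (s : List (ZMod k) × T) (n : ℕ) :
    act f a s (List.replicate n a) = (s.1, s.2 + (n : T)) := by
  induction n with
  | zero => simp [act]
  | succ n ih =>
    rw [List.replicate_succ', act_append, ih]
    simp [act, stp, add_assoc]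

theorem act_b (f : T → ZMod k) {a b : α} (hab : a ≠ b) (s : List (ZMod k) × T) :
    act f a s [b] = (s.1 ++ [f s.2], 0) := by
  simp [act, stp, hab.symm]

/-- The generator `a^i b`. -/
def gi (a b : α) (i : ZMod k) : List α := List.replicate i.val a ++ [b]

theorem act_gi [NeZero k] (f : T → ZMod k) (hf : ∀ t (n : ℕ), f (t + n) = f t + n) {a b : α}
    (hab : a ≠ b) (s : List (ZMod k) × T) (i : ZMod k) :
    act f a s (gi a b i) = (s.1 ++ [f s.2 + i], 0) := by
  rw [gi, act_append, act_rep, act_b f hab, hf]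
  simp

/-- Canonical representative. -/
def can {γ : Type} (tl : T → List (ZMod k ⊕ γ)) (s : List (ZMod k) × T) : List (ZMod k ⊕ γ) :=
  s.1.map Sum.inl ++ tl s.2

theorem act_blocks [NeZero k] {γ : Type} (f : T → ZMod k)
    (hf : ∀ t (n : ℕ), f (t + n) = f t + n) (hf0 : f 0 = 0) {a b : α}
    (hab : a ≠ b) (g : ZMod k ⊕ γ → List α) (hg : ∀ i, g (.inl i) = gi a b i)
    (B : List (ZMod k)) :
    act f a ([], 0) (expandW g (B.map Sum.inl)) = (B, 0) := by
  induction B using List.reverseRecOn with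
  | nil => simp [expandW_nil, act]
  | append_singleton B i ih =>
    rw [List.map_append, expandW_append, act_append, ih]
    simp [expandW_cons, expandW_nil, hg, act_gi f hf hab, hf0]

theorem act_can [NeZero k] {γ : Type} (f : T → ZMod k)
    (hf : ∀ t (n : ℕ), f (t + n) = f t + n) (hf0 : f 0 = 0) {a b : α}
    (hab : a ≠ b) (g : ZMod k ⊕ γ → List α) (hg : ∀ i, g (.inl i) = gi a b i)
    (tl : T → List (ZMod k ⊕ γ))
    (htl : ∀ s t, act f a s (expandW g (tl t)) = (s.1, s.2 + t))
    (s : List (ZMod k) × T) :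
    act f a ([], 0) (expandW g (can tl s)) = s := by
  rw [can, expandW_append, act_append, act_blocks f hf hf0 hab g hg, htl]
  simp

theorem we_can [NeZero k] {γ : Type} {R : Set (List α × List α)} (f : T → ZMod k)
    {a b : α} (hA : ∀ x : α, x = a ∨ x = b)
    (hab : a ≠ b) (g : ZMod k ⊕ γ → List α) (hg : ∀ i, g (.inl i) = gi a b i)
    (tl : T → List (ZMod k ⊕ γ))
    (h0 : WordEq R [] (expandW g (tl 0)))
    (ha : ∀ t, WordEq R (expandW g (tl t) ++ [a]) (expandW g (tl (t + 1))))
    (hb : ∀ t, WordEq R (expandW g (tl t) ++ [b]) (gi a b (f t) ++ expandW g (tl 0)))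
    (w : List α) :
    WordEq R w (expandW g (can tl (act f a ([], 0) w))) := by
  induction w using List.reverseRecOn with
  | nil => simpa [act, can] using h0
  | append_singleton w c ih =>
    refine we_trans (we_right [c] ih) ?_
    rw [act_append]
    generalize act f a ([], 0) w = s
    rcases hA c with rfl | rfl
    · have h1 := we_left (expandW g (s.1.map Sum.inl)) (ha s.2)
      simpa [can, expandW_append, act, stp] using h1
    · have h1 := we_left (expandW g (s.1.map Sum.inl)) (hb s.2)
      simpa [can, expandW_append, expandW_cons, expandW_nil, act_b f hab, hg] using h1

theorem we_iff [NeZero k] {γ : Type} {R : Set (List α × List α)} (f : T → ZMod k)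
    {a b : α} (hA : ∀ x : α, x = a ∨ x = b)
    (hab : a ≠ b) (g : ZMod k ⊕ γ → List α) (hg : ∀ i, g (.inl i) = gi a b i)
    (tl : T → List (ZMod k ⊕ γ))
    (h0 : WordEq R [] (expandW g (tl 0)))
    (ha : ∀ t, WordEq R (expandW g (tl t) ++ [a]) (expandW g (tl (t + 1))))
    (hb : ∀ t, WordEq R (expandW g (tl t) ++ [b]) (gi a b (f t) ++ expandW g (tl 0)))
    (hR : ∀ s u v, (u, v) ∈ R → act f a s u = act f a s v)
    (w v : List α) :
    WordEq R w v ↔ act f a ([], 0) w = act f a ([], 0) v := by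
  constructor
  · intro h
    refine we_inv (R := R) (fun z => act f a ([], 0) z) ?_ h
    intro p u v s huv
    simp only [act_append, hR _ u v huv]
  · intro h
    have h1 := we_can (R := R) f hA hab g hg tl h0 ha hb w
    rw [h] at h1
    exact we_trans h1 (we_symm (we_can (R := R) f hA hab g hg tl h0 ha hb v))

end Act

theorem we_mod {α : Type} {a b : α} {k l : ℕ} {R : Set (List α × List α)}
    (hRdef : R = {(List.replicate k a ++ List.replicate l b, List.replicate l b)})
    {n m : ℕ} (h : (n : ZMod k) = m) :
    WordEq R (List.replicate n a ++ List.replicate l b)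
      (List.replicate m a ++ List.replicate l b) := by
  have key : ∀ n, WordEq R (List.replicate n a ++ List.replicate l b)
      (List.replicate (n % k) a ++ List.replicate l b) := by
    intro n
    have h1 := we_left (List.replicate (n % k) a) (we_pow hRdef (n / k) [])
    simp only [List.append_nil, ← List.append_assoc, ← List.replicate_add] at h1
    rwa [Nat.mod_add_div] at h1
  have h2 : n % k = m % k := (ZMod.natCast_eq_natCast_iff' n m k).1 h
  have h3 := key n
  rw [h2] at h3
  exact we_trans h3 (we_symm (key m))

theorem reg_pairs {δ γ T : Type} (x y : T → List (δ ⊕ γ))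
    (h : IsReg {p | ∃ t, p = padR (x t) (y t)}) :
    IsReg {p | ∃ (B : List δ) (t : T), p = padR (B.map Sum.inl ++ x t) (B.map Sum.inl ++ y t)} := by
  have h1 := reg_concat (fun d : δ => (dg (Sum.inl d : δ ⊕ γ))) reg_univ h
  convert h1 using 1
  ext p
  simp only [padR_append, List.map_map, Set.mem_setOf_eq, Set.mem_univ, true_and]
  constructor
  · rintro ⟨B, t, rfl⟩
    exact ⟨B, _, ⟨t, rfl⟩, rfl⟩
  · rintro ⟨B, _, ⟨t, rfl⟩, rfl⟩
    exact ⟨B, t, rfl⟩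

theorem reg_pairs_fin {δ γ T : Type} [Finite T] (x y : T → List (δ ⊕ γ)) :
    IsReg {p | ∃ (B : List δ) (t : T), p = padR (B.map Sum.inl ++ x t) (B.map Sum.inl ++ y t)} := by
  apply reg_pairs
  apply reg_finite
  refine (Set.finite_range fun t => padR (x t) (y t)).subset ?_
  rintro p ⟨t, rfl⟩
  exact ⟨t, rfl⟩

theorem prefix_blocks {δ γ : Type} {B : List δ} {y : List (δ ⊕ γ)}
    (h : y <+: B.map Sum.inl) : ∃ B' : List δ, y = B'.map Sum.inl := by
  rw [List.prefix_iff_eq_take] at h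
  exact ⟨B.take y.length, by rw [List.map_take]; exact h⟩

theorem auto_zero {α : Type} {a b : α} (hab : a ≠ b) (hA : ∀ x : α, x = a ∨ x = b) {k : ℕ}
    (hk : 1 ≤ k) {R : Set (List α × List α)}
    (hRdef : R = {(List.replicate k a ++ List.replicate 0 b, List.replicate 0 b)}) :
    SgpPrefixAutomatic R := by
  classical
  have : NeZero k := ⟨by omega⟩
  let g : ZMod k ⊕ ZMod k → List α := fun c => match c with
    | .inl i => gi a b i
    | .inr t => List.replicate (t.val + k) a
  let f : ZMod k → ZMod k := fun t => t
  let tl : ZMod k → List (ZMod k ⊕ ZMod k) := fun t => [.inr t]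
  have hg : ∀ i, g (.inl i) = gi a b i := fun _ => rfl
  have hgr : ∀ i, g (.inr i) = List.replicate (i.val + k) a := fun _ => rfl
  have hf : ∀ t (n : ℕ), f (t + n) = f t + n := fun _ _ => rfl
  have hte : ∀ t, expandW g (tl t) = List.replicate (t.val + k) a := by
    intro t; simp [tl, expandW, g]
  clear_value g
  have hmod : ∀ {n m : ℕ}, (n : ZMod k) = m →
      WordEq R (List.replicate n a) (List.replicate m a) := by
    intro n m h
    simpa using we_mod hRdef h
  have htl : ∀ s t, act f a s (expandW g (tl t)) = (s.1, s.2 + t) := by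
    intro s t
    rw [hte, act_rep]; simp
  have hiff := we_iff (R := R) f hA hab g hg tl
    (by rw [hte]; exact hmod (n := 0) (by simp))
    (by intro t; rw [hte, hte, ← List.replicate_succ']; exact hmod (by simp))
    (by
      intro t
      rw [hte, hte, gi]
      have h1 := we_right [b] (hmod (n := t.val + k) (m := t.val) (by simp))
      have h2 := we_left (List.replicate t.val a ++ [b])
        (hmod (n := 0) (m := (0 : ZMod k).val + k) (by simp))
      simp only [List.replicate_zero, List.append_nil] at h2
      exact we_trans h1 h2)
    (by
      intro s u v huv
      rw [hRdef] at huv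
      simp only [Set.mem_singleton_iff, Prod.mk.injEq] at huv
      obtain ⟨rfl, rfl⟩ := huv
      simp only [List.replicate_zero, List.append_nil]
      rw [act_rep]; simp [act])
  have hcan := act_can f hf rfl hab g hg tl htl
  have hbl := act_blocks f hf rfl hab g hg
  have hcc : ∀ s t, WordEq R (expandW g (can tl s)) (expandW g (can tl t)) ↔ s = t := by
    intro s t; rw [hiff, hcan, hcan]
  have hcm : ∀ s c t, WordEq R (expandW g (can tl s) ++ g c) (expandW g (can tl t)) ↔
      act f a s (g c) = t := by
    intro s c t; rw [hiff, act_append, hcan, hcan]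
  refine ⟨ZMod k ⊕ ZMod k, inferInstance, g, Set.range (can tl), ⟨⟨?_, ?_, ?_, ?_, ?_, ?_⟩, ?_⟩⟩
  · rintro (i | i)
    · rw [hg]; simp [gi]
    · rw [hgr]; simp; omega
  · have h1 := reg_concat (Sum.inl : ZMod k → ZMod k ⊕ ZMod k) reg_univ
      (reg_finite (Set.finite_range tl))
    convert h1 using 1
    ext p
    constructor
    · rintro ⟨s, rfl⟩
      exact ⟨s.1, trivial, _, ⟨s.2, rfl⟩, rfl⟩
    · rintro ⟨B, _, _, ⟨t, rfl⟩, rfl⟩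
      exact ⟨(B, t), rfl⟩
  · rintro _ ⟨s, rfl⟩
    simp [can, tl]
  · intro w _
    exact ⟨_, ⟨act f a ([], 0) w, rfl⟩, by rw [hiff, hcan]⟩
  · have h1 := reg_pairs_fin tl tl
    convert h1 using 1
    ext p
    constructor
    · rintro ⟨_, ⟨s, rfl⟩, _, ⟨t, rfl⟩, h, rfl⟩
      obtain rfl := (hcc s t).1 h
      exact ⟨s.1, s.2, rfl⟩
    · rintro ⟨B, t, rfl⟩
      exact ⟨_, ⟨(B, t), rfl⟩, _, ⟨(B, t), rfl⟩, we_refl _, rfl⟩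
  · rintro (i | i)
    · have h1 := reg_pairs_fin tl (fun t => Sum.inl (t + i) :: tl 0)
      convert h1 using 1
      ext p
      constructor
      · rintro ⟨_, ⟨s, rfl⟩, _, ⟨t, rfl⟩, h, rfl⟩
        replace h := (hcm _ _ _).1 h
        rw [hg, act_gi f hf hab] at h
        subst h
        exact ⟨s.1, s.2, by simp [can, f]⟩
      · rintro ⟨B, t, rfl⟩
        refine ⟨_, ⟨(B, t), rfl⟩, _, ⟨(B ++ [t + i], 0), rfl⟩, ?_, by simp [can]⟩
        refine (hcm _ _ _).2 ?_
        rw [hg, act_gi f hf hab]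
    · have h1 := reg_pairs_fin tl (fun t => tl (t + i))
      convert h1 using 1
      ext p
      constructor
      · rintro ⟨_, ⟨s, rfl⟩, _, ⟨t, rfl⟩, h, rfl⟩
        replace h := (hcm _ _ _).1 h
        rw [hgr, act_rep] at h
        subst h
        exact ⟨s.1, s.2, by simp [can]⟩
      · rintro ⟨B, t, rfl⟩
        refine ⟨_, ⟨(B, t), rfl⟩, _, ⟨(B, t + i), rfl⟩, ?_, by simp [can]⟩
        refine (hcm _ _ _).2 ?_
        rw [hgr, act_rep]; simp
  · have h1 := reg_union (reg_pairs_fin tl tl)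
      (reg_pairs_fin (fun _ : Unit => tl 0) (fun _ : Unit => []))
    convert h1 using 1
    ext p
    constructor
    · rintro ⟨_, ⟨s, rfl⟩, y, ⟨_, ⟨t, rfl⟩, hy⟩, h, rfl⟩
      rcases List.prefix_concat_iff.1 (show y <+: t.1.map Sum.inl ++ [.inr t.2] from hy)
        with h2 | h2
      · left
        have h3 : y = can tl t := h2
        subst h3
        obtain rfl := (hcc s t).1 h
        exact ⟨s.1, s.2, rfl⟩
      · right
        obtain ⟨B, rfl⟩ := prefix_blocks h2
        rw [hiff, hcan, hbl] at h
        subst h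
        exact ⟨B, (), by simp [can]⟩
    · rintro (⟨B, t, rfl⟩ | ⟨B, t, rfl⟩)
      · exact ⟨_, ⟨(B, t), rfl⟩, _, ⟨_, ⟨(B, t), rfl⟩, List.prefix_rfl⟩, we_refl _, rfl⟩
      · refine ⟨_, ⟨(B, 0), rfl⟩, B.map Sum.inl, ⟨_, ⟨(B, 0), rfl⟩, ⟨_, rfl⟩⟩, ?_, by simp [can]⟩
        rw [hiff, hcan, hbl]

theorem reg_count {k : ℕ} [NeZero k] (i : ZMod k) :
    IsReg {p : List (Option (ZMod k ⊕ Unit) × Option (ZMod k ⊕ Unit)) | ∃ j : ℕ,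
      p = padR (List.replicate j (Sum.inr ())) [Sum.inl ((j : ZMod k) + i)]} := by
  let A : Option (ZMod k ⊕ Unit) × Option (ZMod k ⊕ Unit) := (some (Sum.inr ()), none)
  let X : Option (Option (ZMod k)) →
      Set (List (Option (ZMod k ⊕ Unit) × Option (ZMod k ⊕ Unit))) := fun s => match s with
    | none => {p | ∃ j : ℕ,
        p = padR (List.replicate j (Sum.inr ())) [Sum.inl ((j : ZMod k) + i)]}
    | some none => {[]}
    | some (some r) => {p | ∃ n : ℕ, (n : ZMod k) = r ∧ p = List.replicate n A}
  let δ : Option (Option (ZMod k)) → Option (ZMod k ⊕ Unit) × Option (ZMod k ⊕ Unit) →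
      Set (Option (Option (ZMod k))) := fun s c => match s with
    | none => {q | (c = (none, some (Sum.inl i)) ∧ q = some none) ∨
        ∃ h, c = (some (Sum.inr ()), some (Sum.inl h)) ∧ q = some (some (h - i - 1))}
    | some none => ∅
    | some (some r) => {q | c = A ∧ q = some (some (r - 1))}
  refine reg_of_lin X δ ?_ none
  rintro (_ | _ | r) c w
  · constructor
    · rintro ⟨j, hj⟩
      cases j with
      | zero =>
        simp only [List.replicate_zero, padR_nil_left, List.map_cons, List.map_nil,
          List.cons.injEq, Nat.cast_zero, zero_add] at hj
        obtain ⟨rfl, rfl⟩ := hj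
        exact ⟨some none, Or.inl ⟨rfl, rfl⟩, rfl⟩
      | succ j =>
        rw [List.replicate_succ, padR_cons, padR_nil_right, List.map_replicate] at hj
        simp only [List.cons.injEq] at hj
        obtain ⟨rfl, rfl⟩ := hj
        exact ⟨_, Or.inr ⟨_, rfl, rfl⟩, j, by push_cast; ring, rfl⟩
    · rintro ⟨q, (⟨rfl, rfl⟩ | ⟨h, rfl, rfl⟩), hw⟩
      · have hw' : w = [] := hw
        subst hw'
        exact ⟨0, by simp [padR_nil_left]⟩
      · obtain ⟨n, hn, rfl⟩ := hw
        refine ⟨n + 1, ?_⟩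
        rw [List.replicate_succ, padR_cons, padR_nil_right, List.map_replicate]
        have : h = ((n + 1 : ℕ) : ZMod k) + i := by push_cast; rw [hn]; ring
        rw [this]
  · constructor
    · intro h
      exact absurd (show c :: w = [] from h) (by simp)
    · rintro ⟨q, hq, _⟩
      exact absurd hq (by simp [δ])
  · constructor
    · rintro ⟨n, hn, he⟩
      cases n with
      | zero => simp at he
      | succ n =>
        rw [List.replicate_succ, List.cons.injEq] at he
        exact ⟨_, ⟨he.1, rfl⟩, n, by rw [← hn]; push_cast; ring, he.2⟩
    · rintro ⟨q, ⟨rfl, rfl⟩, n, hn, rfl⟩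
      exact ⟨n + 1, by push_cast; rw [hn]; ring, by rw [List.replicate_succ]⟩

theorem reg_rep {γ : Type} (c : γ) : IsReg {p | ∃ n : ℕ, p = List.replicate n c} := by
  refine reg_of_lin (σ := Unit) (fun _ => {p | ∃ n : ℕ, p = List.replicate n c})
    (fun _ d => {_q | d = c}) ?_ ()
  intro _ d w
  constructor
  · rintro ⟨n, hn⟩
    cases n with
    | zero => simp at hn
    | succ n =>
      rw [List.replicate_succ, List.cons.injEq] at hn
      exact ⟨(), hn.1, n, hn.2⟩
  · rintro ⟨_, rfl, n, rfl⟩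
    exact ⟨n + 1, by rw [List.replicate_succ]⟩

theorem auto_one {α : Type} {a b : α} (hab : a ≠ b) (hA : ∀ x : α, x = a ∨ x = b) {k : ℕ}
    (hk : 1 ≤ k) {R : Set (List α × List α)}
    (hRdef : R = {(List.replicate k a ++ List.replicate 1 b, List.replicate 1 b)}) :
    SgpPrefixAutomatic R := by
  classical
  have : NeZero k := ⟨by omega⟩
  let g : ZMod k ⊕ Unit → List α := fun c => match c with
    | .inl i => gi a b i
    | .inr _ => [a]
  let f : ℕ → ZMod k := fun t => t
  let tl : ℕ → List (ZMod k ⊕ Unit) := fun t => List.replicate t (.inr ())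
  have hg : ∀ i, g (.inl i) = gi a b i := fun _ => rfl
  have hgr : ∀ i, g (.inr i) = [a] := fun _ => rfl
  have hf : ∀ t (n : ℕ), f (t + n) = f t + n := fun _ _ => by simp [f]
  have hf0 : f 0 = 0 := by simp [f]
  have hte : ∀ t, expandW g (tl t) = List.replicate t a := by
    intro t
    induction t with
    | zero => rfl
    | succ t ih =>
      have : tl (t + 1) = .inr () :: tl t := List.replicate_succ
      rw [this, expandW_cons, ih, List.replicate_succ]; rfl
  clear_value g
  have htl : ∀ s t, act f a s (expandW g (tl t)) = (s.1, s.2 + t) := by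
    intro s t
    rw [hte, act_rep]; simp
  have hiff := we_iff (R := R) f hA hab g hg tl
    (by rw [hte]; exact we_refl _)
    (by intro t; rw [hte, hte, ← List.replicate_succ']; exact we_refl _)
    (by
      intro t
      rw [hte, hte, gi]
      have h1 := we_mod hRdef (n := t) (m := (f t).val) (by simp [f])
      simpa using h1)
    (by
      intro s u v huv
      rw [hRdef] at huv
      simp only [Set.mem_singleton_iff, Prod.mk.injEq] at huv
      obtain ⟨rfl, rfl⟩ := huv
      simp only [List.replicate_one]
      rw [act_append, act_rep, act_b f hab, act_b f hab]; simp [f])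
  have hcan := act_can f hf hf0 hab g hg tl htl
  have hcc : ∀ s t, WordEq R (expandW g (can tl s)) (expandW g (can tl t)) ↔ s = t := by
    intro s t; rw [hiff, hcan, hcan]
  have hcm : ∀ s c t, WordEq R (expandW g (can tl s) ++ g c) (expandW g (can tl t)) ↔
      act f a s (g c) = t := by
    intro s c t; rw [hiff, act_append, hcan, hcan]
  have hnil : can tl ([], 0) = [] := rfl
  have hinj : ∀ s, can tl s = [] → s = ([], 0) := by
    intro s hs
    rw [← hcan s, hs]; rfl
  have hL : IsReg (Set.range (can tl) \ {[]}) := by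
    refine reg_diff ?_ (reg_finite (Set.finite_singleton _))
    have h1 := reg_concat (Sum.inl : ZMod k → ZMod k ⊕ Unit) reg_univ
      (reg_rep (Sum.inr ()))
    convert h1 using 1
    ext p
    constructor
    · rintro ⟨s, rfl⟩
      exact ⟨s.1, trivial, _, ⟨s.2, rfl⟩, rfl⟩
    · rintro ⟨B, _, _, ⟨t, rfl⟩, rfl⟩
      exact ⟨(B, t), rfl⟩
  have hE : IsReg {p | ∃ x ∈ Set.range (can tl) \ {[]}, p = padR x x} := by
    have h1 := reg_concat dg hL (reg_finite (Set.finite_singleton []))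
    convert h1 using 1
    ext p
    simp [padR_self]
  refine ⟨ZMod k ⊕ Unit, inferInstance, g, Set.range (can tl) \ {[]},
    ⟨⟨?_, hL, ?_, ?_, ?_, ?_⟩, ?_⟩⟩
  · rintro (i | i)
    · rw [hg]; simp [gi]
    · rw [hgr]; simp
  · rintro _ ⟨_, h⟩
    exact h
  · intro w hw
    refine ⟨can tl (act f a ([], 0) w), ⟨⟨_, rfl⟩, ?_⟩, by rw [hiff, hcan]⟩
    intro h
    have h1 : WordEq R w [] := by
      rw [hiff, hinj _ h]; rfl
    refine hw (we_alone hRdef h1 ?_)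
    simp
  · convert hE using 1
    ext p
    constructor
    · rintro ⟨_, ⟨⟨s, rfl⟩, hs⟩, _, ⟨⟨t, rfl⟩, _⟩, h, rfl⟩
      obtain rfl := (hcc s t).1 h
      exact ⟨_, ⟨⟨s, rfl⟩, hs⟩, rfl⟩
    · rintro ⟨x, hx, rfl⟩
      exact ⟨x, hx, x, hx, we_refl _, rfl⟩
  · rintro (i | i)
    · have h1 := reg_diff (reg_pairs tl (fun t => [Sum.inl ((t : ZMod k) + i)]) (reg_count i))
        (reg_finite (Set.finite_singleton [(none, some (Sum.inl i))]))
      convert h1 using 1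
      ext p
      constructor
      · rintro ⟨_, ⟨⟨s, rfl⟩, hs⟩, _, ⟨⟨t, rfl⟩, _⟩, h, rfl⟩
        replace h := (hcm _ _ _).1 h
        rw [hg, act_gi f hf hab] at h
        subst h
        have e : can tl (s.1 ++ [f s.2 + i], 0) =
            s.1.map Sum.inl ++ [Sum.inl ((s.2 : ZMod k) + i)] := by
          simp [can, f, tl]
        rw [e]
        refine ⟨⟨s.1, s.2, rfl⟩, ?_⟩
        intro hp
        have hp' : padR (can tl s) (s.1.map Sum.inl ++ [Sum.inl ((s.2 : ZMod k) + i)]) =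
          padR [] [Sum.inl i] := hp
        exact hs (padR_inj hp').1
      · rintro ⟨⟨B, t, rfl⟩, hp⟩
        refine ⟨can tl (B, t), ⟨⟨(B, t), rfl⟩, ?_⟩, can tl (B ++ [(t : ZMod k) + i], 0),
          ⟨⟨_, rfl⟩, ?_⟩, ?_, by simp [can, tl]⟩
        · intro h
          have h2 := hinj _ h
          simp only [Prod.mk.injEq] at h2
          obtain ⟨rfl, rfl⟩ := h2
          apply hp
          simp [tl, padR_nil_left]
        · simp [can]
        · refine (hcm _ _ _).2 ?_
          rw [hg, act_gi f hf hab]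
    · have h1 := reg_concat dg hL (reg_finite (Set.finite_singleton [(none, some (Sum.inr ()))]))
      have e : ∀ s, can tl (s.1, s.2 + 1) = can tl s ++ [Sum.inr ()] := by
        intro s; simp [can, tl, List.replicate_succ']
      have e2 : ∀ x : List (ZMod k ⊕ Unit), padR x (x ++ [Sum.inr ()]) =
          x.map dg ++ [(none, some (Sum.inr ()))] := by
        intro x
        have := padR_append x [] [Sum.inr ()]
        simpa [padR_nil_left] using this
      convert h1 using 1
      ext p
      constructor
      · rintro ⟨_, ⟨⟨s, rfl⟩, hs⟩, _, ⟨⟨t, rfl⟩, _⟩, h, rfl⟩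
        replace h := (hcm _ _ _).1 h
        rw [hgr] at h
        have h' := act_rep f a s 1
        rw [List.replicate_one, h] at h'
        subst h'
        exact ⟨_, ⟨⟨s, rfl⟩, hs⟩, _, rfl, by simp only [Nat.cast_one]; rw [e, e2]⟩
      · rintro ⟨_, ⟨⟨s, rfl⟩, hs⟩, _, rfl, rfl⟩
        refine ⟨_, ⟨⟨s, rfl⟩, hs⟩, can tl (s.1, s.2 + 1), ⟨⟨_, rfl⟩, ?_⟩, ?_, ?_⟩
        · rw [e]; simp
        · refine (hcm _ _ _).2 ?_
          rw [hgr]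
          have h' := act_rep f a s 1
          rw [List.replicate_one] at h'
          rw [h']; simp
        · rw [e, e2]
  · convert hE using 1
    ext p
    constructor
    · rintro ⟨_, ⟨⟨s, rfl⟩, hs⟩, y, ⟨_, ⟨⟨t, rfl⟩, _⟩, hy⟩, h, rfl⟩
      obtain ⟨t', rfl⟩ : ∃ t', y = can tl t' := by
        rw [List.prefix_iff_eq_take] at hy
        refine ⟨(t.1.take y.length, min (y.length - t.1.length) t.2), ?_⟩
        generalize y.length = n at hy
        rw [hy]
        simp [can, tl, List.take_append, List.take_replicate]
      obtain rfl := (hcc s t').1 h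
      exact ⟨_, ⟨⟨s, rfl⟩, hs⟩, rfl⟩
    · rintro ⟨x, hx, rfl⟩
      exact ⟨x, hx, x, ⟨x, hx, List.prefix_rfl⟩, we_refl _, rfl⟩

end St9

/-- the semigroup `S = sgp⁺⟨a, b ∣ aᵏbˡ = bˡ⟩` (`k ≥ 1`, `l ≥ 0`)
is prefix-automatic if and only if `l ≤ 1`; moreover for `l ≥ 2` it is not even
automatic. -/
theorem statement_9 {α : Type} [Fintype α] (a b : α) (hab : a ≠ b)
    (hA : ∀ x : α, x = a ∨ x = b) (k l : ℕ) (hk : 1 ≤ k)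
    (R : Set (List α × List α))
    (hRdef : R = {(List.replicate k a ++ List.replicate l b, List.replicate l b)}) :
    (SgpPrefixAutomatic R ↔ l ≤ 1) ∧ (2 ≤ l → ¬ SgpAutomatic R) := by
  have hneg : 2 ≤ l → ¬ SgpAutomatic R := fun hl => St9.not_auto hab hk hl hRdef
  refine ⟨⟨?_, ?_⟩, hneg⟩
  · rintro ⟨β, hβ, g, L, h⟩
    by_contra hl
    exact hneg (by omega) ⟨β, hβ, g, L, h.toSgpAutoStruct⟩
  · intro hl
    obtain rfl | rfl : l = 0 ∨ l = 1 := by omega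
    · exact St9.auto_zero hab hA hk hRdef
    · exact St9.auto_one hab hA hk hRdef
end
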